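/- arXiv:1303.6470 — 3 statements merged into one kernel-verified Lean document; each statement's English description precedes it below -/
import Mathlib

section
/- For integers n ≥ 2 and d ≥ 2, the k-vector space (Hom_{S̃}(B_{nd}, S̃/B_{nd}))₀ of degree-preserving S̃-module homomorphisms from B_{nd} to S̃/B_{nd} has dimension exactly n·d²·(d+n−1) − d² − (d+n−1)² + 1. -/
/-!
Statement 2: For `n, d ≥ 2` the dimension of the space of degree-zero homomorphisms
`(Hom_{S̃}(B_{nd}, S̃/B_{nd}))₀` (the tangent space of the Hilbert scheme at the box
polarization `B_{nd}`) equals `n·d²·(d+n−1) − d² − (d+n−1)² + 1`.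
-/

set_option synthInstance.maxHeartbeats 800000
set_option maxHeartbeats 1600000

open MvPolynomial

noncomputable section

/-- The box polarization `B_{nd}` of `m^d`:
the ideal of `S̃ = k[x_{ij}]` generated by the monomials `x_{i₁1}x_{i₂2}⋯x_{i_dd}`
with `i₁ ≤ i₂ ≤ ⋯ ≤ i_d`. -/
def BoxIdeal (k : Type) [Field k] (n d : ℕ) : Ideal (MvPolynomial (Fin n × Fin d) k) :=
  Ideal.span {f | ∃ i : Fin d → Fin n, Monotone i ∧ f = ∏ j : Fin d, X (i j, j)}

/-- The degree-preserving (degree zero) `S̃`-module homomorphisms `I → S̃/I`,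
as a `k`-subspace of `Hom_{S̃}(I, S̃/I)`. -/
def degZeroHom (k : Type) [Field k] (σ : Type) (I : Ideal (MvPolynomial σ k)) :
    Submodule k (↥I →ₗ[MvPolynomial σ k] (MvPolynomial σ k ⧸ I)) where
  carrier := {φ | ∀ (e : ℕ) (f : MvPolynomial σ k) (hf : f ∈ I), f.IsHomogeneous e →
      ∃ g : MvPolynomial σ k, g.IsHomogeneous e ∧ φ ⟨f, hf⟩ = Ideal.Quotient.mk I g}
  add_mem' := by
    intro φ ψ hφ hψ e f hf hfe
    obtain ⟨g, hg, hg'⟩ := hφ e f hf hfe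
    obtain ⟨g', hg2, hg2'⟩ := hψ e f hf hfe
    exact ⟨g + g', hg.add hg2, by rw [LinearMap.add_apply, hg', hg2', map_add]⟩
  zero_mem' := by
    intro e f hf hfe
    exact ⟨0, MvPolynomial.isHomogeneous_zero _ _ _, by rw [LinearMap.zero_apply, map_zero]⟩
  smul_mem' := by
    intro c φ hφ e f hf hfe
    obtain ⟨g, hg, hg'⟩ := hφ e f hf hfe
    refine ⟨c • g, ?_, ?_⟩
    · rw [MvPolynomial.smul_eq_C_mul]
      simpa using (MvPolynomial.isHomogeneous_C σ c).mul hg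
    · have : (c • φ) ⟨f, hf⟩ = c • (φ ⟨f, hf⟩) := rfl
      rw [this, hg']
      exact (Submodule.Quotient.mk_smul _ _ _).symm

namespace BoxPolarization

variable {k : Type} [Field k] {n d : ℕ}

/-- The exponent vector of the monomial `∏ j, x_{i j, j}`. -/
def pathExp (i : Fin d → Fin n) : Fin n × Fin d →₀ ℕ :=
  ∑ j, Finsupp.single (i j, j) 1

/-- The exponent vector of the monomial `∏ j ∈ J, x_{r, j}`. -/
def rowExp (r : Fin n) (J : Finset (Fin d)) : Fin n × Fin d →₀ ℕ :=
  ∑ j ∈ J, Finsupp.single (r, j) 1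

/-- The monomial with exponent vector `μ` lies in the box polarization. -/
def InBox (μ : Fin n × Fin d →₀ ℕ) : Prop :=
  ∃ q : Fin d → Fin n, Monotone q ∧ ∀ j, 0 < μ (q j, j)

lemma pathExp_apply (i : Fin d → Fin n) (r : Fin n) (j : Fin d) :
    pathExp i (r, j) = if i j = r then 1 else 0 := by
  classical
  simp only [pathExp, Finsupp.finsetSum_apply, Finsupp.single_apply, Prod.mk.injEq]
  rw [Finset.sum_eq_single j]
  · simp
  · intro b _ hb
    simp [hb]
  · simp

lemma rowExp_apply (s : Fin n) (J : Finset (Fin d)) (r : Fin n) (j : Fin d) :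
    rowExp s J (r, j) = if s = r ∧ j ∈ J then 1 else 0 := by
  classical
  simp only [rowExp, Finsupp.finsetSum_apply, Finsupp.single_apply, Prod.mk.injEq]
  by_cases hj : j ∈ J
  · rw [Finset.sum_eq_single j]
    · simp [hj]
    · intro b _ hb
      simp [hb]
    · simp [hj]
  · rw [Finset.sum_eq_zero]
    · simp [hj]
    · intro b hb
      have : b ≠ j := by rintro rfl; exact hj hb
      simp [this]

lemma degree_pathExp (i : Fin d → Fin n) : (pathExp i).degree = d := by
  simp [pathExp, map_sum]

lemma degree_rowExp (s : Fin n) (J : Finset (Fin d)) : (rowExp s J).degree = J.card := by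
  simp [rowExp, map_sum]

lemma eq_of_le_of_degree_eq {σ : Type*} {μ ν : σ →₀ ℕ} (h : μ ≤ ν) (hd : μ.degree = ν.degree) :
    μ = ν := by
  obtain ⟨τ, rfl⟩ := exists_add_of_le h
  rw [map_add] at hd
  have : τ = 0 := (Finsupp.degree_eq_zero_iff τ).1 (by omega)
  simp [this]

lemma exists_add_single_of_le {σ : Type*} {μ ν : σ →₀ ℕ} (h : μ ≤ ν)
    (hd : μ.degree + 1 = ν.degree) : ∃ w, ν = μ + Finsupp.single w 1 := by
  obtain ⟨τ, rfl⟩ := exists_add_of_le h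
  rw [map_add] at hd
  have : τ.degree = 1 := by omega
  obtain ⟨w, hw⟩ : ∃ w, τ = Finsupp.single w 1 := by
    have h0 : τ ≠ 0 := by rintro rfl; simp at this
    obtain ⟨w, hw⟩ := Finsupp.ne_iff.1 h0
    refine ⟨w, (eq_of_le_of_degree_eq ?_ (by simp [this])).symm⟩
    rw [Finsupp.single_le_iff]
    exact Nat.one_le_iff_ne_zero.2 hw
  exact ⟨w, by rw [hw]⟩

lemma eq_of_pos_of_degree {μ : Fin n × Fin d →₀ ℕ} (hdeg : μ.degree = d)
    (h : ∀ j, ∃ r, 0 < μ (r, j)) {j : Fin d} {r r' : Fin n} (hr : 0 < μ (r, j))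
    (hr' : 0 < μ (r', j)) : r = r' := by
  choose p hp using h
  have hle : pathExp p ≤ μ := by
    rintro ⟨r, j⟩
    rw [pathExp_apply]
    split_ifs with h
    · subst h; exact hp j
    · exact Nat.zero_le _
  have := eq_of_le_of_degree_eq hle (by rw [degree_pathExp, hdeg])
  subst this
  rw [pathExp_apply] at hr hr'
  grind

/-- The combinatorial conditions satisfied by the coefficients `c i μ` of the image of the
generator `∏ j, x_{i j, j}` under a homomorphism of degree zero. -/
structure TangentCoeff (c : (Fin d → Fin n) → (Fin n × Fin d →₀ ℕ) → k) : Prop where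
  degree_eq : ∀ {i μ}, Monotone i → c i μ ≠ 0 → μ.degree = d
  not_inBox : ∀ {i μ}, Monotone i → c i μ ≠ 0 → ¬ InBox μ
  exchange : ∀ {i μ} (i' : Fin d → Fin n), Monotone i → Monotone i' → c i μ ≠ 0 →
    (∃ q, Monotone q ∧ ∀ j, 0 < μ (q j, j) ∨ (q j = i' j ∧ i' j ≠ i j)) ∨
    ∃ μ', μ' + pathExp i = μ + pathExp i' ∧ c i' μ' = c i μ

variable {c : (Fin d → Fin n) → (Fin n × Fin d →₀ ℕ) → k}

lemma TangentCoeff.exists_const (hc : TangentCoeff c) (hd : 0 < d) {i : Fin d → Fin n}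
    {μ : Fin n × Fin d →₀ ℕ} (hi : Monotone i) (h : c i μ ≠ 0) :
    ∃ s μ', c (fun _ => s) μ' = c i μ := by
  by_contra! hno
  have key : ∀ s, ∃ q, Monotone q ∧ ∀ j, 0 < μ (q j, j) ∨ (q j = s ∧ s ≠ i j) := by
    intro s
    rcases hc.exchange (fun _ => s) hi monotone_const h with h1 | ⟨μ', -, h2⟩
    · exact h1
    · exact absurd h2 (hno s μ')
  have hne : ∀ j, ∃ r, 0 < μ (r, j) := by
    intro j
    obtain ⟨q, -, hq⟩ := key (i j)
    exact ⟨q j, (hq j).resolve_right (by simp)⟩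
  choose p hp using hne
  have huniq : ∀ j r, 0 < μ (r, j) → r = p j := fun j r hr =>
    eq_of_pos_of_degree (hc.degree_eq hi h) (fun j => ⟨p j, hp j⟩) hr (hp j)
  have hnm : ¬ Monotone p := fun hm => hc.not_inBox hi h ⟨p, hm, hp⟩
  obtain ⟨D, rfl⟩ : ∃ D, d = D + 1 := ⟨d - 1, by omega⟩
  rw [Fin.monotone_iff_le_succ] at hnm
  push Not at hnm
  obtain ⟨e, he⟩ := hnm
  obtain ⟨q, hqm, hq⟩ := key (i e.succ)
  obtain ⟨q', hqm', hq'⟩ := key (i e.castSucc)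
  have h1 := huniq _ _ ((hq e.succ).resolve_right (by simp))
  have h2 := huniq _ _ ((hq' e.castSucc).resolve_right (by simp))
  have h3 := hqm e.castSucc_le_succ
  have h4 := hqm' e.castSucc_le_succ
  have h5 := hi e.castSucc_le_succ
  have h6 : q e.castSucc = i e.succ := by
    rcases hq e.castSucc with h | h
    · have := huniq _ _ h
      omega
    · exact h.1
  have h7 : q' e.succ = i e.castSucc := by
    rcases hq' e.succ with h | h
    · have := huniq _ _ h
      omega
    · exact h.1
  omega

/-- The row next to the bottom or top row `s`. -/
def nextRow {N : ℕ} (s : Fin (N + 2)) : Fin (N + 2) :=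
  if s = 0 then 1 else (Fin.last N).castSucc

lemma nextRow_zero {N : ℕ} : (nextRow (0 : Fin (N + 2)) : ℕ) = 1 := by
  simp [nextRow]

lemma nextRow_last {N : ℕ} : (nextRow (Fin.last (N + 1)) : ℕ) = N := by
  simp [nextRow, Fin.ext_iff]

/-- The pairs of columns between which the row `s` can be replaced by `nextRow s`. -/
def AdmCols {N D : ℕ} (s : Fin (N + 2)) (c e : Fin (D + 1)) : Prop :=
  c = e ∨ (s = 0 ∧ c < e) ∨ (s = Fin.last (N + 1) ∧ e < c)

/-- The variables which can replace `x_{s, e}`. -/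
def AdmVar {N D : ℕ} (s : Fin (N + 2)) (c e : Fin (D + 1)) (w : Fin (N + 2) × Fin (D + 1)) :
    Prop :=
  w ≠ (s, c) ∧ (w.2 = e → (s < w.1 ∧ e < Fin.last D) ∨ (w.1 < s ∧ 0 < e))

/-- The numerator of the Laurent monomial by which a basic homomorphism multiplies. -/
def shiftExp {N D : ℕ} (s : Fin (N + 2)) (c e : Fin (D + 1)) (w : Fin (N + 2) × Fin (D + 1)) :
    Fin (N + 2) × Fin (D + 1) →₀ ℕ :=
  rowExp (nextRow s) ((Finset.uIcc c e).erase e) + Finsupp.single w 1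

/-- The numerator of the Laurent monomial by which an interior basic homomorphism multiplies. -/
def swapExp {N D : ℕ} (m : Fin N) (t : Fin D) : Fin (N + 2) × Fin (D + 1) →₀ ℕ :=
  Finsupp.single (m.succ.succ, t.castSucc) 1 + Finsupp.single (m.castSucc.castSucc, t.succ) 1

section Classification

variable {N D : ℕ} {c : (Fin (D + 1) → Fin (N + 2)) → (Fin (N + 2) × Fin (D + 1) →₀ ℕ) → k}
  {s : Fin (N + 2)} {μ : Fin (N + 2) × Fin (D + 1) →₀ ℕ}

lemma TangentCoeff.exists_path (hc : TangentCoeff c) (h : c (fun _ => s) μ ≠ 0)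
    {i : Fin (D + 1) → Fin (N + 2)} (hi : Monotone i) {b : Fin (D + 1)} (hb : μ (s, b) = 0)
    (hib : i b ≠ s) :
    ∃ q, Monotone q ∧ ∀ j, 0 < μ (q j, j) ∨ (q j = i j ∧ i j ≠ s) := by
  rcases hc.exchange i monotone_const hi h with h1 | ⟨μ', h1, -⟩
  · exact h1
  · have := DFunLike.congr_fun h1 (s, b)
    simp [pathExp_apply, hb, hib] at this

lemma TangentCoeff.eq_shiftExp (hc : TangentCoeff c) (h : c (fun _ => s) μ ≠ 0)
    {a e : Fin (D + 1)} (hae : AdmCols s a e) (ha : μ (s, a) = 0) (he : μ (s, e) = 0)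
    (hout : ∀ j, j ∉ Finset.uIcc a e → 0 < μ (s, j))
    (hin : ∀ j, j ∈ Finset.uIcc a e → j ≠ e → 0 < μ (nextRow s, j)) :
    ∃ w, AdmVar s a e w ∧ μ = rowExp s (Finset.uIcc a e)ᶜ + shiftExp s a e w := by
  obtain ⟨w, hw⟩ := exists_add_single_of_le
    (μ := rowExp s (Finset.uIcc a e)ᶜ + rowExp (nextRow s) ((Finset.uIcc a e).erase e)) (ν := μ)
    (by
      rintro ⟨r, j⟩
      simp only [Finsupp.add_apply, rowExp_apply, Finset.mem_compl, Finset.mem_erase]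
      split_ifs with h1 h2 h2
      · exact absurd h2.2.2 h1.2
      · obtain ⟨rfl, h1⟩ := h1
        have := hout j h1
        simp
        omega
      · obtain ⟨rfl, h2, h3⟩ := h2
        have := hin j h3 h2
        simp
        omega
      · simp)
    (by
      rw [hc.degree_eq monotone_const h, map_add, degree_rowExp, degree_rowExp,
        Finset.card_compl, Finset.card_erase_of_mem Finset.right_mem_uIcc, Fintype.card_fin]
      have h1 : (Finset.uIcc a e).card ≤ D + 1 := (Finset.card_le_univ _).trans (by simp)
      have h2 : 0 < (Finset.uIcc a e).card := Finset.card_pos.2 ⟨e, Finset.right_mem_uIcc⟩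
      omega)
  refine ⟨w, ⟨?_, ?_⟩, by rw [shiftExp, ← add_assoc, hw]⟩
  · rintro rfl
    rw [hw] at ha
    simp at ha
  · obtain ⟨q, f⟩ := w
    dsimp only
    rintro rfl
    have hpos : 0 < μ (q, f) := by rw [hw]; simp
    have hqs : q ≠ s := by rintro rfl; omega
    by_contra hcon
    refine hc.not_inBox monotone_const h
      ⟨fun j => if j = f then q else if j ∈ Finset.uIcc a f then nextRow s else s, ?_, ?_⟩
    · rcases hae with rfl | ⟨rfl, haf⟩ | ⟨rfl, haf⟩
      · intro x y hxy
        simp only [Finset.uIcc_self, Finset.mem_singleton, Fin.lt_def, Fin.le_def, Fin.ext_iff,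
          Fin.val_last, Fin.val_zero] at *
        split_ifs <;> omega
      · intro x y hxy
        have hr := nextRow_zero (N := N)
        simp only [Finset.uIcc_of_le haf.le, Finset.mem_Icc, Fin.lt_def, Fin.le_def,
          Fin.ext_iff, Fin.val_last, Fin.val_zero] at haf hxy hqs hcon hr ⊢
        have h0 : ((0 : Fin (N + 2)) : ℕ) = 0 := rfl
        have hl : (Fin.last (N + 1) : ℕ) = N + 1 := rfl
        split_ifs <;> omega
      · intro x y hxy
        have hr := nextRow_last (N := N)
        simp only [Finset.uIcc_of_ge haf.le, Finset.mem_Icc, Fin.lt_def, Fin.le_def,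
          Fin.ext_iff, Fin.val_last, Fin.val_zero] at haf hxy hqs hcon hr ⊢
        have h0 : ((0 : Fin (N + 2)) : ℕ) = 0 := rfl
        have hl : (Fin.last (N + 1) : ℕ) = N + 1 := rfl
        split_ifs <;> omega
    · intro j
      dsimp only
      split_ifs with h1 h2
      · rw [h1]; exact hpos
      · exact hin j h2 h1
      · exact hout j h2

lemma TangentCoeff.classification (hc : TangentCoeff c) (h : c (fun _ => s) μ ≠ 0) :
    (∃ a e w, AdmCols s a e ∧ AdmVar s a e w ∧
      μ = rowExp s (Finset.uIcc a e)ᶜ + shiftExp s a e w) ∨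
    ∃ (m : Fin N) (t : Fin D), s = m.succ.castSucc ∧
      μ = rowExp s {t.castSucc, t.succ}ᶜ + swapExp m t := by
  have hbox := hc.not_inBox monotone_const h
  set J : Finset (Fin (D + 1)) := Finset.univ.filter fun j => μ (s, j) = 0 with hJ
  have hmem : ∀ j, j ∈ J ↔ μ (s, j) = 0 := by simp [hJ]
  have hJne : J.Nonempty := by
    by_contra hem
    rw [Finset.not_nonempty_iff_eq_empty] at hem
    refine hbox ⟨fun _ => s, monotone_const, fun j => ?_⟩
    have : j ∉ J := by simp [hem]
    rw [hmem] at this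
    exact Nat.pos_of_ne_zero this
  set a := J.min' hJne
  set b := J.max' hJne
  have ha : μ (s, a) = 0 := (hmem a).1 (J.min'_mem hJne)
  have hb : μ (s, b) = 0 := (hmem b).1 (J.max'_mem hJne)
  have hab : a ≤ b := J.min'_le _ (J.max'_mem hJne)
  have hlt : ∀ j, j < a → 0 < μ (s, j) := fun j hj => by
    by_contra h0
    exact absurd (J.min'_le j ((hmem j).2 (by omega))) (not_le.2 hj)
  have hgt : ∀ j, b < j → 0 < μ (s, j) := fun j hj => by
    by_contra h0
    exact absurd (J.le_max' j ((hmem j).2 (by omega))) (not_le.2 hj)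
  rcases hab.eq_or_lt with hab' | hab'
  · left
    obtain ⟨w, hw, hμ⟩ := hc.eq_shiftExp h (a := a) (e := a) (Or.inl rfl) ha ha
      (fun j hj => by
        simp at hj
        rcases lt_or_gt_of_ne hj with h1 | h1
        · exact hlt j h1
        · exact hgt j (hab' ▸ h1))
      (fun j hj hj' => by simp at hj; exact absurd hj hj')
    exact ⟨a, a, w, Or.inl rfl, hw, hμ⟩
  have hup : s ≠ Fin.last (N + 1) → ∃ q : Fin (D + 1) → Fin (N + 2), Monotone q ∧
      (∀ j, j < b → 0 < μ (q j, j)) ∧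
      ∀ j, b ≤ j → 0 < μ (q j, j) ∨ (q j : ℕ) = s + 1 := by
    intro hs
    have hs' : (s : ℕ) + 1 < N + 2 := by
      have := s.isLt
      have : (s : ℕ) ≠ N + 1 := fun h => hs (Fin.ext h)
      omega
    obtain ⟨q, hq, hq'⟩ := hc.exists_path h (i := fun j => if j < b then s else ⟨s + 1, hs'⟩)
      (fun x y hxy => by
        dsimp only
        simp only [Fin.le_def, Fin.lt_def] at *
        split_ifs <;> first | omega | (dsimp only; omega)) hb (by simp [Fin.ext_iff])
    refine ⟨q, hq, fun j hj => ?_, fun j hj => ?_⟩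
    · simpa [hj] using hq' j
    · have := hq' j
      simp only [not_lt.2 hj, if_false] at this
      exact this.imp_right fun h => by rw [h.1]
  have hdown : s ≠ 0 → ∃ q : Fin (D + 1) → Fin (N + 2), Monotone q ∧
      (∀ j, a < j → 0 < μ (q j, j)) ∧
      ∀ j, j ≤ a → 0 < μ (q j, j) ∨ (q j : ℕ) + 1 = s := by
    intro hs
    have hs' : 0 < (s : ℕ) := by
      have : (s : ℕ) ≠ 0 := fun h => hs (Fin.ext h)
      omega
    obtain ⟨q, hq, hq'⟩ := hc.exists_path h
      (i := fun j => if a < j then s else ⟨s - 1, by omega⟩)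
      (fun x y hxy => by
        dsimp only
        simp only [Fin.le_def, Fin.lt_def] at *
        split_ifs <;> first | omega | (dsimp only; omega)) ha (by simp [Fin.ext_iff]; omega)
    refine ⟨q, hq, fun j hj => ?_, fun j hj => ?_⟩
    · simpa [hj] using hq' j
    · have := hq' j
      simp only [not_lt.2 hj, if_false] at this
      exact this.imp_right fun h => by rw [h.1]; simp; omega
  have hne : ∀ {j r}, 0 < μ (r, j) → μ (s, j) = 0 → r ≠ s := by
    rintro j r h1 h2 rfl
    omega
  by_cases hs0 : s = 0
  · left
    obtain ⟨q, hq, hq1, hq2⟩ := hup (by rw [hs0]; exact (Fin.last_pos).ne)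
    have hpos : ∀ j, a ≤ j → 0 < (q j : ℕ) := by
      intro j hj
      have h1 : (q a : ℕ) ≠ 0 := fun h0 => hne (hq1 a hab') ha (by rw [hs0]; exact Fin.ext h0)
      have h2 : (q a : ℕ) ≤ q j := hq hj
      omega
    have hqb : (q b : ℕ) = 1 := by
      by_contra hqb
      refine hbox ⟨q, hq, fun j => ?_⟩
      rcases lt_or_ge j b with hj | hj
      · exact hq1 j hj
      · refine (hq2 j hj).resolve_right fun h1 => hqb ?_
        have h2 : (q b : ℕ) ≤ q j := hq hj
        have h3 := hpos b hab
        rw [hs0] at h1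
        simp at h1
        omega
    obtain ⟨w, hw, hμ⟩ := hc.eq_shiftExp h (a := a) (e := b) (Or.inr (Or.inl ⟨hs0, hab'⟩)) ha hb
      (fun j hj => by
        rw [Finset.uIcc_of_le hab, Finset.mem_Icc, not_and_or, not_le, not_le] at hj
        exact hj.elim (hlt j) (hgt j))
      (fun j hj hj' => by
        rw [Finset.uIcc_of_le hab, Finset.mem_Icc] at hj
        have h1 : (q j : ℕ) ≤ q b := hq hj.2
        have h2 := hpos j hj.1
        have h3 : nextRow s = q j := by
          rw [Fin.ext_iff, hs0, nextRow_zero]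
          omega
        rw [h3]
        exact hq1 j (lt_of_le_of_ne hj.2 hj'))
    exact ⟨a, b, w, Or.inr (Or.inl ⟨hs0, hab'⟩), hw, hμ⟩
  by_cases hsl : s = Fin.last (N + 1)
  · left
    obtain ⟨q, hq, hq1, hq2⟩ := hdown hs0
    have hpos : ∀ j, j ≤ b → (q j : ℕ) < N + 1 := by
      intro j hj
      have h1 : (q b : ℕ) ≠ N + 1 := fun h0 =>
        hne (hq1 b hab') hb (by rw [hsl]; exact Fin.ext h0)
      have h2 : (q j : ℕ) ≤ q b := hq hj
      omega
    have hqa : (q a : ℕ) = N := by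
      by_contra hqa
      refine hbox ⟨q, hq, fun j => ?_⟩
      rcases lt_or_ge a j with hj | hj
      · exact hq1 j hj
      · refine (hq2 j hj).resolve_right fun h1 => hqa ?_
        have h2 : (q j : ℕ) ≤ q a := hq hj
        have h3 := hpos a hab
        rw [hsl] at h1
        simp at h1
        omega
    obtain ⟨w, hw, hμ⟩ := hc.eq_shiftExp h (a := b) (e := a) (Or.inr (Or.inr ⟨hsl, hab'⟩)) hb ha
      (fun j hj => by
        rw [Finset.uIcc_of_ge hab, Finset.mem_Icc, not_and_or, not_le, not_le] at hj
        exact hj.elim (hlt j) (hgt j))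
      (fun j hj hj' => by
        rw [Finset.uIcc_of_ge hab, Finset.mem_Icc] at hj
        have h2 := hpos j hj.2
        have h3 : nextRow s = q j := by
          have h1 : (q a : ℕ) ≤ q j := hq hj.1
          rw [Fin.ext_iff, hsl, nextRow_last]
          omega
        rw [h3]
        exact hq1 j (lt_of_le_of_ne hj.1 (Ne.symm hj')))
    exact ⟨b, a, w, Or.inr (Or.inr ⟨hsl, hab'⟩), hw, hμ⟩
  right
  obtain ⟨q, hq, hq1, hq2⟩ := hup hsl
  obtain ⟨q', hq', hq1', hq2'⟩ := hdown hs0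
  have huniq : ∀ {j r r'}, 0 < μ (r, j) → 0 < μ (r', j) → r = r' := fun h1 h2 =>
    eq_of_pos_of_degree (hc.degree_eq monotone_const h)
      (fun j => (lt_or_ge j b).elim (fun hj => ⟨_, hq1 j hj⟩)
        fun hj => ⟨_, hq1' j (hab'.trans_le hj)⟩) h1 h2
  have hdesc : q' b < q a := by
    by_contra hle
    rw [not_lt] at hle
    refine hbox ⟨fun j => if j < b then q j else q' j, fun x y hxy => ?_, fun j => ?_⟩
    · dsimp only
      split_ifs with h1 h2 h2
      · exact hq hxy
      · rw [not_lt] at h2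
        rcases le_or_gt x a with h3 | h3
        · exact (hq h3).trans (hle.trans (hq' h2))
        · rw [huniq (hq1 x h1) (hq1' x h3)]
          exact hq' hxy
      · exact absurd (hxy.trans_lt h2) h1
      · exact hq' hxy
    · dsimp only
      split_ifs with h1
      · exact hq1 j h1
      · exact hq1' j (hab'.trans_le (not_lt.1 h1))
  have hnext : ∀ t, ¬ (a < t ∧ t < b) := fun t ht => by
    have h1 : q a ≤ q t := hq ht.1.le
    have h2 : q' t ≤ q' b := hq' ht.2.le
    rw [huniq (hq1 t ht.2) (hq1' t ht.1)] at h1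
    exact absurd (h1.trans h2) (not_le.2 hdesc)
  have hqa : (q a : ℕ) = s + 1 ∧ (q' b : ℕ) + 1 = s := by
    have h1 : q a ≤ q b := hq hab
    have h2 : q' a ≤ q' b := hq' hab
    have h3 : (q b : ℕ) = s + 1 := (hq2 b le_rfl).resolve_left fun h0 => by
      rw [huniq h0 (hq1' b hab')] at h1
      exact absurd h1 (not_le.2 hdesc)
    have h4 : (q' a : ℕ) + 1 = s := (hq2' a le_rfl).resolve_left fun h0 => by
      rw [huniq h0 (hq1 a hab')] at h2
      exact absurd h2 (not_le.2 hdesc)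
    have h5 := hne (hq1 a hab') ha
    have h6 := hne (hq1' b hab') hb
    simp only [Fin.le_def, Fin.lt_def, ne_eq, Fin.ext_iff] at h1 h2 h5 h6 hdesc
    omega
  have hbval : (b : ℕ) = a + 1 := by
    by_contra hcon
    rw [Fin.lt_def] at hab'
    exact hnext ⟨a + 1, by omega⟩ ⟨by simp [Fin.lt_def], by simp only [Fin.lt_def]; omega⟩
  have hs0' : (s : ℕ) ≠ 0 := fun h0 => hs0 (Fin.ext h0)
  have hsl' : (s : ℕ) ≠ N + 1 := fun h0 => hsl (Fin.ext h0)
  refine ⟨⟨s - 1, by omega⟩, ⟨a, by omega⟩, by ext; simp; omega, ?_⟩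
  have hta : (⟨a, by omega⟩ : Fin D).castSucc = a := rfl
  have htb : (⟨a, by omega⟩ : Fin D).succ = b := by ext; simp [hbval]
  have hrowa : (⟨s - 1, by omega⟩ : Fin N).succ.succ = q a := by ext; simp; omega
  have hrowb : (⟨s - 1, by omega⟩ : Fin N).castSucc.castSucc = q' b := by ext; simp; omega
  rw [swapExp, hta, htb, hrowa, hrowb]
  refine (eq_of_le_of_degree_eq ?_ ?_).symm
  · rintro ⟨r, j⟩
    simp only [Finsupp.add_apply, rowExp_apply, Finset.mem_compl, Finset.mem_insert,
      Finset.mem_singleton, Finsupp.single_apply, Prod.mk.injEq]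
    by_cases hja : j = a
    · subst hja
      have := hq1 a hab'
      by_cases hr : q a = r
      · subst hr
        simp [hab'.ne']
        omega
      · simp [hr, hab'.ne']
    by_cases hjb : j = b
    · subst hjb
      have := hq1' b hab'
      by_cases hr : q' b = r
      · subst hr
        simp [hab'.ne]
        omega
      · simp [hr, hab'.ne]
    by_cases hr : s = r
    · subst hr
      have h1 : 0 < μ (s, j) := by
        rcases lt_or_ge j a with h1 | h1
        · exact hlt j h1
        · refine hgt j (lt_of_le_of_ne (not_lt.1 fun h2 => ?_) (Ne.symm hjb))
          exact hnext j ⟨lt_of_le_of_ne h1 (Ne.symm hja), h2⟩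
      simp [Ne.symm hja, Ne.symm hjb, hja, hjb]
      omega
    · simp [hr, Ne.symm hja, Ne.symm hjb]
  · rw [hc.degree_eq monotone_const h, map_add, map_add, degree_rowExp, Finset.card_compl,
      Finset.card_pair hab'.ne, Fintype.card_fin]
    simp
    omega

end Classification

section Hom

lemma inBox_iff {μ : Fin n × Fin d →₀ ℕ} : InBox μ ↔ ∃ i, Monotone i ∧ pathExp i ≤ μ := by
  refine exists_congr fun i => and_congr_right fun _ => ⟨fun h => ?_, fun h j => ?_⟩
  · rintro ⟨r, j⟩
    rw [pathExp_apply]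
    split_ifs with hr
    · subst hr; exact h j
    · exact Nat.zero_le _
  · have := h (i j, j)
    rw [pathExp_apply, if_pos rfl] at this
    exact this

lemma InBox.mono {μ ν : Fin n × Fin d →₀ ℕ} (h : InBox μ) (hle : μ ≤ ν) : InBox ν := by
  obtain ⟨q, hq, hq'⟩ := h
  exact ⟨q, hq, fun j => (hq' j).trans_le (hle _)⟩

lemma prod_X_eq (i : Fin d → Fin n) :
    (∏ j : Fin d, X (i j, j) : MvPolynomial (Fin n × Fin d) k) = monomial (pathExp i) 1 := by
  rw [pathExp, monomial_sum_one]
  rfl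

lemma mem_boxIdeal {f : MvPolynomial (Fin n × Fin d) k} :
    f ∈ BoxIdeal k n d ↔ ∀ μ ∈ f.support, InBox μ := by
  have h : {f : MvPolynomial (Fin n × Fin d) k |
      ∃ i : Fin d → Fin n, Monotone i ∧ f = ∏ j : Fin d, X (i j, j)} =
      (fun μ => monomial μ (1 : k)) '' (pathExp '' {i : Fin d → Fin n | Monotone i}) := by
    ext f
    simp only [prod_X_eq, Set.mem_ofPred_eq, Set.mem_image, exists_exists_and_eq_and]
    exact exists_congr fun i => and_congr_right fun _ => eq_comm
  rw [BoxIdeal, h, mem_ideal_span_monomial_image]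
  refine forall₂_congr fun μ _ => ?_
  rw [inBox_iff]
  simp

lemma monomial_mem_boxIdeal {i : Fin d → Fin n} (hi : Monotone i) :
    (monomial (pathExp i) 1 : MvPolynomial (Fin n × Fin d) k) ∈ BoxIdeal k n d := by
  rw [← prod_X_eq]
  exact Ideal.subset_span ⟨i, hi, rfl⟩

/-- Multiplication by the Laurent monomial with exponent `a - b` induces a homomorphism from the
box polarization to its quotient ring. -/
def Shiftable (a b : Fin n × Fin d →₀ ℕ) : Prop :=
  ∀ ρ v τ, InBox ρ → ¬ b ≤ ρ → τ + b = ρ + Finsupp.single v 1 → InBox (τ + a)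

lemma Shiftable.X_mul {a b : Fin n × Fin d →₀ ℕ} (H : Shiftable a b)
    {f : MvPolynomial (Fin n × Fin d) k} (hf : f ∈ BoxIdeal k n d) (v : Fin n × Fin d) :
    monomial a 1 * (X v * f).divMonomial b - X v * (monomial a 1 * f.divMonomial b) ∈
      BoxIdeal k n d := by
  classical
  rw [mem_boxIdeal]
  intro ν hν
  by_contra hbox
  rw [mem_support_iff] at hν
  apply hν
  rw [coeff_sub, mul_left_comm, sub_eq_zero]
  by_cases ha : a ≤ ν
  · obtain ⟨τ, rfl⟩ := exists_add_of_le ha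
    rw [coeff_monomial_mul, coeff_monomial_mul, one_mul, one_mul, coeff_divMonomial,
      coeff_X_mul', coeff_X_mul']
    by_cases h1 : v ∈ τ.support
    · have h2 : v ∈ (b + τ).support := by
        simp only [Finsupp.mem_support_iff, Finsupp.add_apply] at *
        omega
      rw [if_pos h1, if_pos h2, coeff_divMonomial]
      congr 1
      rw [add_tsub_assoc_of_le]
      rw [Finsupp.single_le_iff]
      exact Nat.one_le_iff_ne_zero.2 (by simpa using h1)
    · rw [if_neg h1]
      split_ifs with h2
      · by_contra h3
        set ρ := b + τ - Finsupp.single v 1 with hρ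
        have hρ' : τ + b = ρ + Finsupp.single v 1 := by
          rw [hρ, tsub_add_cancel_of_le, add_comm]
          rw [Finsupp.single_le_iff]
          exact Nat.one_le_iff_ne_zero.2 (by simpa using h2)
        refine hbox (add_comm τ a ▸ H ρ v τ (mem_boxIdeal.1 hf ρ (mem_support_iff.2 h3)) ?_ hρ')
        intro hle
        have h4 := hle v
        have h5 := DFunLike.congr_fun hρ' v
        simp only [Finsupp.mem_support_iff, Finsupp.add_apply, Finsupp.single_eq_same] at *
        omega
      · rfl
  · rw [coeff_monomial_mul', coeff_monomial_mul', if_neg ha, if_neg ha]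

lemma Shiftable.smul {a b : Fin n × Fin d →₀ ℕ} (H : Shiftable a b)
    (r : MvPolynomial (Fin n × Fin d) k) {f : MvPolynomial (Fin n × Fin d) k}
    (hf : f ∈ BoxIdeal k n d) :
    monomial a 1 * (r * f).divMonomial b - r * (monomial a 1 * f.divMonomial b) ∈
      BoxIdeal k n d := by
  induction r using MvPolynomial.induction_on with
  | C x =>
    convert (BoxIdeal k n d).zero_mem
    rw [sub_eq_zero, mul_left_comm]
    congr 1
    ext m
    simp [coeff_divMonomial, coeff_C_mul]
  | add p q hp hq =>
    convert add_mem hp hq using 1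
    rw [add_mul, add_divMonomial]
    ring
  | mul_X p v hp =>
    convert add_mem (H.X_mul (Ideal.mul_mem_left _ p hf) v) (Ideal.mul_mem_left _ (X v) hp) using 1
    rw [show p * X v * f = X v * (p * f) by ring]
    ring

/-- The homomorphism induced by multiplication by the Laurent monomial with exponent `a - b`. -/
def shiftHom (k : Type) [Field k] (a b : Fin n × Fin d →₀ ℕ) (H : Shiftable a b) :
    ↥(BoxIdeal k n d) →ₗ[MvPolynomial (Fin n × Fin d) k]
      (MvPolynomial (Fin n × Fin d) k ⧸ BoxIdeal k n d) where
  toFun f := Ideal.Quotient.mk _ (monomial a 1 * f.1.divMonomial b)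
  map_add' f g := by
    rw [Submodule.coe_add, add_divMonomial, mul_add, map_add]
  map_smul' r f := by
    exact Ideal.Quotient.eq.2 (H.smul r f.2)

lemma shiftHom_mem {a b : Fin n × Fin d →₀ ℕ} (H : Shiftable a b) (hab : a.degree = b.degree) :
    shiftHom k a b H ∈ degZeroHom k (Fin n × Fin d) (BoxIdeal k n d) := by
  intro e f hf hfe
  refine ⟨_, ?_, rfl⟩
  intro ν hν
  rw [coeff_monomial_mul'] at hν
  split_ifs at hν with ha
  · obtain ⟨τ, rfl⟩ := exists_add_of_le ha
    rw [add_tsub_cancel_left, one_mul, coeff_divMonomial] at hν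
    have := hfe hν
    rw [Pi.one_def, ← Finsupp.degree_eq_weight_one, map_add] at this
    rw [Pi.one_def, ← Finsupp.degree_eq_weight_one, map_add]
    omega
  · exact absurd rfl hν

/-- The coefficient of a monomial outside of the box polarization, as a functional on the
quotient ring. -/
def quotCoeff (k : Type) [Field k] (μ : Fin n × Fin d →₀ ℕ) (hμ : ¬ InBox μ) :
    (MvPolynomial (Fin n × Fin d) k ⧸ BoxIdeal k n d) →ₗ[k] k :=
  ((BoxIdeal k n d).restrictScalars k).liftQ (lcoeff k μ) (by
    intro f hf
    by_contra h
    exact hμ (mem_boxIdeal.1 hf μ (mem_support_iff.2 h))) ∘ₗ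
  (Submodule.Quotient.restrictScalarsEquiv k (BoxIdeal k n d)).symm.toLinearMap

lemma quotCoeff_mk {μ : Fin n × Fin d →₀ ℕ} (hμ : ¬ InBox μ)
    (f : MvPolynomial (Fin n × Fin d) k) :
    quotCoeff k μ hμ (Ideal.Quotient.mk _ f) = coeff μ f := rfl

lemma eq_zero_of_quotCoeff (x : MvPolynomial (Fin n × Fin d) k ⧸ BoxIdeal k n d)
    (h : ∀ μ hμ, quotCoeff k μ hμ x = 0) : x = 0 := by
  obtain ⟨f, rfl⟩ := Ideal.Quotient.mk_surjective x
  rw [Ideal.Quotient.eq_zero_iff_mem, mem_boxIdeal]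
  intro μ hμ
  by_contra hbox
  exact mem_support_iff.1 hμ (h μ hbox)

/-- The image of the generator `∏ j, x_{i j, j}`. -/
def genImage (φ : ↥(BoxIdeal k n d) →ₗ[MvPolynomial (Fin n × Fin d) k]
    (MvPolynomial (Fin n × Fin d) k ⧸ BoxIdeal k n d)) {i : Fin d → Fin n} (hi : Monotone i) :
    MvPolynomial (Fin n × Fin d) k ⧸ BoxIdeal k n d :=
  φ ⟨_, monomial_mem_boxIdeal hi⟩

open Classical in
/-- The coefficient of the monomial with exponent `μ` in the image of the generator
`∏ j, x_{i j, j}`. -/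
def homCoeff (φ : ↥(BoxIdeal k n d) →ₗ[MvPolynomial (Fin n × Fin d) k]
    (MvPolynomial (Fin n × Fin d) k ⧸ BoxIdeal k n d)) (i : Fin d → Fin n)
    (μ : Fin n × Fin d →₀ ℕ) : k :=
  if h : Monotone i ∧ ¬ InBox μ then quotCoeff k μ h.2 (genImage φ h.1) else 0

lemma tangentCoeff_homCoeff {φ : ↥(BoxIdeal k n d) →ₗ[MvPolynomial (Fin n × Fin d) k]
    (MvPolynomial (Fin n × Fin d) k ⧸ BoxIdeal k n d)}
    (hφ : φ ∈ degZeroHom k (Fin n × Fin d) (BoxIdeal k n d)) : TangentCoeff (homCoeff φ) where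
  degree_eq {i μ} hi h := by
    obtain ⟨g, hg, hg'⟩ := hφ d _ (monomial_mem_boxIdeal hi)
      (isHomogeneous_monomial 1 (degree_pathExp i))
    rw [homCoeff] at h
    split_ifs at h with h1
    · rw [genImage, hg', quotCoeff_mk] at h
      have := hg h
      rwa [Pi.one_def, ← Finsupp.degree_eq_weight_one] at this
    · exact absurd rfl h
  not_inBox {i μ} hi h := by
    rw [homCoeff] at h
    split_ifs at h with h1
    · exact h1.2
    · exact absurd rfl h
  exchange {i μ} i' hi hi' h := by
    classical
    rw [or_iff_not_imp_left]
    intro hno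
    have hμ : ¬ InBox μ := fun ⟨q, hq, hq'⟩ => hno ⟨q, hq, fun j => Or.inl (hq' j)⟩
    set K := Finset.univ.filter fun j => i' j ≠ i j with hK
    set A : Fin n × Fin d →₀ ℕ := ∑ j ∈ K, Finsupp.single (i' j, j) 1 with hA
    set B : Fin n × Fin d →₀ ℕ := ∑ j ∈ K, Finsupp.single (i j, j) 1 with hB
    have hAv : ∀ r j, A (r, j) = if i' j = r ∧ i' j ≠ i j then 1 else 0 := by
      intro r j
      simp only [hA, hK, Finsupp.finsetSum_apply, Finsupp.single_apply, Prod.mk.injEq]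
      rw [Finset.sum_filter, Finset.sum_eq_single j]
      · split_ifs <;> simp_all
      · intro b _ hb
        simp [hb]
      · simp
    have hAB : A + pathExp i = B + pathExp i' := by
      have h1 : ∀ p : Fin d → Fin n, pathExp p = ∑ j ∈ K, Finsupp.single (p j, j) 1 +
          ∑ j ∈ Kᶜ, Finsupp.single (p j, j) 1 := fun p => (Finset.sum_add_sum_compl K _).symm
      rw [h1 i, h1 i', ← hA, ← hB, add_left_comm]
      congr 2
      refine Finset.sum_congr rfl fun j hj => ?_
      have : i' j = i j := by simpa [hK] using hj
      rw [this]
    have hAμ : ¬ InBox (A + μ) := by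
      rintro ⟨q, hq, hq'⟩
      refine hno ⟨q, hq, fun j => ?_⟩
      have := hq' j
      rw [Finsupp.add_apply, hAv] at this
      split_ifs at this with h1
      · exact Or.inr ⟨h1.1.symm, h1.2⟩
      · left; omega
    have hrel : monomial A (1 : k) • genImage φ hi = monomial B (1 : k) • genImage φ hi' := by
      rw [genImage, genImage, ← map_smul, ← map_smul]
      congr 1
      ext1
      simp [monomial_mul, hAB]
    obtain ⟨f, hf⟩ := Ideal.Quotient.mk_surjective (genImage φ hi)
    obtain ⟨g, hg⟩ := Ideal.Quotient.mk_surjective (genImage φ hi')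
    have hcf : homCoeff φ i μ = coeff μ f := by
      rw [homCoeff, dif_pos ⟨hi, hμ⟩, ← hf, quotCoeff_mk]
    rw [← hf, ← hg] at hrel
    have hrel' := congrArg (quotCoeff k (A + μ) hAμ) hrel
    change coeff (A + μ) (monomial A (1 : k) * f) = coeff (A + μ) (monomial B (1 : k) * g) at hrel'
    rw [coeff_monomial_mul, one_mul, coeff_monomial_mul', one_mul] at hrel'
    split_ifs at hrel' with hle
    · obtain ⟨μ', hμ'⟩ := exists_add_of_le hle
      rw [hμ', add_tsub_cancel_left] at hrel'
      refine ⟨μ', ?_, ?_⟩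
      · have h2 : A + (μ' + pathExp i) = A + (μ + pathExp i') := by
          rw [add_left_comm, hAB, ← add_assoc A, hμ', ← add_assoc, add_comm μ' B]
        exact add_left_cancel h2
      · have hμ'' : ¬ InBox μ' := fun h0 => hAμ (hμ' ▸ h0.mono le_add_self)
        rw [hcf, homCoeff, dif_pos ⟨hi', hμ''⟩, ← hg, quotCoeff_mk, hrel']
    · exact absurd (hcf.trans hrel') h

lemma eq_zero_of_homCoeff {φ : ↥(BoxIdeal k n d) →ₗ[MvPolynomial (Fin n × Fin d) k]
    (MvPolynomial (Fin n × Fin d) k ⧸ BoxIdeal k n d)}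
    (h : ∀ i μ, Monotone i → homCoeff φ i μ = 0) : φ = 0 := by
  have hgen : ∀ (f) (hf : f ∈ BoxIdeal k n d), φ ⟨f, hf⟩ = 0 := by
    intro f hf
    refine Submodule.span_induction (p := fun f hf => φ ⟨f, hf⟩ = 0) ?_ ?_ ?_ ?_ hf
    · rintro _ ⟨i, hi, rfl⟩
      refine eq_zero_of_quotCoeff _ fun μ hμ => ?_
      have := h i μ hi
      rw [homCoeff, dif_pos ⟨hi, hμ⟩] at this
      rw [← this, genImage]
      congr 3
      exact prod_X_eq i
    · exact map_zero φ
    · intro x y hx hy h1 h2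
      rw [← add_zero (0 : MvPolynomial (Fin n × Fin d) k ⧸ BoxIdeal k n d)]
      nth_rw 1 [← h1]
      rw [← h2, ← map_add]
      rfl
    · intro a x hx h1
      rw [← smul_zero a, ← h1, ← map_smul]
      rfl
  ext ⟨f, hf⟩
  exact hgen f hf

end Hom

section Index

lemma shiftable_rowExp {s : Fin n} {J : Finset (Fin d)} {a : Fin n × Fin d →₀ ℕ}
    (h : ∀ i : Fin d → Fin n, Monotone i → (∃ t ∈ J, i t ≠ s) →
      ∃ q : Fin d → Fin n, Monotone q ∧
        ∀ j, (q j = i j ∧ (i j = s → j ∉ J)) ∨ 0 < a (q j, j)) :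
    Shiftable a (rowExp s J) := by
  rintro ρ v τ ⟨i, hi, hpos⟩ hle hτ
  obtain ⟨⟨r, t⟩, hu⟩ : ∃ u, ¬ rowExp s J u ≤ ρ u := by
    by_contra! h0
    exact hle h0
  rw [rowExp_apply] at hu
  obtain ⟨⟨rfl, ht⟩, hρ⟩ : (s = r ∧ t ∈ J) ∧ ρ (r, t) = 0 := by
    split_ifs at hu with h1
    · exact ⟨h1, by omega⟩
    · omega
  have hv : v = (s, t) := by
    by_contra hv
    have := DFunLike.congr_fun hτ (s, t)
    rw [Finsupp.add_apply, Finsupp.add_apply, rowExp_apply, hρ,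
      Finsupp.single_eq_of_ne (Ne.symm hv), if_pos ⟨rfl, ht⟩] at this
    omega
  obtain ⟨q, hq, hq'⟩ := h i hi ⟨t, ht, fun h0 => by
    have := hpos t
    rw [h0, hρ] at this
    exact this.false⟩
  refine ⟨q, hq, fun j => ?_⟩
  rcases hq' j with ⟨h1, h2⟩ | h1
  · have h3 := DFunLike.congr_fun hτ (i j, j)
    rw [Finsupp.add_apply, Finsupp.add_apply, rowExp_apply, if_neg fun h4 => h2 h4.1.symm h4.2]
      at h3
    have h4 := hpos j
    rw [h1, Finsupp.add_apply]
    omega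
  · rw [Finsupp.add_apply]
    omega

variable {N D : ℕ}

lemma AdmCols.nextRow_ne {s : Fin (N + 2)} {c e : Fin (D + 1)} (h : AdmCols s c e)
    (hne : c ≠ e) : nextRow s ≠ s := by
  intro h0
  rcases h with h | ⟨rfl, h⟩ | ⟨rfl, h⟩
  · exact hne h
  · have := nextRow_zero (N := N)
    rw [h0] at this
    simp at this
  · have := nextRow_last (N := N)
    rw [h0] at this
    simp at this

lemma AdmCols.eq_of_mem {s : Fin (N + 2)} {c e c' e' : Fin (D + 1)} (h : AdmCols s c e)
    (h' : AdmCols s c' e') (h1 : c' ∈ Finset.uIcc c e) (h2 : e' ∈ Finset.uIcc c e)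
    (h3 : c ∈ Finset.uIcc c' e') (h4 : e ∈ Finset.uIcc c' e') : c = c' ∧ e = e' := by
  rw [Finset.mem_uIcc'] at h1 h2 h3 h4
  rcases h with rfl | ⟨rfl, h⟩ | ⟨rfl, h⟩
  · omega
  · rcases h' with h' | h' | h'
    · omega
    · omega
    · exact absurd h'.1 (Fin.last_pos).ne
  · rcases h' with h' | h' | h'
    · omega
    · exact absurd h'.1 (Fin.last_pos).ne'
    · omega

lemma shiftExp_apply (s : Fin (N + 2)) (c e : Fin (D + 1)) (w : Fin (N + 2) × Fin (D + 1))
    (r : Fin (N + 2)) (j : Fin (D + 1)) :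
    shiftExp s c e w (r, j) =
      (if nextRow s = r ∧ j ∈ (Finset.uIcc c e).erase e then 1 else 0) +
        if w = (r, j) then 1 else 0 := by
  classical
  rw [shiftExp, Finsupp.add_apply, rowExp_apply, Finsupp.single_apply]

lemma degree_shiftExp (s : Fin (N + 2)) (c e : Fin (D + 1)) (w : Fin (N + 2) × Fin (D + 1)) :
    (shiftExp s c e w).degree = (Finset.uIcc c e).card := by
  rw [shiftExp, map_add, degree_rowExp, Finsupp.degree_single,
    Finset.card_erase_add_one Finset.right_mem_uIcc]

lemma shiftable_shiftExp {s : Fin (N + 2)} {c e : Fin (D + 1)} {w : Fin (N + 2) × Fin (D + 1)}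
    (h : AdmCols s c e) : Shiftable (shiftExp s c e w) (rowExp s (Finset.uIcc c e)) := by
  refine shiftable_rowExp fun i hi ⟨t, ht, hts⟩ => ?_
  rw [Finset.mem_uIcc'] at ht
  refine ⟨fun j => if j ∈ Finset.uIcc c e ∧ i j = s then nextRow s else i j, ?_, ?_⟩
  · intro j j' hjj
    have h1 := hi hjj
    dsimp only
    rcases h with rfl | ⟨rfl, h⟩ | ⟨rfl, h⟩
    · obtain rfl : t = c := by omega
      have hno : ∀ l, ¬ (l ∈ Finset.uIcc t t ∧ i l = s) := by
        rintro l ⟨hl, hl'⟩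
        rw [Finset.uIcc_self, Finset.mem_singleton] at hl
        exact hts (hl ▸ hl')
      rwa [if_neg (hno j), if_neg (hno j')]
    · have hit : ∀ l, i l = 0 → l < t := by
        intro l hl
        by_contra! hlt
        exact hts (le_antisymm (hl ▸ hi hlt) (Fin.zero_le _))
      split_ifs with h2 h3 h3
      · exact le_rfl
      · rw [Fin.le_def, nextRow_zero, Nat.one_le_iff_ne_zero, Fin.val_ne_zero_iff]
        intro h4
        have := hit _ h4
        refine h3 ⟨?_, h4⟩
        rw [Finset.mem_uIcc'] at h2 ⊢
        omega
      · exact (h3.2 ▸ h1).trans (Fin.zero_le _)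
      · exact h1
    · have hit : ∀ l, i l = Fin.last (N + 1) → t < l := by
        intro l hl
        by_contra! hlt
        exact hts (le_antisymm (Fin.le_last _) (hl ▸ hi hlt))
      split_ifs with h2 h3 h3
      · exact le_rfl
      · exact (Fin.le_last _).trans (h2.2 ▸ h1)
      · rw [Fin.le_def, nextRow_last, ← Nat.lt_succ_iff]
        refine Fin.val_lt_last (fun h4 => h2 ⟨?_, h4⟩)
        have := hit _ h4
        rw [Finset.mem_uIcc'] at h3 ⊢
        omega
      · exact h1
  · intro j
    dsimp only
    split_ifs with hj
    · right
      have hje : j ≠ e := by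
        rintro rfl
        rcases h with rfl | ⟨rfl, h⟩ | ⟨rfl, h⟩
        · exact hts ((show t = c by omega) ▸ hj.2)
        · exact hts (le_antisymm (hj.2 ▸ hi (show t ≤ j by omega)) (Fin.zero_le _))
        · exact hts (le_antisymm (Fin.le_last _) (hj.2 ▸ hi (show j ≤ t by omega)))
      rw [shiftExp_apply, if_pos ⟨rfl, Finset.mem_erase.2 ⟨hje, hj.1⟩⟩]
      omega
    · exact Or.inl ⟨rfl, fun h1 h2 => hj ⟨h2, h1⟩⟩

lemma not_inBox_shiftExp {s : Fin (N + 2)} {c e : Fin (D + 1)} {w : Fin (N + 2) × Fin (D + 1)}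
    (h : AdmCols s c e) (hw : AdmVar s c e w) :
    ¬ InBox (rowExp s (Finset.uIcc c e)ᶜ + shiftExp s c e w) := by
  rintro ⟨q, hq, hpos⟩
  have key : ∀ j, (s = q j ∧ j ∉ Finset.uIcc c e) ∨
      (nextRow s = q j ∧ j ∈ (Finset.uIcc c e).erase e) ∨ w = (q j, j) := by
    intro j
    have := hpos j
    rw [Finsupp.add_apply, rowExp_apply, shiftExp_apply] at this
    by_contra! h0
    rw [if_neg fun h1 => Finset.mem_compl.1 h1.2 (h0.1 h1.1), if_neg fun h1 => h0.2.1 h1.1 h1.2,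
      if_neg h0.2.2] at this
    exact this.false
  have hwe : w = (q e, e) := by
    rcases key e with h1 | h1 | h1
    · exact absurd Finset.right_mem_uIcc h1.2
    · exact absurd rfl (Finset.ne_of_mem_erase h1.2)
    · exact h1
  rcases hw.2 (by rw [hwe]) with ⟨h1, h2⟩ | ⟨h1, h2⟩
  · rw [hwe] at h1
    obtain ⟨f, hf⟩ : ∃ f : Fin (D + 1), (f : ℕ) = e + 1 := ⟨⟨e + 1, by
      rw [Fin.lt_def, Fin.val_last] at h2; omega⟩, rfl⟩
    have hfe : e < f := by omega
    have hfJ : f ∉ Finset.uIcc c e := by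
      rw [Finset.mem_uIcc']
      rcases h with rfl | ⟨rfl, h⟩ | ⟨rfl, h⟩
      · omega
      · omega
      · exact absurd h1 (Fin.le_last _).not_gt
    rcases key f with h3 | h3 | h3
    · exact absurd (hq hfe.le) (h3.1 ▸ h1).not_ge
    · exact hfJ (Finset.mem_of_mem_erase h3.2)
    · rw [hwe, Prod.mk.injEq] at h3
      exact hfe.ne h3.2
  · rw [hwe] at h1
    obtain ⟨f, hf⟩ : ∃ f : Fin (D + 1), (f : ℕ) + 1 = e := ⟨⟨e - 1, by omega⟩, by
      rw [Fin.lt_def, Fin.val_zero] at h2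
      exact Nat.sub_add_cancel h2⟩
    have hfe : f < e := by omega
    have hfJ : f ∉ Finset.uIcc c e := by
      rw [Finset.mem_uIcc']
      rcases h with rfl | ⟨rfl, h⟩ | ⟨rfl, h⟩
      · omega
      · exact absurd h1 (Fin.zero_le _).not_gt
      · omega
    rcases key f with h3 | h3 | h3
    · exact absurd (hq hfe.le) (h3.1 ▸ h1).not_ge
    · exact hfJ (Finset.mem_of_mem_erase h3.2)
    · rw [hwe, Prod.mk.injEq] at h3
      exact hfe.ne' h3.2

lemma swapExp_apply (m : Fin N) (t : Fin D) (r : Fin (N + 2)) (j : Fin (D + 1)) :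
    swapExp m t (r, j) = (if r = m.succ.succ ∧ j = t.castSucc then 1 else 0) +
      if r = m.castSucc.castSucc ∧ j = t.succ then 1 else 0 := by
  classical
  rw [swapExp, Finsupp.add_apply, Finsupp.single_apply, Finsupp.single_apply]
  simp only [Prod.mk.injEq, eq_comm]

lemma degree_swapExp (m : Fin N) (t : Fin D) :
    (swapExp m t).degree = ({t.castSucc, t.succ} : Finset (Fin (D + 1))).card := by
  rw [swapExp, map_add, Finsupp.degree_single, Finsupp.degree_single, Finset.card_pair]
  exact Fin.castSucc_lt_succ.ne

lemma shiftable_swapExp (m : Fin N) (t : Fin D) :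
    Shiftable (swapExp m t) (rowExp m.succ.castSucc {t.castSucc, t.succ}) := by
  refine shiftable_rowExp fun i hi ht => ?_
  refine ⟨fun j => if i j = m.succ.castSucc then if j = t.castSucc then m.succ.succ else
    if j = t.succ then m.castSucc.castSucc else i j else i j, ?_, ?_⟩
  · have hne : i t.castSucc ≠ m.succ.castSucc ∨ i t.succ ≠ m.succ.castSucc := by
      simpa using ht
    have hst := hi (Fin.castSucc_lt_succ (i := t)).le
    intro j j' hjj
    have h1 := hi hjj
    have h2 : t.castSucc ≤ j → i t.castSucc ≤ i j := fun h => hi h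
    have h3 : t.succ ≤ j → i t.succ ≤ i j := fun h => hi h
    have h4 : j' ≤ t.castSucc → i j' ≤ i t.castSucc := fun h => hi h
    have h5 : j' ≤ t.succ → i j' ≤ i t.succ := fun h => hi h
    have h6 : t.castSucc = j' → i t.castSucc = i j' := congrArg i
    have h7 : t.succ = j → i t.succ = i j := congrArg i
    have h8 : t.castSucc = j → i t.castSucc = i j := congrArg i
    have h10 : t.succ ≤ j' → i t.succ ≤ i j' := fun h => hi h
    have h11 : j ≤ t.castSucc → i j ≤ i t.castSucc := fun h => hi h
    have h9 : t.succ = j' → i t.succ = i j' := congrArg i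
    dsimp only
    split_ifs <;>
      simp only [Fin.ext_iff, Fin.le_def, ne_eq, Fin.val_castSucc, Fin.val_succ] at * <;>
      omega
  · intro j
    dsimp only
    split_ifs with h1 h2 h3
    · right; simp [swapExp_apply, h2]
    · right; simp [swapExp_apply, h3]
    · left; simp [h2, h3]
    · exact Or.inl ⟨rfl, fun h => absurd h h1⟩

lemma not_inBox_swapExp (m : Fin N) (t : Fin D) :
    ¬ InBox (rowExp m.succ.castSucc {t.castSucc, t.succ}ᶜ + swapExp m t) := by
  rintro ⟨q, hq, hpos⟩
  have h1 := hpos t.castSucc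
  have h2 := hpos t.succ
  have h3 := hq (Fin.castSucc_lt_succ (i := t)).le
  have h4 : t.castSucc ≠ t.succ := Fin.castSucc_lt_succ.ne
  have h5 : q t.castSucc = m.succ.succ := by
    by_contra h5
    simp [rowExp_apply, swapExp_apply, h4, h5] at h1
  have h6 : q t.succ = m.castSucc.castSucc := by
    by_contra h6
    simp [rowExp_apply, swapExp_apply, h4.symm, h6] at h2
  rw [h5, h6] at h3
  simp [Fin.le_def] at h3

/-- The basic homomorphisms that multiply by `shiftExp`. -/
abbrev ShiftIndex (N D : ℕ) : Type :=
  {p : (Fin (N + 2) × Fin (D + 1) × Fin (D + 1)) × Fin (N + 2) × Fin (D + 1) //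
    AdmCols p.1.1 p.1.2.1 p.1.2.2 ∧ AdmVar p.1.1 p.1.2.1 p.1.2.2 p.2}

/-- The index set of a basis of the tangent space. -/
abbrev BasisIndex (N D : ℕ) : Type := ShiftIndex N D ⊕ Fin N × Fin D

namespace BasisIndex

/-- The row whose generator is not annihilated by the basic homomorphism. -/
def row : BasisIndex N D → Fin (N + 2) :=
  Sum.elim (fun p => p.1.1.1) fun q => q.1.succ.castSucc

/-- The columns of the row that the basic homomorphism divides out. -/
def cols : BasisIndex N D → Finset (Fin (D + 1)) :=
  Sum.elim (fun p => Finset.uIcc p.1.1.2.1 p.1.1.2.2) fun q => {q.2.castSucc, q.2.succ}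

/-- The numerator of the Laurent monomial of the basic homomorphism. -/
def num : BasisIndex N D → Fin (N + 2) × Fin (D + 1) →₀ ℕ :=
  Sum.elim (fun p => shiftExp p.1.1.1 p.1.1.2.1 p.1.1.2.2 p.1.2) fun q => swapExp q.1 q.2

/-- The image of the generator of the row under the basic homomorphism. -/
def target (t : BasisIndex N D) : Fin (N + 2) × Fin (D + 1) →₀ ℕ :=
  rowExp t.row t.colsᶜ + t.num

lemma degree_num (t : BasisIndex N D) : t.num.degree = (rowExp t.row t.cols).degree := by
  rw [degree_rowExp]
  rcases t with p | q
  · exact degree_shiftExp _ _ _ _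
  · exact degree_swapExp _ _

lemma shiftable (t : BasisIndex N D) : Shiftable t.num (rowExp t.row t.cols) := by
  rcases t with p | q
  · exact shiftable_shiftExp p.2.1
  · exact shiftable_swapExp _ _

lemma not_inBox_target (t : BasisIndex N D) : ¬ InBox t.target := by
  rcases t with p | q
  · exact not_inBox_shiftExp p.2.1 p.2.2
  · exact not_inBox_swapExp _ _

lemma cols_nonempty (t : BasisIndex N D) : t.cols.Nonempty := by
  rcases t with p | q
  · exact ⟨_, Finset.left_mem_uIcc⟩
  · exact ⟨_, Finset.mem_insert_self _ _⟩

lemma target_inl (p : ShiftIndex N D) : target (Sum.inl p : BasisIndex N D) =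
    rowExp p.1.1.1 (Finset.uIcc p.1.1.2.1 p.1.1.2.2)ᶜ +
      shiftExp p.1.1.1 p.1.1.2.1 p.1.1.2.2 p.1.2 := rfl

lemma target_inr (q : Fin N × Fin D) : target (Sum.inr q : BasisIndex N D) =
    rowExp q.1.succ.castSucc {q.2.castSucc, q.2.succ}ᶜ + swapExp q.1 q.2 := rfl

lemma target_inr_eq_zero (q : Fin N × Fin D) {j : Fin (D + 1)} :
    target (Sum.inr q : BasisIndex N D) (q.1.succ.castSucc, j) = 0 ↔
      j = q.2.castSucc ∨ j = q.2.succ := by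
  have h1 : q.1.succ.castSucc ≠ q.1.succ.succ := Fin.castSucc_lt_succ.ne
  have h2 : q.1.succ.castSucc ≠ q.1.castSucc.castSucc := by simp [Fin.ext_iff]
  rw [target_inr, Finsupp.add_apply, rowExp_apply, swapExp_apply,
    if_neg (c := _ ∧ j = q.2.castSucc) fun h => h1 h.1,
    if_neg (c := _ ∧ j = q.2.succ) fun h => h2 h.1]
  simp
  tauto

lemma mem_cols_of_target_eq_zero {t : BasisIndex N D} {j : Fin (D + 1)}
    (h : t.target (t.row, j) = 0) : j ∈ t.cols := by
  by_contra hj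
  rw [target, Finsupp.add_apply, rowExp_apply, if_pos ⟨rfl, Finset.mem_compl.2 hj⟩] at h
  omega

lemma target_inl_left (p : ShiftIndex N D) :
    target (Sum.inl p : BasisIndex N D) (p.1.1.1, p.1.1.2.1) = 0 := by
  rw [target_inl, Finsupp.add_apply, rowExp_apply, shiftExp_apply,
    if_neg fun h => Finset.mem_compl.1 h.2 Finset.left_mem_uIcc,
    if_neg fun h => p.2.1.nextRow_ne (Finset.ne_of_mem_erase h.2) h.1, if_neg p.2.2.1]

lemma target_inl_right (p : ShiftIndex N D) :
    target (Sum.inl p : BasisIndex N D) (p.1.1.1, p.1.1.2.2) = 0 := by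
  rw [target_inl, Finsupp.add_apply, rowExp_apply, shiftExp_apply,
    if_neg fun h => Finset.mem_compl.1 h.2 Finset.right_mem_uIcc,
    if_neg fun h => Finset.ne_of_mem_erase h.2 rfl, if_neg fun h => ?_]
  rcases p.2.2.2 (by rw [h]) with h1 | h1
  · rw [h] at h1
    exact h1.1.false
  · rw [h] at h1
    exact h1.1.false

lemma target_inl_ne_inr (p : ShiftIndex N D) (q : Fin N × Fin D)
    (hr : row (Sum.inl p : BasisIndex N D) = row (Sum.inr q : BasisIndex N D)) :
    target (Sum.inl p : BasisIndex N D) ≠ target (Sum.inr q : BasisIndex N D) := by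
  intro h
  have hr' : p.1.1.1 = q.1.succ.castSucc := hr
  have h1 := (target_inr_eq_zero q (j := q.2.castSucc)).2 (Or.inl rfl)
  have h2 := (target_inr_eq_zero q (j := q.2.succ)).2 (Or.inr rfl)
  rw [← h] at h1 h2
  change target _ (row (Sum.inr q : BasisIndex N D), _) = 0 at h1 h2
  rw [← hr] at h1 h2
  replace h1 : _ ∈ Finset.uIcc p.1.1.2.1 p.1.1.2.2 := mem_cols_of_target_eq_zero h1
  replace h2 : _ ∈ Finset.uIcc p.1.1.2.1 p.1.1.2.2 := mem_cols_of_target_eq_zero h2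
  rcases p.2.1 with h3 | h3 | h3
  · rw [h3, Finset.uIcc_self, Finset.mem_singleton] at h1 h2
    exact Fin.castSucc_lt_succ.ne (h1.trans h2.symm)
  · have := hr'.symm.trans h3.1
    simp [Fin.ext_iff] at this
  · have := hr'.symm.trans h3.1
    simp [Fin.ext_iff] at this
    omega

lemma target_injective {t t' : BasisIndex N D} (hr : t.row = t'.row)
    (h : t.target = t'.target) : t = t' := by
  rcases t with p | q <;> rcases t' with p' | q'
  · have h1 := target_inl_left p
    have h2 := target_inl_right p
    have h3 := target_inl_left p'
    have h4 := target_inl_right p'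
    have hr' : p.1.1.1 = p'.1.1.1 := hr
    rw [h, hr'] at h1 h2
    rw [← h, ← hr'] at h3 h4
    replace h1 := mem_cols_of_target_eq_zero h1
    replace h2 := mem_cols_of_target_eq_zero h2
    replace h3 := mem_cols_of_target_eq_zero h3
    replace h4 := mem_cols_of_target_eq_zero h4
    obtain ⟨⟨⟨s, c, e⟩, w⟩, hp⟩ := p
    obtain ⟨⟨⟨s', c', e'⟩, w'⟩, hp'⟩ := p'
    obtain rfl : s = s' := hr
    obtain ⟨rfl, rfl⟩ : c = c' ∧ e = e' := hp.1.eq_of_mem hp'.1 h3 h4 h1 h2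
    obtain rfl : w = w' := by
      rw [target_inl, target_inl] at h
      exact Finsupp.single_left_injective one_ne_zero (add_left_cancel (add_left_cancel h))
    rfl
  · exact absurd h (target_inl_ne_inr _ _ hr)
  · exact absurd h.symm (target_inl_ne_inr _ _ hr.symm)
  · obtain ⟨m, t⟩ := q
    obtain ⟨m', t'⟩ := q'
    obtain rfl : m = m' := Fin.succ_injective _ (Fin.castSucc_injective _ hr)
    have h1 := (target_inr_eq_zero (m, t) (j := t.castSucc)).2 (Or.inl rfl)
    have h2 := (target_inr_eq_zero (m, t) (j := t.succ)).2 (Or.inr rfl)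
    rw [h] at h1 h2
    replace h1 := (target_inr_eq_zero (m, t') (j := t.castSucc)).1 h1
    replace h2 := (target_inr_eq_zero (m, t') (j := t.succ)).1 h2
    obtain rfl : t = t' := by
      simp only [Fin.ext_iff, Fin.val_castSucc, Fin.val_succ] at *
      omega
    rfl

end BasisIndex

end Index

section Basis

variable {N D : ℕ}

/-- The coefficients that determine a homomorphism of degree zero. -/
def basisCoeff (k : Type) [Field k] (N D : ℕ) :
    degZeroHom k (Fin (N + 2) × Fin (D + 1)) (BoxIdeal k (N + 2) (D + 1)) →ₗ[k]
      (BasisIndex N D → k) where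
  toFun φ t := quotCoeff k t.target t.not_inBox_target (genImage φ.1 (monotone_const (c := t.row)))
  map_add' φ ψ := by
    ext t
    exact map_add _ _ _
  map_smul' r φ := by
    ext t
    exact map_smul _ r _

lemma eq_zero_of_basisCoeff
    {φ : degZeroHom k (Fin (N + 2) × Fin (D + 1)) (BoxIdeal k (N + 2) (D + 1))}
    (hφ : basisCoeff k N D φ = 0) : φ = 0 := by
  have hc := tangentCoeff_homCoeff φ.2
  ext1
  refine eq_zero_of_homCoeff fun i μ hi => ?_
  by_contra h
  obtain ⟨s, μ', hs⟩ := hc.exists_const D.succ_pos hi h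
  rw [← hs] at h
  obtain ⟨t, rfl, rfl⟩ : ∃ t : BasisIndex N D, t.row = s ∧ t.target = μ' := by
    rcases hc.classification h with ⟨a, e, w, h1, h2, h3⟩ | ⟨m, t, h1, h2⟩
    · exact ⟨Sum.inl ⟨((s, a, e), w), h1, h2⟩, rfl, h3.symm⟩
    · subst h1
      exact ⟨Sum.inr (m, t), rfl, h2.symm⟩
  rw [homCoeff, dif_pos ⟨monotone_const, t.not_inBox_target⟩] at h
  exact h (congrFun hφ t)

lemma basisCoeff_injective : Function.Injective (basisCoeff k N D) := by
  intro φ ψ h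
  have h0 : φ + (-1 : k) • ψ = 0 := by
    refine eq_zero_of_basisCoeff ?_
    rw [map_add, map_smul, h, neg_one_smul, add_neg_cancel]
  ext f
  have h1 := LinearMap.congr_fun (congrArg Subtype.val h0) f
  change φ.1 f + (-1 : k) • ψ.1 f = 0 at h1
  rwa [neg_one_smul, add_neg_eq_zero] at h1

/-- The homomorphism dual to a basis coefficient. -/
def basisHom (k : Type) [Field k] (t : BasisIndex N D) :
    degZeroHom k (Fin (N + 2) × Fin (D + 1)) (BoxIdeal k (N + 2) (D + 1)) :=
  ⟨shiftHom k t.num (rowExp t.row t.cols) t.shiftable, shiftHom_mem _ t.degree_num⟩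

lemma pathExp_const (s : Fin n) (J : Finset (Fin d)) :
    pathExp (fun _ => s) = rowExp s J + rowExp s Jᶜ :=
  (Finset.sum_add_sum_compl J _).symm

lemma basisCoeff_basisHom (t u : BasisIndex N D) :
    basisCoeff k N D (basisHom k u) t = if u = t then 1 else 0 := by
  change coeff t.target (monomial u.num (1 : k) *
    (monomial (pathExp fun _ => t.row) (1 : k)).divMonomial (rowExp u.row u.cols)) = _
  by_cases hr : u.row = t.row
  · have h1 : (monomial (pathExp fun _ => t.row) (1 : k)).divMonomial (rowExp u.row u.cols) =
        monomial (rowExp u.row u.colsᶜ) 1 := by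
      ext m
      rw [coeff_divMonomial, coeff_monomial, coeff_monomial, ← hr, pathExp_const _ u.cols]
      simp only [add_right_inj]
    rw [h1, monomial_mul, one_mul, coeff_monomial, add_comm u.num]
    refine if_congr ⟨fun h => BasisIndex.target_injective hr h, ?_⟩ rfl rfl
    rintro rfl
    rfl
  · have h0 : (monomial (pathExp fun _ => t.row) (1 : k)).divMonomial (rowExp u.row u.cols) = 0 := by
      ext m
      rw [coeff_divMonomial, coeff_monomial, if_neg, coeff_zero]
      intro h
      obtain ⟨j, hj⟩ := u.cols_nonempty
      have := DFunLike.congr_fun h (u.row, j)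
      rw [Finsupp.add_apply, pathExp_apply, rowExp_apply, if_neg (Ne.symm hr),
        if_pos ⟨rfl, hj⟩] at this
      omega
    rw [h0, mul_zero, coeff_zero, if_neg]
    rintro rfl
    exact hr rfl

lemma basisCoeff_surjective : Function.Surjective (basisCoeff k N D) := by
  intro f
  have := Fintype.ofFinite (BasisIndex N D)
  refine ⟨∑ u, f u • basisHom k u, ?_⟩
  ext t
  simp [map_sum, basisCoeff_basisHom]

theorem finrank_degZeroHom : Module.finrank k
    (degZeroHom k (Fin (N + 2) × Fin (D + 1)) (BoxIdeal k (N + 2) (D + 1))) =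
      Nat.card (BasisIndex N D) := by
  have := Fintype.ofFinite (BasisIndex N D)
  rw [(LinearEquiv.ofBijective _ ⟨basisCoeff_injective, basisCoeff_surjective⟩).finrank_eq,
    Module.finrank_fintype_fun_eq_card, Nat.card_eq_fintype_card]

end Basis

section Count

variable {N D : ℕ}

open Classical in
lemma sum_admVar (s : Fin (N + 2)) (c e : Fin (D + 1)) :
    (∑ w, if AdmVar s c e w then (1 : ℤ) else 0) =
      (N + 2) * D - (if c = e then 0 else 1) + (if e = Fin.last D then 0 else (N + 1 - s : ℤ)) +
        if e = 0 then 0 else (s : ℤ) := by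
  have h1 : (∑ r : Fin (N + 2), if s < r then (1 : ℤ) else 0) = N + 1 - s := by
    rw [Finset.sum_boole, Finset.filter_lt_eq_Ioi, Fin.card_Ioi]
    omega
  have h2 : (∑ r : Fin (N + 2), if r < s then (1 : ℤ) else 0) = s := by
    rw [Finset.sum_boole, Finset.filter_gt_eq_Iio, Fin.card_Iio]
  set E : ℤ := (if e = Fin.last D then 0 else (N + 1 - s : ℤ)) + if e = 0 then 0 else (s : ℤ) with hE
  have key : ∀ j, (∑ r, if AdmVar s c e (r, j) then (1 : ℤ) else 0) =
      ((N + 2) - if c = j then 1 else 0) +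
        if e = j then E - (N + 2) + (if c = j then 1 else 0) else 0 := by
    intro j
    by_cases hj : e = j
    · subst hj
      have h3 : ∀ r, (if AdmVar s c e (r, e) then (1 : ℤ) else 0) =
          (if e = Fin.last D then 0 else if s < r then 1 else 0) +
            if e = 0 then 0 else if r < s then 1 else 0 := by
        intro r
        have h4 : AdmVar s c e (r, e) ↔ (s < r ∧ e ≠ Fin.last D) ∨ (r < s ∧ e ≠ 0) := by
          rw [AdmVar, Fin.lt_last_iff_ne_last, Fin.pos_iff_ne_zero]
          refine ⟨fun h => h.2 rfl, fun h => ⟨?_, fun _ => h⟩⟩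
          rintro h0
          rw [Prod.mk.injEq] at h0
          rcases h with h | h
          · exact h.1.ne' h0.1
          · exact h.1.ne h0.1
        rw [if_congr h4 rfl rfl]
        rcases lt_trichotomy s r with h | h | h <;>
          by_cases ha : e = Fin.last D <;> by_cases hb : e = 0 <;>
          simp [h, ha, hb, h.not_gt, -Fin.last_eq_zero_iff, -Fin.zero_eq_last_iff]
      simp only [h3, Finset.sum_add_distrib, if_true]
      rw [hE]
      split_ifs <;> simp [h1, h2] <;> ring
    · have h3 : ∀ r, (if AdmVar s c e (r, j) then (1 : ℤ) else 0) =
          1 - if s = r then (if c = j then 1 else 0) else 0 := by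
        intro r
        have h4 : AdmVar s c e (r, j) ↔ ¬ (s = r ∧ c = j) := by
          rw [AdmVar, ne_eq, Prod.mk.injEq, and_iff_left fun h => absurd h.symm hj, eq_comm,
            eq_comm (a := j)]
        rw [if_congr h4 rfl rfl]
        split_ifs <;> simp_all
      simp [h3, hj, Finset.sum_sub_distrib]
  rw [Fintype.sum_prod_type_right]
  simp only [key, Finset.sum_add_distrib, Finset.sum_sub_distrib, Finset.sum_ite_eq,
    Finset.mem_univ, if_true, Finset.sum_const, Finset.card_univ, Fintype.card_fin, nsmul_eq_mul]
  rw [hE]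
  push_cast
  split_ifs <;> ring

lemma two_mul_sum_fin (m : ℕ) : 2 * ∑ i : Fin m, (i : ℤ) = m * (m - 1) := by
  induction m with
  | zero => simp
  | succ m ih =>
    rw [Fin.sum_univ_castSucc, mul_add]
    simp only [Fin.val_castSucc, ih, Fin.val_last]
    push_cast
    ring

lemma sum_lt (A B : ℤ) :
    2 * (∑ c : Fin (D + 1), ∑ e : Fin (D + 1),
      if c < e then A + (if e = Fin.last D then 0 else B) else 0) =
      D * (D + 1) * A + D * (D - 1) * B := by
  have h : ∀ e : Fin (D + 1), (∑ c : Fin (D + 1),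
      if c < e then A + (if e = Fin.last D then 0 else B) else 0) =
      e * (A + (if e = Fin.last D then 0 else B)) := by
    intro e
    rw [← Finset.sum_filter, Finset.sum_const, Finset.filter_gt_eq_Iio, Fin.card_Iio, nsmul_eq_mul]
  rw [Finset.sum_comm]
  simp only [h]
  rw [Fin.sum_univ_castSucc]
  simp only [Fin.castSucc_ne_last, if_true, if_false, ← Finset.sum_mul, Fin.val_castSucc,
    Fin.val_last]
  linear_combination (A + B) * two_mul_sum_fin D

lemma sum_gt (A B : ℤ) :
    2 * (∑ c : Fin (D + 1), ∑ e : Fin (D + 1),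
      if e < c then A + (if e = 0 then 0 else B) else 0) =
      D * (D + 1) * A + D * (D - 1) * B := by
  rw [← sum_lt A B, ← Equiv.sum_comp Fin.revPerm]
  congr 1
  refine Finset.sum_congr rfl fun c _ => ?_
  rw [← Equiv.sum_comp Fin.revPerm]
  simp [Fin.rev_eq_iff]

open Classical in
lemma sum_admCols (s : Fin (N + 2)) (c e : Fin (D + 1)) (x : ℤ) :
    (if AdmCols s c e then x else 0) = (if c = e then x else 0) +
      (if s = 0 then if c < e then x else 0 else 0) +
        if s = Fin.last (N + 1) then if e < c then x else 0 else 0 := by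
  have h0 : (0 : Fin (N + 2)) ≠ Fin.last (N + 1) := Fin.last_pos.ne
  unfold AdmCols
  rcases lt_trichotomy c e with h | h | h
  · simp [h.ne, h, h.not_gt]
  · simp [h]
  · simp [h.ne', h, h.not_gt]

theorem card_shiftIndex : (Nat.card (ShiftIndex N D) : ℤ) =
    (N + 2) * (D + 1) * ((N + 2) * D) + (N + 2) * D * (N + 1) +
      (D * (D + 1) * ((N + 2) * D - 1) + D * (D - 1) * (N + 1)) := by
  classical
  have h : (Nat.card (ShiftIndex N D) : ℤ) = ∑ s : Fin (N + 2), ∑ c : Fin (D + 1),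
      ∑ e : Fin (D + 1), if AdmCols s c e then ∑ w, if AdmVar s c e w then (1 : ℤ) else 0 else 0 := by
    rw [Nat.card_eq_fintype_card, Fintype.card_subtype, Finset.card_filter, Fintype.sum_prod_type,
      Fintype.sum_prod_type]
    push_cast
    refine Finset.sum_congr rfl fun s _ => ?_
    rw [Fintype.sum_prod_type]
    refine Finset.sum_congr rfl fun c _ => Finset.sum_congr rfl fun e _ => ?_
    split_ifs with hc <;> simp [hc]
  have hdiag : (∑ s : Fin (N + 2), ∑ c : Fin (D + 1), ∑ e : Fin (D + 1),
      if c = e then ∑ w, if AdmVar s c e w then (1 : ℤ) else 0 else 0) =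
      (N + 2) * (D + 1) * ((N + 2) * D) + (N + 2) * D * (N + 1) := by
    have h1 : ∀ s : Fin (N + 2), (∑ c : Fin (D + 1), ∑ e : Fin (D + 1),
        if c = e then ∑ w, if AdmVar s c e w then (1 : ℤ) else 0 else 0) =
        (D + 1) * ((N + 2) * D) + D * (N + 1) := by
      intro s
      simp only [Finset.sum_ite_eq, Finset.mem_univ, if_true, sum_admVar, Finset.sum_add_distrib]
      rw [Fin.sum_univ_castSucc (fun e : Fin (D + 1) => if e = Fin.last D then 0 else _),
        Fin.sum_univ_succ (fun e : Fin (D + 1) => if e = 0 then 0 else (s : ℤ))]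
      simp
      ring
    simp only [h1, Finset.sum_const, Finset.card_univ, Fintype.card_fin, nsmul_eq_mul]
    push_cast
    ring
  have hlt : (∑ s : Fin (N + 2), ∑ c : Fin (D + 1), ∑ e : Fin (D + 1),
      if s = 0 then if c < e then ∑ w, if AdmVar s c e w then (1 : ℤ) else 0 else 0 else 0) =
      ∑ c : Fin (D + 1), ∑ e : Fin (D + 1),
        if c < e then (N + 2) * D - 1 + (if e = Fin.last D then 0 else (N + 1 : ℤ)) else 0 := by
    rw [Fintype.sum_eq_single 0 fun s hs => by simp [hs]]
    refine Finset.sum_congr rfl fun c _ => Finset.sum_congr rfl fun e _ => ?_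
    rw [if_pos rfl]
    refine if_ctx_congr Iff.rfl (fun hce => ?_) fun _ => rfl
    rw [sum_admVar, if_neg hce.ne]
    simp
  have hgt : (∑ s : Fin (N + 2), ∑ c : Fin (D + 1), ∑ e : Fin (D + 1),
      if s = Fin.last (N + 1) then
        if e < c then ∑ w, if AdmVar s c e w then (1 : ℤ) else 0 else 0 else 0) =
      ∑ c : Fin (D + 1), ∑ e : Fin (D + 1),
        if e < c then (N + 2) * D - 1 + (if e = 0 then 0 else (N + 1 : ℤ)) else 0 := by
    rw [Fintype.sum_eq_single (Fin.last (N + 1)) fun s hs => by simp [hs]]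
    refine Finset.sum_congr rfl fun c _ => Finset.sum_congr rfl fun e _ => ?_
    rw [if_pos rfl]
    refine if_ctx_congr Iff.rfl (fun hce => ?_) fun _ => rfl
    rw [sum_admVar, if_neg hce.ne']
    simp
  rw [h]
  simp only [sum_admCols, Finset.sum_add_distrib]
  rw [hdiag, hlt, hgt]
  have h1 := sum_lt (D := D) ((N + 2) * D - 1) (N + 1)
  have h2 := sum_gt (D := D) ((N + 2) * D - 1) (N + 1)
  linarith

theorem card_basisIndex : (Nat.card (BasisIndex N D) : ℤ) =
    (N + 2) * (D + 1) ^ 2 * (D + 1 + (N + 2) - 1) - (D + 1) ^ 2 - (D + 1 + (N + 2) - 1) ^ 2 + 1 := by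
  rw [Nat.card_sum, Nat.card_prod, Nat.card_fin, Nat.card_fin]
  push_cast
  rw [card_shiftIndex]
  ring

end Count

end BoxPolarization

theorem statement2 (k : Type) [Field k] (n d : ℕ) (hn : 2 ≤ n) (hd : 2 ≤ d) :
    (Module.finrank k (degZeroHom k (Fin n × Fin d) (BoxIdeal k n d)) : ℤ) =
      (n : ℤ) * (d : ℤ)^2 * ((d : ℤ) + (n : ℤ) - 1)
        - (d : ℤ)^2 - ((d : ℤ) + (n : ℤ) - 1)^2 + 1 := by
  obtain ⟨N, rfl⟩ := Nat.exists_eq_add_of_le' hn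
  obtain ⟨D, rfl⟩ := Nat.exists_eq_add_of_le' (one_le_two.trans hd)
  rw [BoxPolarization.finrank_degZeroHom, BoxPolarization.card_basisIndex]
  push_cast
  ring

end
end

section
/- Let n' ≥ 3 and let T be a spanning tree of the complete graph K_{n'} on vertex set {1,…,n'} with edges labeled e_1,…,e_{n'−1}. Then the k-vector space (Hom_{S_T}(I_T, S_T/I_T))₀ of degree-preserving S_T-module homomorphisms from I_T to S_T/I_T has dimension exactly (3n'−4)(n'−1) + i(T). -/
/-!
Statement 3: For a spanning tree `T` of the complete graph on `n' ≥ 3` vertices with edges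
`e_1, …, e_{n'-1}`, the dimension of the space of degree-zero homomorphisms
`(Hom_{S_T}(I_T, S_T/I_T))₀` equals `(3n'−4)(n'−1) + i(T)`, where `i(T) = (n'−2)ν₁ + ν₂`
is computed from the numbers `ν_i` of vertices of degree `i` in the line graph `G_T` of `T`.
-/

set_option synthInstance.maxHeartbeats 800000
set_option maxHeartbeats 1600000

open MvPolynomial

noncomputable section

/-- The variables `x_{ia}` of `S_T`: pairs of a vertex `i` and an (labelled) edge `e_a`
incident to it. -/
def TreeVar (n' : ℕ) (edges : Fin (n' - 1) → Sym2 (Fin n')) : Type :=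
  {p : Fin n' × Fin (n' - 1) // p.1 ∈ edges p.2}

/-- The polarization `I_T ⊆ S_T` attached to a (labelled) spanning tree `T`:
it is generated by the monomials `x_{ia}·x_{jb}` for the pairs of distinct vertices `i, j`
such that the unique path in `T` from `i` to `j` starts with the edge `e_a` and ends with
the edge `e_b` (first/last edges being detected by distances in `T`). -/
def TreeIdeal (k : Type) [Field k] (n' : ℕ) (T : SimpleGraph (Fin n'))
    (edges : Fin (n' - 1) → Sym2 (Fin n')) :
    Ideal (MvPolynomial (TreeVar n' edges) k) :=
  Ideal.span {f | ∃ (i j : Fin n') (a b : Fin (n' - 1))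
    (hia : i ∈ edges a) (hjb : j ∈ edges b),
    i ≠ j ∧
    (∃ i', edges a = s(i, i') ∧ T.dist i' j + 1 = T.dist i j) ∧
    (∃ j', edges b = s(j', j) ∧ T.dist i j' + 1 = T.dist i j) ∧
    f = X (⟨(i, a), hia⟩ : TreeVar n' edges) * X (⟨(j, b), hjb⟩ : TreeVar n' edges)}

/-- The degree of the vertex `e_a` in the line graph `G_T` of `T`. -/
def lineDeg (n' : ℕ) (edges : Fin (n' - 1) → Sym2 (Fin n')) (a : Fin (n' - 1)) : ℕ :=
  Set.ncard {b : Fin (n' - 1) | b ≠ a ∧ ∃ v, v ∈ edges a ∧ v ∈ edges b}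

/-- The index `i(T) = (n'−2)·ν₁ + ν₂`, where `ν_i` is the number of vertices of the line
graph `G_T` of degree `i`. -/
def treeIndex (n' : ℕ) (edges : Fin (n' - 1) → Sym2 (Fin n')) : ℕ :=
  (n' - 2) * Set.ncard {a | lineDeg n' edges a = 1} + Set.ncard {a | lineDeg n' edges a = 2}

section EdgeIdeal

variable {k : Type} [Field k] {σ : Type}

/-- The exponent vector of the quadratic monomial `x_a x_b`. -/
def pairExp : Sym2 σ → (σ →₀ ℕ) :=
  Sym2.lift ⟨fun a b => Finsupp.single a 1 + Finsupp.single b 1, fun _ _ => add_comm _ _⟩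

lemma pairExp_mk (a b : σ) :
    pairExp s(a, b) = Finsupp.single a 1 + Finsupp.single b 1 := rfl

lemma monomial_pairExp_mk (a b : σ) :
    monomial (pairExp s(a, b)) (1 : k) = X a * X b := by
  rw [pairExp_mk, X, X, monomial_mul, one_mul]

lemma pairExp_injective : Function.Injective (pairExp : Sym2 σ → (σ →₀ ℕ)) := by
  intro e f
  induction e with | _ a b
  induction f with | _ c d
  intro h
  rw [pairExp_mk, pairExp_mk,
    Finsupp.single_add_single_eq_single_add_single one_ne_zero one_ne_zero] at h
  rcases h with ⟨h1, h2⟩ | ⟨-, h1, h2⟩ | ⟨h, -⟩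
  · rw [h1, h2]
  · rw [h1, h2, Sym2.eq_swap]
  · norm_num at h

lemma degree_pairExp (e : Sym2 σ) : (pairExp e).degree = 2 := by
  induction e with | _ a b
  rw [pairExp_mk, map_add, Finsupp.degree_single, Finsupp.degree_single]

lemma weight_one_apply (w : σ →₀ ℕ) : Finsupp.weight (1 : σ → ℕ) w = w.degree :=
  (DFunLike.congr_fun Finsupp.degree_eq_weight_one w).symm

lemma exists_pairExp_eq {w : σ →₀ ℕ} (hw : w.degree = 2) : ∃ e, pairExp e = w := by
  classical
  have h0 : w ≠ 0 := by rintro rfl; simp at hw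
  obtain ⟨a, ha⟩ := Finsupp.ne_iff.1 h0
  have hle : Finsupp.single a 1 ≤ w := by
    rw [Finsupp.single_le_iff]; exact Nat.one_le_iff_ne_zero.2 ha
  obtain ⟨v, rfl⟩ := exists_add_of_le hle
  rw [map_add, Finsupp.degree_single] at hw
  have h1 : v ≠ 0 := by rintro rfl; simp at hw
  obtain ⟨b, hb⟩ := Finsupp.ne_iff.1 h1
  have hle : Finsupp.single b 1 ≤ v := by
    rw [Finsupp.single_le_iff]; exact Nat.one_le_iff_ne_zero.2 hb
  obtain ⟨v, rfl⟩ := exists_add_of_le hle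
  rw [map_add, Finsupp.degree_single] at hw
  have hv : v = 0 := by
    rw [← Finsupp.degree_eq_zero_iff]; omega
  subst hv
  exact ⟨s(a, b), by rw [pairExp_mk, add_zero]⟩

lemma pairExp_apply_ne_zero {e : Sym2 σ} {x : σ} : pairExp e x ≠ 0 ↔ x ∈ e := by
  classical
  induction e with | _ a b
  rw [pairExp_mk, Sym2.mem_iff, Finsupp.add_apply, Finsupp.single_apply, Finsupp.single_apply]
  split_ifs with h1 h2 h2
  · simp [h1.symm]
  · simp [h1.symm]
  · simp [h2.symm]
  · simp [Ne.symm h1, Ne.symm h2]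

lemma pairExp_le_iff {e : Sym2 σ} {w : σ →₀ ℕ} (he : ¬ e.IsDiag) :
    pairExp e ≤ w ↔ ∀ x ∈ e, w x ≠ 0 := by
  classical
  induction e with | _ a b
  rw [Sym2.mk_isDiag_iff] at he
  constructor
  · intro h x hx
    have := h x
    have := pairExp_apply_ne_zero.2 hx
    omega
  · intro h x
    have ha := h a (Sym2.mem_mk_left _ _)
    have hb := h b (Sym2.mem_mk_right _ _)
    rw [pairExp_mk, Finsupp.add_apply, Finsupp.single_apply, Finsupp.single_apply]
    split_ifs with h1 h2 h2
    · exact absurd (h1.trans h2.symm) he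
    · subst h1; omega
    · subst h2; omega
    · omega

/-- The edge ideal of a graph. -/
def edgeIdeal (k : Type) [Field k] (H : SimpleGraph σ) : Ideal (MvPolynomial σ k) :=
  Ideal.span ((fun w => monomial w (1 : k)) '' (pairExp '' H.edgeSet))

variable {H : SimpleGraph σ}

lemma mem_edgeIdeal {f : MvPolynomial σ k} :
    f ∈ edgeIdeal k H ↔ ∀ w, coeff w f ≠ 0 → ∃ e ∈ H.edgeSet, pairExp e ≤ w := by
  rw [edgeIdeal, mem_ideal_span_monomial_image]
  simp [mem_support_iff]

lemma monomial_pairExp_mem {e : Sym2 σ} (he : e ∈ H.edgeSet) :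
    monomial (pairExp e) (1 : k) ∈ edgeIdeal k H :=
  Ideal.subset_span ⟨_, ⟨e, he, rfl⟩, rfl⟩

/-- The exponent vectors of the monomials outside the edge ideal. -/
def IsStandard (H : SimpleGraph σ) (w : σ →₀ ℕ) : Prop :=
  ∀ a b, H.Adj a b → w a ≠ 0 → w b ≠ 0 → False

lemma isStandard_iff {w : σ →₀ ℕ} :
    IsStandard H w ↔ ¬ ∃ e ∈ H.edgeSet, pairExp e ≤ w := by
  constructor
  · rintro h ⟨e, he, hle⟩
    have hd := H.not_isDiag_of_mem_edgeSet he
    rw [pairExp_le_iff hd] at hle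
    induction e with | _ a b
    exact h a b he (hle _ (Sym2.mem_mk_left _ _)) (hle _ (Sym2.mem_mk_right _ _))
  · intro h a b hab ha hb
    refine h ⟨s(a, b), hab, ?_⟩
    rw [pairExp_le_iff (by simpa using hab.ne)]
    intro x hx
    rcases Sym2.mem_iff.1 hx with rfl | rfl <;> assumption

lemma mem_edgeIdeal_iff_isStandard {f : MvPolynomial σ k} :
    f ∈ edgeIdeal k H ↔ ∀ w, IsStandard H w → coeff w f = 0 := by
  simp only [mem_edgeIdeal, isStandard_iff]
  refine forall_congr' fun w => ?_
  rw [not_imp_comm]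

open Classical in
/-- The coefficient of a standard monomial, as a functional on the quotient by the
edge ideal; it is zero on the other monomials. -/
def quotCoeff (k : Type) [Field k] (H : SimpleGraph σ) (w : σ →₀ ℕ) :
    (MvPolynomial σ k ⧸ edgeIdeal k H) →ₗ[k] k :=
  (((edgeIdeal k H).restrictScalars k).liftQ (if IsStandard H w then lcoeff k w else 0) (by
    intro f hf
    rw [LinearMap.mem_ker]
    split_ifs with hw
    · exact mem_edgeIdeal_iff_isStandard.1 hf w hw
    · rfl)).comp
    (Submodule.Quotient.restrictScalarsEquiv k (edgeIdeal k H)).symm.toLinearMap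

lemma quotCoeff_mk {w : σ →₀ ℕ} (hw : IsStandard H w) (f : MvPolynomial σ k) :
    quotCoeff k H w (Ideal.Quotient.mk _ f) = coeff w f := by
  classical
  have : quotCoeff k H w (Ideal.Quotient.mk _ f) = (if IsStandard H w then lcoeff k w else 0) f :=
    rfl
  rw [this, if_pos hw]
  rfl

lemma quotCoeff_X_smul {w : σ →₀ ℕ} {v : σ} (hw : IsStandard H (Finsupp.single v 1 + w))
    (z : MvPolynomial σ k ⧸ edgeIdeal k H) :
    quotCoeff k H (Finsupp.single v 1 + w) ((X v : MvPolynomial σ k) • z) =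
      quotCoeff k H w z := by
  have hw' : IsStandard H w := fun a b hab ha hb =>
    hw a b hab (by rw [Finsupp.add_apply]; omega) (by rw [Finsupp.add_apply]; omega)
  obtain ⟨f, rfl⟩ := Ideal.Quotient.mk_surjective z
  have : (X v : MvPolynomial σ k) • Ideal.Quotient.mk (edgeIdeal k H) f =
    Ideal.Quotient.mk (edgeIdeal k H) (X v * f) := rfl
  rw [this, quotCoeff_mk hw, quotCoeff_mk hw', coeff_X_mul]

lemma quotCoeff_X_smul_of_eq_zero {w : σ →₀ ℕ} {v : σ} (hw : IsStandard H w) (hv : w v = 0)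
    (z : MvPolynomial σ k ⧸ edgeIdeal k H) :
    quotCoeff k H w ((X v : MvPolynomial σ k) • z) = 0 := by
  classical
  obtain ⟨f, rfl⟩ := Ideal.Quotient.mk_surjective z
  have : (X v : MvPolynomial σ k) • Ideal.Quotient.mk (edgeIdeal k H) f =
    Ideal.Quotient.mk (edgeIdeal k H) (X v * f) := rfl
  rw [this, quotCoeff_mk hw, coeff_X_mul', if_neg (by simpa using hv)]

/-- The value of a homomorphism at the generator of an edge. -/
def genValue (φ : edgeIdeal k H →ₗ[MvPolynomial σ k] (MvPolynomial σ k ⧸ edgeIdeal k H))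
    (e : H.edgeSet) : MvPolynomial σ k ⧸ edgeIdeal k H :=
  φ ⟨monomial (pairExp e.1) 1, monomial_pairExp_mem e.2⟩

lemma X_smul_genValue (φ : edgeIdeal k H →ₗ[MvPolynomial σ k] (MvPolynomial σ k ⧸ edgeIdeal k H))
    {q r v : σ} (hr : H.Adj q r) (hv : H.Adj q v) :
    (X v : MvPolynomial σ k) • genValue φ ⟨s(q, r), hr⟩ =
      (X r : MvPolynomial σ k) • genValue φ ⟨s(q, v), hv⟩ := by
  rw [genValue, genValue, ← map_smul, ← map_smul]
  congr 1
  ext1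
  simp only [Submodule.coe_smul, monomial_pairExp_mk, smul_eq_mul]
  ring

lemma eq_zero_of_genValue
    {φ : edgeIdeal k H →ₗ[MvPolynomial σ k] (MvPolynomial σ k ⧸ edgeIdeal k H)}
    (h : ∀ e, genValue φ e = 0) : φ = 0 := by
  ext ⟨f, hf⟩
  rw [LinearMap.zero_apply]
  induction hf using Submodule.span_induction with
  | mem x hx =>
    obtain ⟨_, ⟨e, he, rfl⟩, rfl⟩ := hx
    exact h ⟨e, he⟩
  | zero => exact map_zero φ
  | add x y hx hy ihx ihy =>
    have : (⟨x + y, Submodule.add_mem _ hx hy⟩ : edgeIdeal k H) = ⟨x, hx⟩ + ⟨y, hy⟩ := rfl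
    rw [this, map_add, ihx, ihy, add_zero]
  | smul a x hx ihx =>
    have : (⟨a • x, Submodule.smul_mem _ a hx⟩ : edgeIdeal k H) = a • ⟨x, hx⟩ := rfl
    rw [this, map_smul, ihx, smul_zero]

/-- A homomorphism preserving degrees vanishes at a generator as soon as all quadratic standard
coefficients of its value there do. -/
lemma genValue_eq_zero
    {φ : edgeIdeal k H →ₗ[MvPolynomial σ k] (MvPolynomial σ k ⧸ edgeIdeal k H)}
    (hφ : φ ∈ degZeroHom k σ (edgeIdeal k H)) (e : H.edgeSet)
    (h : ∀ u, IsStandard H (pairExp u) → quotCoeff k H (pairExp u) (genValue φ e) = 0) :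
    genValue φ e = 0 := by
  obtain ⟨g, hg, hg'⟩ := hφ 2 (monomial (pairExp e.1) 1) (monomial_pairExp_mem e.2)
    (isHomogeneous_monomial _ (degree_pairExp _))
  have hval : genValue φ e = Ideal.Quotient.mk _ g := hg'
  rw [hval, Ideal.Quotient.eq_zero_iff_mem, mem_edgeIdeal_iff_isStandard]
  intro w hw
  by_contra hc
  have hd : w.degree = 2 := by
    have := hg hc
    rwa [weight_one_apply] at this
  obtain ⟨u, rfl⟩ := exists_pairExp_eq hd
  have := h u hw
  rw [hval, quotCoeff_mk hw] at this
  exact hc this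

/-- The homomorphism induced by the derivation `x_p ∂/∂x_q`. -/
def derivHom (k : Type) [Field k] (H : SimpleGraph σ) (q p : σ) :
    edgeIdeal k H →ₗ[MvPolynomial σ k] (MvPolynomial σ k ⧸ edgeIdeal k H) where
  toFun f := Ideal.Quotient.mk _ (X p * pderiv q f.1)
  map_add' f g := by simp [mul_add]
  map_smul' s f := by
    have hf : Ideal.Quotient.mk (edgeIdeal k H) f.1 = 0 := Ideal.Quotient.eq_zero_iff_mem.2 f.2
    have : ∀ z, s • Ideal.Quotient.mk (edgeIdeal k H) z =
      Ideal.Quotient.mk (edgeIdeal k H) (s * z) := fun _ => rfl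
    rw [RingHom.id_apply, this]
    simp only [Submodule.coe_smul, smul_eq_mul, Derivation.leibniz, map_mul, map_add, hf]
    ring

lemma derivHom_mem (q p : σ) : derivHom k H q p ∈ degZeroHom k σ (edgeIdeal k H) := by
  intro e f hf he
  refine ⟨X p * pderiv q f, ?_, rfl⟩
  rcases Nat.eq_zero_or_pos e with rfl | hpos
  · have : f = C (coeff 0 f) := by
      rw [← totalDegree_eq_zero_iff_eq_C]
      exact Nat.le_zero.1 he.totalDegree_le
    rw [this, pderiv_C, mul_zero]
    exact isHomogeneous_zero _ _ _
  · have := (isHomogeneous_X k p).mul (he.pderiv (i := q))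
    rwa [Nat.add_sub_cancel' hpos] at this

open Classical in
lemma genValue_derivHom (q p a b : σ) (hab : H.Adj a b) :
    genValue (derivHom k H q p) ⟨s(a, b), hab⟩ =
      Ideal.Quotient.mk _ ((if a = q then monomial (pairExp s(p, b)) 1 else 0) +
        (if b = q then monomial (pairExp s(p, a)) 1 else 0)) := by
  have : genValue (derivHom k H q p) ⟨s(a, b), hab⟩ =
    Ideal.Quotient.mk _ (X p * pderiv q (monomial (pairExp s(a, b)) 1)) := rfl
  rw [this]
  congr 1
  simp only [monomial_pairExp_mk, Derivation.leibniz, smul_eq_mul, pderiv_X, Pi.single_apply]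
  split_ifs <;> simp_all
  ring

/-- The condition on the quadratic monomial `u` under which sending the generator of the edge `e`
to `u` and the other generators to zero defines a homomorphism. -/
def IsReplacement (H : SimpleGraph σ) (e u : Sym2 σ) : Prop :=
  (∀ x ∈ u, x ∉ e) ∧ IsStandard H (pairExp u) ∧
    ∀ q r v, e = s(q, r) → H.Adj q v → v ≠ r → ∃ s ∈ u, H.Adj s v

lemma IsReplacement.monomial_mul_mem {e u : Sym2 σ} (h : IsReplacement H e u) (v : σ)
    {f : MvPolynomial σ k} (hf : f ∈ edgeIdeal k H) :
    monomial (pairExp u) (1 : k) * ((X v * f).divMonomial (pairExp e) -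
      X v * f.divMonomial (pairExp e)) ∈ edgeIdeal k H := by
  classical
  rw [mem_edgeIdeal_iff_isStandard]
  intro w hw
  rw [coeff_monomial_mul']
  split_ifs with hle
  swap
  · rfl
  obtain ⟨w, rfl⟩ := exists_add_of_le hle
  rw [add_tsub_cancel_left, one_mul, coeff_sub, coeff_divMonomial, coeff_X_mul', coeff_X_mul',
    coeff_divMonomial]
  by_cases hv : v ∈ w.support
  · rw [if_pos hv, if_pos (by simp at hv ⊢; omega), sub_eq_zero]
    congr 1
    rw [add_tsub_assoc_of_le]
    rw [Finsupp.single_le_iff]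
    exact Nat.one_le_iff_ne_zero.2 (Finsupp.mem_support_iff.1 hv)
  · rw [if_neg hv, sub_zero]
    split_ifs with hv'
    swap
    · rfl
    by_contra hc
    have hwv : w v = 0 := by simpa using hv
    have hve : v ∈ e := by
      rw [← pairExp_apply_ne_zero]
      simpa [hwv] using hv'
    obtain ⟨z, rfl⟩ := hve
    have hexp : pairExp s(v, z) + w - Finsupp.single v 1 = Finsupp.single z 1 + w := by
      rw [pairExp_mk, add_assoc, add_tsub_cancel_left]
    rw [hexp] at hc
    have key : ∀ y, H.Adj z y → (Finsupp.single z 1 + w : σ →₀ ℕ) y ≠ 0 → False := by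
      intro y hy hne
      rw [Finsupp.add_apply, Finsupp.single_apply, if_neg hy.ne, zero_add] at hne
      obtain ⟨s, hs, hsy⟩ := h.2.2 z v y Sym2.eq_swap hy (by rintro rfl; exact hne hwv)
      refine hw s y hsy ?_ ?_
      · have := pairExp_apply_ne_zero.2 hs
        rw [Finsupp.add_apply]; omega
      · rw [Finsupp.add_apply]; omega
    refine hc (mem_edgeIdeal_iff_isStandard.1 hf _ fun a b hab ha hb => ?_)
    by_cases haz : z = a
    · subst haz; exact key b hab hb
    by_cases hbz : z = b
    · subst hbz; exact key a hab.symm ha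
    rw [Finsupp.add_apply, Finsupp.single_apply, if_neg haz, zero_add] at ha
    rw [Finsupp.add_apply, Finsupp.single_apply, if_neg hbz, zero_add] at hb
    exact hw a b hab (by rw [Finsupp.add_apply]; omega) (by rw [Finsupp.add_apply]; omega)

lemma IsReplacement.mk_monomial_mul_divMonomial_mul {e u : Sym2 σ} (h : IsReplacement H e u)
    (s : MvPolynomial σ k) :
    ∀ f ∈ edgeIdeal k H,
      Ideal.Quotient.mk (edgeIdeal k H)
        (monomial (pairExp u) (1 : k) * (s * f).divMonomial (pairExp e)) =
      Ideal.Quotient.mk (edgeIdeal k H)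
        (s * (monomial (pairExp u) (1 : k) * f.divMonomial (pairExp e))) := by
  induction s using MvPolynomial.induction_on with
  | C a =>
    intro f _
    congr 1
    have : (C a * f).divMonomial (pairExp e) = C a * f.divMonomial (pairExp e) := by
      ext w
      simp [coeff_divMonomial, coeff_C_mul]
    rw [this]
    ring
  | add p q hp hq =>
    intro f hf
    rw [add_mul, add_divMonomial, mul_add, map_add, hp f hf, hq f hf, add_mul, map_add]
  | mul_X p v hp =>
    intro f hf
    rw [mul_assoc, hp _ (Ideal.mul_mem_left _ _ hf), map_mul, mul_assoc, map_mul _ p]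
    congr 1
    rw [Ideal.Quotient.eq]
    convert h.monomial_mul_mem v hf using 1
    ring

/-- The homomorphism sending the generator of `e` to `u` and the other generators to zero. -/
def replaceHom (k : Type) [Field k] (H : SimpleGraph σ) (e u : Sym2 σ) (h : IsReplacement H e u) :
    edgeIdeal k H →ₗ[MvPolynomial σ k] (MvPolynomial σ k ⧸ edgeIdeal k H) where
  toFun f := Ideal.Quotient.mk _ (monomial (pairExp u) 1 * f.1.divMonomial (pairExp e))
  map_add' f g := by simp [add_divMonomial, mul_add]
  map_smul' s f := h.mk_monomial_mul_divMonomial_mul s f.1 f.2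

lemma replaceHom_mem (e u : Sym2 σ) (h : IsReplacement H e u) :
    replaceHom k H e u h ∈ degZeroHom k σ (edgeIdeal k H) := by
  classical
  intro d f hf hd
  refine ⟨_, ?_, rfl⟩
  intro w hw
  rw [coeff_monomial_mul'] at hw
  split_ifs at hw with hle
  swap
  · exact absurd rfl hw
  obtain ⟨w, rfl⟩ := exists_add_of_le hle
  rw [add_tsub_cancel_left, one_mul, coeff_divMonomial] at hw
  have := hd hw
  rw [weight_one_apply] at this ⊢
  rw [← this, map_add, map_add, degree_pairExp, degree_pairExp]

open Classical in
lemma genValue_replaceHom (e u : Sym2 σ) (h : IsReplacement H e u) (e' : H.edgeSet) :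
    genValue (replaceHom k H e u h) e' =
      Ideal.Quotient.mk _ (if e'.1 = e then monomial (pairExp u) 1 else 0) := by
  have : genValue (replaceHom k H e u h) e' = Ideal.Quotient.mk _
    (monomial (pairExp u) 1 * (monomial (pairExp e'.1) 1).divMonomial (pairExp e)) := rfl
  rw [this]
  congr 1
  split_ifs with he
  · rw [he, divMonomial_monomial, mul_one]
  · have : (monomial (pairExp e'.1) (1 : k)).divMonomial (pairExp e) = 0 := by
      ext w
      rw [coeff_divMonomial, coeff_monomial, if_neg, coeff_zero]
      intro heq
      have hd := congrArg Finsupp.degree heq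
      rw [map_add, degree_pairExp, degree_pairExp] at hd
      have hw : w = 0 := by rw [← Finsupp.degree_eq_zero_iff]; omega
      rw [hw, add_zero] at heq
      exact he (pairExp_injective heq)
    rw [this, mul_zero]

/-- The coefficient of `u` in the value of a homomorphism at the generator of `e`. -/
def valueCoeff (k : Type) [Field k] (H : SimpleGraph σ) (e : H.edgeSet) (u : Sym2 σ) :
    degZeroHom k σ (edgeIdeal k H) →ₗ[k] k where
  toFun φ := quotCoeff k H (pairExp u) (genValue φ.1 e)
  map_add' φ ψ := map_add _ _ _
  map_smul' c φ := by
    have : genValue (c • φ).1 e = c • genValue φ.1 e := rfl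
    rw [this, map_smul, RingHom.id_apply]

lemma isStandard_pairExp_iff {a b : σ} : IsStandard H (pairExp s(a, b)) ↔ ¬ H.Adj a b := by
  constructor
  · intro h hab
    exact h a b hab (pairExp_apply_ne_zero.2 (Sym2.mem_mk_left _ _))
      (pairExp_apply_ne_zero.2 (Sym2.mem_mk_right _ _))
  · intro h c d hcd hc hd
    rw [pairExp_apply_ne_zero, Sym2.mem_iff] at hc hd
    rcases hc with rfl | rfl <;> rcases hd with rfl | rfl
    · exact hcd.ne rfl
    · exact h hcd
    · exact h hcd.symm
    · exact hcd.ne rfl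

/-- If `u` meets neither end of `e` and is not a replacement of `e`, then the coefficient of `u` in
the value at `e` vanishes. -/
lemma quotCoeff_genValue_of_not_isReplacement
    (φ : edgeIdeal k H →ₗ[MvPolynomial σ k] (MvPolynomial σ k ⧸ edgeIdeal k H))
    (e : H.edgeSet) {u : Sym2 σ} (hu : IsStandard H (pairExp u)) (hd : ∀ x ∈ u, x ∉ e.1)
    (hr : ¬ IsReplacement H e.1 u) : quotCoeff k H (pairExp u) (genValue φ e) = 0 := by
  classical
  obtain ⟨e, he⟩ := e
  have : ∃ q r v, e = s(q, r) ∧ H.Adj q v ∧ v ≠ r ∧ ∀ s ∈ u, ¬ H.Adj s v := by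
    by_contra! hcon
    exact hr ⟨hd, hu, fun q r v h1 h2 h3 => hcon q r v h1 h2 h3⟩
  obtain ⟨q, r, v, rfl, hv, hvr, huv⟩ := this
  have hstd : IsStandard H (Finsupp.single v 1 + pairExp u) := by
    intro a b hab ha hb
    rw [Finsupp.add_apply, Finsupp.single_apply] at ha hb
    split_ifs at ha hb with h1 h2 h2
    · exact hab.ne (h1.symm.trans h2)
    · subst h1
      exact huv b (pairExp_apply_ne_zero.1 (by omega)) hab.symm
    · subst h2
      exact huv a (pairExp_apply_ne_zero.1 (by omega)) hab
    · exact hu a b hab (by omega) (by omega)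
  rw [← quotCoeff_X_smul hstd, X_smul_genValue φ he hv, quotCoeff_X_smul_of_eq_zero hstd]
  have h1 : pairExp u r = 0 := by
    by_contra h
    exact hd r (pairExp_apply_ne_zero.1 h) (Sym2.mem_mk_right _ _)
  rw [Finsupp.add_apply, h1, Finsupp.single_apply, if_neg hvr]

/-- Moving `q` to `p` at the edge `q r` has the same coefficient as at the edge `q t`. -/
lemma quotCoeff_genValue_eq_of_not_adj
    (φ : edgeIdeal k H →ₗ[MvPolynomial σ k] (MvPolynomial σ k ⧸ edgeIdeal k H))
    {q p r t : σ} (hr : H.Adj q r) (ht : H.Adj q t) (hpr : ¬ H.Adj p r) (hpt : ¬ H.Adj p t)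
    (hrt : ¬ H.Adj t r) :
    quotCoeff k H (pairExp s(p, r)) (genValue φ ⟨s(q, r), hr⟩) =
      quotCoeff k H (pairExp s(p, t)) (genValue φ ⟨s(q, t), ht⟩) := by
  classical
  have hstd : IsStandard H (Finsupp.single t 1 + pairExp s(p, r)) := by
    have hmem : ∀ a, (Finsupp.single t 1 + pairExp s(p, r) : σ →₀ ℕ) a ≠ 0 → a = t ∨ a = p ∨ a = r := by
      intro a ha
      by_contra! hcon
      refine ha ?_
      rw [Finsupp.add_apply, Finsupp.single_apply, if_neg hcon.1.symm, zero_add]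
      by_contra h
      rcases Sym2.mem_iff.1 (pairExp_apply_ne_zero.1 h) with h | h
      · exact hcon.2.1 h
      · exact hcon.2.2 h
    intro a b hab ha hb
    have h1 := hab.symm
    rcases hmem a ha with rfl | rfl | rfl <;> rcases hmem b hb with rfl | rfl | rfl <;>
      first | exact hab.ne rfl | contradiction
  have hexp : Finsupp.single t 1 + pairExp s(p, r) = Finsupp.single r 1 + pairExp s(p, t) := by
    rw [pairExp_mk, pairExp_mk]
    abel
  rw [← quotCoeff_X_smul hstd, X_smul_genValue φ hr ht]
  rw [hexp] at hstd ⊢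
  exact quotCoeff_X_smul hstd _

/-- The pairs `(q, p)` for which `x_p ∂/∂x_q` is nonzero on the edge ideal. -/
def IsMove (H : SimpleGraph σ) (x : σ × σ) : Prop :=
  x.1 ≠ x.2 ∧ ∃ r, H.Adj x.1 r ∧ ¬ H.Adj x.2 r

/-- Suppose that, for all `q ≠ p`, among the neighbours of `q` that are not neighbours of `p`
(if any) there is one which is adjacent to none of them. Then the homomorphisms of degree zero
have a basis consisting of the derivations `x_p ∂/∂x_q` and the replacements. -/
theorem finrank_degZeroHom_edgeIdeal [Finite σ] (hub : σ → σ → σ)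
    (hhub : ∀ q p, IsMove H (q, p) → H.Adj q (hub q p) ∧ ¬ H.Adj p (hub q p) ∧
      ∀ r, H.Adj q r → ¬ H.Adj p r → ¬ H.Adj (hub q p) r) :
    Module.finrank k (degZeroHom k σ (edgeIdeal k H)) =
      Nat.card {x : σ × σ // IsMove H x} +
        Nat.card {x : Sym2 σ × Sym2 σ // x.1 ∈ H.edgeSet ∧ IsReplacement H x.1 x.2} := by
  classical
  let J₁ := {x : σ × σ // IsMove H x}
  let J₂ := {x : Sym2 σ × Sym2 σ // x.1 ∈ H.edgeSet ∧ IsReplacement H x.1 x.2}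
  have := Fintype.ofFinite σ
  have : Fintype (J₁ ⊕ J₂) := Fintype.ofFinite _
  let E : J₁ ⊕ J₂ → H.edgeSet := Sum.elim
    (fun x => ⟨s(x.1.1, hub x.1.1 x.1.2), (hhub _ _ x.2).1⟩) (fun x => ⟨x.1.1, x.2.1⟩)
  let U : J₁ ⊕ J₂ → Sym2 σ := Sum.elim
    (fun x => s(x.1.2, hub x.1.1 x.1.2)) (fun x => x.1.2)
  have hU : ∀ j, IsStandard H (pairExp (U j)) := by
    rintro (⟨⟨q, p⟩, hx⟩ | x)
    · exact isStandard_pairExp_iff.2 (hhub q p hx).2.1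
    · exact x.2.2.2.1
  let Ψ : degZeroHom k σ (edgeIdeal k H) →ₗ[k] (J₁ ⊕ J₂ → k) :=
    LinearMap.pi fun j => valueCoeff k H (E j) (U j)
  let B : J₁ ⊕ J₂ → degZeroHom k σ (edgeIdeal k H) := Sum.elim
    (fun x => ⟨derivHom k H x.1.1 x.1.2, derivHom_mem _ _⟩)
    (fun x => ⟨replaceHom k H x.1.1 x.1.2 x.2.2, replaceHom_mem _ _ _⟩)
  have hΨB : ∀ j, Ψ (B j) = Pi.single j 1 := by
    intro j
    ext i
    change quotCoeff k H (pairExp (U i)) (genValue (B j).1 (E i)) = _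
    rcases j with ⟨⟨q, p⟩, hx⟩ | ⟨⟨e, u⟩, he, hu⟩
    · change quotCoeff k H (pairExp (U i)) (genValue (derivHom k H q p) (E i)) = _
      rcases i with ⟨⟨q', p'⟩, hx'⟩ | ⟨⟨e', u'⟩, he', hu'⟩
      · change quotCoeff k H (pairExp s(p', hub q' p'))
          (genValue (derivHom k H q p) ⟨s(q', hub q' p'), (hhub _ _ hx').1⟩) = _
        rw [genValue_derivHom, quotCoeff_mk (isStandard_pairExp_iff.2 (hhub _ _ hx').2.1)]
        have hz : coeff (pairExp s(p', hub q' p')) (if hub q' p' = q then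
            monomial (pairExp s(p, q')) (1 : k) else 0) = 0 := by
          split_ifs with h
          swap
          · rfl
          rw [coeff_monomial, if_neg]
          intro heq
          have heq := pairExp_injective heq
          have h1 := (hhub q' p' hx').1.ne
          have h2 := hx.1
          rw [h, Sym2.eq_iff] at heq
          rw [h] at h1
          rcases heq with ⟨-, h3⟩ | ⟨h3, -⟩
          · exact h1 h3
          · exact h2 h3.symm
        rw [coeff_add, hz, add_zero]
        by_cases hq : q' = q
        · subst hq
          rw [if_pos rfl, coeff_monomial]
          by_cases hp : p' = p
          · subst hp
            rw [if_pos rfl, Pi.single_eq_same]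
          · rw [Pi.single_eq_of_ne fun heq =>
              hp (congrArg (fun x => x.1.2) (Sum.inl.inj heq)), if_neg]
            intro heq
            have heq := pairExp_injective heq
            rw [Sym2.eq_iff] at heq
            rcases heq with ⟨h3, -⟩ | ⟨h3, h4⟩
            · exact hp h3.symm
            · exact hp (h4.symm.trans h3.symm)
        · rw [if_neg hq, coeff_zero, Pi.single_eq_of_ne fun heq =>
            hq (congrArg (fun x => x.1.1) (Sum.inl.inj heq))]
      · change quotCoeff k H (pairExp u') (genValue (derivHom k H q p) ⟨e', he'⟩) = _
        rw [Pi.single_eq_of_ne Sum.inr_ne_inl]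
        induction e' with | _ a b
        rw [genValue_derivHom q p a b he', quotCoeff_mk hu'.2.1]
        have hz : ∀ y ∈ s(a, b), coeff (pairExp u') (monomial (pairExp s(p, y)) (1 : k)) = 0 := by
          intro y hy
          rw [coeff_monomial, if_neg]
          intro heq
          refine hu'.1 y ?_ hy
          rw [← pairExp_injective heq]
          exact Sym2.mem_mk_right _ _
        rw [coeff_add]
        split_ifs <;> simp only [coeff_zero, hz _ (Sym2.mem_mk_left _ _),
          hz _ (Sym2.mem_mk_right _ _), add_zero]
    · change quotCoeff k H (pairExp (U i)) (genValue (replaceHom k H e u hu) (E i)) = _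
      rw [genValue_replaceHom, quotCoeff_mk (hU i)]
      rcases i with ⟨⟨q', p'⟩, hx'⟩ | ⟨⟨e', u'⟩, he', hu'⟩
      · rw [Pi.single_eq_of_ne Sum.inl_ne_inr]
        split_ifs with h
        swap
        · rfl
        rw [coeff_monomial, if_neg]
        intro heq
        have heq := pairExp_injective heq
        have h1 : hub q' p' ∈ u := by rw [heq]; exact Sym2.mem_mk_right _ _
        refine hu.1 _ h1 ?_
        change _ ∈ e
        rw [← h]
        exact Sym2.mem_mk_right _ _
      · change coeff (pairExp u') (if e' = e then monomial (pairExp u) (1 : k) else 0) = _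
        by_cases h : e' = e
        · subst h
          rw [if_pos rfl, coeff_monomial]
          by_cases h' : u = u'
          · subst h'
            rw [if_pos rfl, Pi.single_eq_same]
          · rw [if_neg fun heq => h' (pairExp_injective heq), Pi.single_eq_of_ne fun heq =>
              h' (congrArg (fun x => x.1.2) (Sum.inr.inj heq)).symm]
        · rw [if_neg h, coeff_zero, Pi.single_eq_of_ne fun heq =>
            h (congrArg (fun x => x.1.1) (Sum.inr.inj heq))]
  have hsurj : Function.Surjective Ψ := by
    rw [← LinearMap.range_eq_top, eq_top_iff, ← (Pi.basisFun k (J₁ ⊕ J₂)).span_eq,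
      Submodule.span_le]
    rintro _ ⟨j, rfl⟩
    exact ⟨B j, by rw [hΨB, Pi.basisFun_apply]⟩
  have hzero : ∀ φ, Ψ φ = 0 → φ.1 = 0 := by
    rintro ⟨φ, hφ⟩ hker
    have hcoord : ∀ j, quotCoeff k H (pairExp (U j)) (genValue φ (E j)) = 0 :=
      fun j => congrFun hker j
    have hmove : ∀ q p r (hqr : H.Adj q r), ¬ H.Adj p r → q ≠ p →
        quotCoeff k H (pairExp s(p, r)) (genValue φ ⟨s(q, r), hqr⟩) = 0 := by
      intro q p r hqr hpr hne
      have hx : IsMove H (q, p) := ⟨hne, r, hqr, hpr⟩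
      obtain ⟨h1, h2, h3⟩ := hhub q p hx
      rw [quotCoeff_genValue_eq_of_not_adj φ hqr h1 hpr h2 (h3 r hqr hpr)]
      exact hcoord (Sum.inl ⟨(q, p), hx⟩)
    refine eq_zero_of_genValue fun e => genValue_eq_zero hφ e fun u hu => ?_
    by_cases hd : ∀ x ∈ u, x ∉ e.1
    · by_cases hr : IsReplacement H e.1 u
      · exact hcoord (Sum.inr ⟨(e.1, u), e.2, hr⟩)
      · exact quotCoeff_genValue_of_not_isReplacement φ e hu hd hr
    · push Not at hd
      obtain ⟨r, hru, hre⟩ := hd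
      obtain ⟨p, rfl⟩ := hru
      obtain ⟨e, he⟩ := e
      obtain ⟨q, rfl⟩ := hre
      have hpr : ¬ H.Adj p r := fun h => isStandard_pairExp_iff.1 hu h.symm
      have heq : (⟨s(r, q), he⟩ : H.edgeSet) = ⟨s(q, r), he.symm⟩ := Subtype.ext Sym2.eq_swap
      rw [heq, Sym2.eq_swap]
      refine hmove q p r _ hpr ?_
      rintro rfl
      exact hpr he.symm
  have hinj : Function.Injective Ψ := by
    intro φ ψ h
    have h0 : Ψ (φ + (-1 : k) • ψ) = 0 := by
      rw [map_add, map_smul, h, neg_one_smul, add_neg_cancel]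
    have h1 : φ.1 + (-1 : k) • ψ.1 = 0 := hzero _ h0
    ext x
    have h2 : φ.1 x + (-1 : k) • ψ.1 x = 0 := LinearMap.congr_fun h1 x
    rwa [neg_one_smul, add_neg_eq_zero] at h2
  rw [(LinearEquiv.ofBijective Ψ ⟨hinj, hsurj⟩).finrank_eq, Module.finrank_fintype_fun_eq_card,
    ← Nat.card_eq_fintype_card, Nat.card_sum]

end EdgeIdeal

section Halfspaces

/-- Counting unordered pairs inside a finite set that contain a given nonempty subset. -/
lemma card_sym2_between {σ : Type} [Finite σ] {B D : Set σ} (hDB : D ⊆ B) (hD : D.Nonempty) :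
    Nat.card {u : Sym2 σ // (∀ s ∈ u, s ∈ B) ∧ ∀ f, f ∈ D → f ∈ u} =
      (if D.ncard = 1 then B.ncard else 0) + if D.ncard = 2 then 1 else 0 := by
  classical
  by_cases h1 : D.ncard = 1
  · rw [if_pos h1, if_neg (by omega), add_zero]
    obtain ⟨f, rfl⟩ := Set.ncard_eq_one.1 h1
    have hf : f ∈ B := hDB rfl
    rw [← Nat.card_coe_set_eq]
    refine (Nat.card_congr (Equiv.ofBijective (fun t : B =>
      (⟨s(f, t), ?_, ?_⟩ : {u : Sym2 σ // (∀ s ∈ u, s ∈ B) ∧ ∀ g, g ∈ ({f} : Set σ) → g ∈ u}))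
      ⟨?_, ?_⟩)).symm
    · intro s hs
      rcases Sym2.mem_iff.1 hs with rfl | rfl
      · exact hf
      · exact t.2
    · rintro g rfl
      exact Sym2.mem_mk_left _ _
    · intro t t' htt
      exact Subtype.ext (Sym2.congr_right.1 (congrArg Subtype.val htt))
    · rintro ⟨u, hu, hfu⟩
      obtain ⟨t, rfl⟩ := hfu f rfl
      exact ⟨⟨t, hu t (Sym2.mem_mk_right _ _)⟩, rfl⟩
  · rw [if_neg h1, zero_add]
    split_ifs with h2
    · obtain ⟨f, g, hfg, rfl⟩ := Set.ncard_eq_two.1 h2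
      rw [Nat.card_eq_one_iff_unique]
      refine ⟨⟨?_⟩, ⟨s(f, g), ?_, ?_⟩⟩
      · rintro ⟨u, -, hu⟩ ⟨v, -, hv⟩
        apply Subtype.ext
        change u = v
        rw [(Sym2.mem_and_mem_iff hfg).1 ⟨hu f (by simp), hu g (by simp)⟩,
          (Sym2.mem_and_mem_iff hfg).1 ⟨hv f (by simp), hv g (by simp)⟩]
      · intro s hs
        rcases Sym2.mem_iff.1 hs with rfl | rfl
        exacts [hDB (by simp), hDB (by simp)]
      · rintro s (rfl | rfl)
        exacts [Sym2.mem_mk_left _ _, Sym2.mem_mk_right _ _]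
    · have h0 := (Set.ncard_pos).2 hD
      rw [Nat.card_eq_zero]
      left
      refine ⟨fun ⟨u, _, hu⟩ => ?_⟩
      obtain ⟨a, b, c, ha, hb, hc, hab, hac, hbc⟩ :=
        (Set.two_lt_ncard_iff (Set.toFinite D)).1 (by omega)
      have h3 := (Sym2.mem_and_mem_iff hab).1 ⟨hu a ha, hu b hb⟩
      have h4 := hu c hc
      rw [h3, Sym2.mem_iff] at h4
      rcases h4 with rfl | rfl
      exacts [hac rfl, hbc rfl]

/-- The properties of the partially ordered set of halfspaces of a tree with the complementation
`c`. -/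
structure IsHalfspaceSystem {σ : Type} [PartialOrder σ] (c : σ → σ) : Prop where
  compl_compl : ∀ x, c (c x) = x
  compl_le_compl : ∀ {x y}, x ≤ y → c y ≤ c x
  not_le_compl : ∀ x, ¬ x ≤ c x
  nested : ∀ x y, x ≤ y ∨ x ≤ c y ∨ c x ≤ y ∨ c x ≤ c y

namespace IsHalfspaceSystem

variable {σ : Type} [PartialOrder σ] {c : σ → σ} (h : IsHalfspaceSystem c)

include h

lemma compl_le_comm {x y : σ} : c x ≤ y ↔ c y ≤ x := by
  constructor
  · intro hxy
    have := h.compl_le_compl hxy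
    rwa [h.compl_compl] at this
  · intro hxy
    have := h.compl_le_compl hxy
    rwa [h.compl_compl] at this

lemma le_compl_comm {x y : σ} : x ≤ c y ↔ y ≤ c x := by
  rw [← h.compl_compl x, h.compl_le_comm, h.compl_compl, h.compl_compl]

lemma compl_le_compl_iff {x y : σ} : c x ≤ c y ↔ y ≤ x := by
  rw [h.compl_le_comm, h.compl_compl]

lemma not_compl_le (x : σ) : ¬ c x ≤ x := by
  have := h.not_le_compl (c x)
  rwa [h.compl_compl] at this

lemma compl_injective : Function.Injective c := fun x y hxy => by
  rw [← h.compl_compl x, hxy, h.compl_compl]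

lemma ne_compl (x : σ) : x ≠ c x := fun hx => h.not_le_compl x hx.le

/-- Two halfspaces face each other if they cover everything. -/
def facingGraph : SimpleGraph σ where
  Adj x y := c x ≤ y
  symm := ⟨fun _ _ hxy => h.compl_le_comm.1 hxy⟩
  loopless := ⟨fun x hx => h.not_compl_le x hx⟩

lemma facingGraph_adj {x y : σ} : h.facingGraph.Adj x y ↔ c x ≤ y := Iff.rfl

lemma isMove_iff {x : σ × σ} : IsMove h.facingGraph x ↔ ¬ x.1 ≤ x.2 := by
  obtain ⟨q, p⟩ := x
  constructor
  · rintro ⟨-, r, hqr, hpr⟩ hle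
    exact hpr (h.compl_le_comm.1 ((h.compl_le_comm.1 hqr).trans hle))
  · intro hle
    refine ⟨fun heq => hle heq.le, c q, le_rfl, fun hadj => hle (h.compl_le_compl_iff.1 hadj)⟩

open Classical in
lemma hub_spec (q p : σ) (hqp : IsMove h.facingGraph (q, p)) :
    h.facingGraph.Adj q (if c q ≤ p then p else c q) ∧
      ¬ h.facingGraph.Adj p (if c q ≤ p then p else c q) ∧
      ∀ r, h.facingGraph.Adj q r → ¬ h.facingGraph.Adj p r →
        ¬ h.facingGraph.Adj (if c q ≤ p then p else c q) r := by
  have hle : ¬ q ≤ p := h.isMove_iff.1 hqp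
  split_ifs with hq
  · exact ⟨hq, SimpleGraph.irrefl _, fun r _ hr => hr⟩
  · refine ⟨le_rfl, fun hadj => hle (h.compl_le_compl_iff.1 hadj), fun r hr _ hadj => ?_⟩
    rw [facingGraph_adj, h.compl_compl] at hadj
    exact h.not_compl_le r ((h.compl_le_comm.1 hr).trans hadj)

lemma card_not_le [Finite σ] :
    4 * Nat.card {x : σ × σ // ¬ x.1 ≤ x.2} + 2 * Nat.card σ = 3 * Nat.card σ ^ 2 := by
  classical
  have := Fintype.ofFinite σ
  let C : σ ≃ σ := ⟨c, c, h.compl_compl, h.compl_compl⟩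
  set S := ∑ x : σ, ∑ y : σ, if x ≤ y then 1 else 0 with hS
  have hsum : ∑ x : σ, ∑ y : σ, ((if x ≤ y then 1 else 0) + (if x ≤ c y then 1 else 0) +
      (if c x ≤ y then 1 else 0) + (if c x ≤ c y then 1 else 0)) = 4 * S := by
    have h1 : ∑ x : σ, ∑ y : σ, (if x ≤ c y then 1 else 0) = S :=
      Finset.sum_congr rfl fun x _ => C.sum_comp fun y => if x ≤ y then 1 else 0
    have h2 : ∑ x : σ, ∑ y : σ, (if c x ≤ y then 1 else 0) = S :=
      C.sum_comp fun x => ∑ y : σ, if x ≤ y then 1 else 0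
    have h3 : ∑ x : σ, ∑ y : σ, (if c x ≤ c y then 1 else 0) = S :=
      (C.sum_comp fun x => ∑ y : σ, if x ≤ c y then 1 else 0).trans h1
    simp only [Finset.sum_add_distrib, h1, h2, h3]
    rw [← hS]
    ring
  have hpt : ∀ x y : σ, ((if x ≤ y then 1 else 0) + (if x ≤ c y then 1 else 0) +
      (if c x ≤ y then 1 else 0) + (if c x ≤ c y then 1 else 0)) =
      1 + (if x = y then 1 else 0) + (if x = c y then 1 else 0) := by
    intro x y
    have e1 : x ≤ y → ¬ x ≤ c y := fun a b => h.not_le_compl x (a.trans (h.le_compl_comm.1 b))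
    have e2 : x ≤ y → ¬ c x ≤ y := fun a b => h.not_compl_le y ((h.compl_le_comm.1 b).trans a)
    have e3 : x ≤ c y → ¬ c x ≤ c y := fun a b =>
      h.not_le_compl y ((h.compl_le_compl_iff.1 b).trans a)
    have e4 : c x ≤ y → ¬ c x ≤ c y := fun a b =>
      h.not_compl_le x (a.trans (h.compl_le_compl_iff.1 b))
    have e5 : x = y ↔ x ≤ y ∧ c x ≤ c y := by
      rw [h.compl_le_compl_iff]; exact le_antisymm_iff
    have e6 : x = c y ↔ x ≤ c y ∧ c x ≤ y := by
      rw [h.compl_le_comm]; exact le_antisymm_iff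
    have := h.nested x y
    rw [if_congr e5 rfl rfl, if_congr e6 rfl rfl]
    by_cases a1 : x ≤ y <;> by_cases a2 : x ≤ c y <;> by_cases a3 : c x ≤ y <;>
      by_cases a4 : c x ≤ c y <;> simp_all
  have htot : 4 * S = Nat.card σ ^ 2 + 2 * Nat.card σ := by
    rw [← hsum]
    simp only [hpt, Finset.sum_add_distrib, Finset.sum_const, Finset.card_univ, Finset.sum_ite_eq,
      Finset.mem_univ, if_true, smul_eq_mul, mul_one]
    have h1 : ∑ x : σ, ∑ y : σ, (if x = c y then 1 else 0) = Fintype.card σ := by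
      rw [Finset.sum_comm]
      simp
    rw [h1, Nat.card_eq_fintype_card]
    ring
  have hcard : S = Nat.card {x : σ × σ // x.1 ≤ x.2} := by
    rw [Nat.card_eq_fintype_card, Fintype.card_subtype, Finset.card_filter,
      ← Finset.univ_product_univ, Finset.sum_product]
  have hcompl : Nat.card {x : σ × σ // x.1 ≤ x.2} + Nat.card {x : σ × σ // ¬ x.1 ≤ x.2} =
      Nat.card σ ^ 2 := by
    rw [← Nat.card_sum, Nat.card_congr (Equiv.sumCompl fun x : σ × σ => x.1 ≤ x.2), Nat.card_prod,
      sq]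
  omega

omit h in
/-- The halfspaces strictly contained in `q` or in its complement. -/
def Below (c : σ → σ) (q x : σ) : Prop := (x ≤ q ∨ x ≤ c q) ∧ x ≠ q ∧ x ≠ c q

lemma isReplacement_iff [Finite σ] {q r : σ} (hqr : h.facingGraph.Adj q r) {u : Sym2 σ} :
    IsReplacement h.facingGraph s(q, r) u ↔
      r = c q ∧ (∀ s ∈ u, Below c q s) ∧ ∀ f, Maximal (Below c q) f → f ∈ u := by
  constructor
  · rintro ⟨hd, hstd, hcov⟩
    have hcov' : ∀ v, h.facingGraph.Adj r v → v ≠ q → ∃ s ∈ u, h.facingGraph.Adj s v :=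
      fun v => hcov r q v Sym2.eq_swap
    replace hcov : ∀ v, h.facingGraph.Adj q v → v ≠ r → ∃ s ∈ u, h.facingGraph.Adj s v :=
      fun v => hcov q r v rfl
    replace hstd : ∀ a ∈ u, ∀ b ∈ u, ¬ h.facingGraph.Adj a b := fun a ha b hb hab =>
      hstd a b hab (pairExp_apply_ne_zero.2 ha) (pairExp_apply_ne_zero.2 hb)
    have hne : ∀ v ∈ u, v ≠ q ∧ v ≠ r := fun v hv => by
      have := hd v hv
      rwa [Sym2.mem_iff, not_or] at this
    have hq : ∀ v ∈ u, ¬ h.facingGraph.Adj q v := fun v hv hqv => by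
      obtain ⟨s, hs, hsv⟩ := hcov v hqv (hne v hv).2
      exact hstd s hs v hv hsv
    have hr : ∀ v ∈ u, ¬ h.facingGraph.Adj r v := fun v hv hqv => by
      obtain ⟨s, hs, hsv⟩ := hcov' v hqv (hne v hv).1
      exact hstd s hs v hv hsv
    have hrq : r = c q := by
      by_contra hrq
      obtain ⟨s, hs, hsr⟩ := hcov' (c r) le_rfl
        (fun heq => hrq (by rw [← heq, h.compl_compl]))
      exact hq s hs (le_trans hqr (h.compl_le_compl_iff.1 hsr))
    subst hrq
    have hbelow : ∀ s ∈ u, Below c q s := by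
      intro s hs
      refine ⟨?_, hne s hs⟩
      have h1 : ¬ c q ≤ s := hq s hs
      have h2 : ¬ q ≤ s := by
        have := hr s hs
        rwa [facingGraph_adj, h.compl_compl] at this
      rcases h.nested q s with h3 | h3 | h3 | h3
      · exact absurd h3 h2
      · exact Or.inr (h.le_compl_comm.1 h3)
      · exact absurd h3 h1
      · exact Or.inl (h.compl_le_compl_iff.1 h3)
    refine ⟨rfl, hbelow, fun f hf => ?_⟩
    have hex : ∃ s ∈ u, h.facingGraph.Adj s (c f) := by
      rcases hf.prop.1 with hfq | hfq
      · exact hcov (c f) (h.compl_le_compl hfq) fun heq => hf.prop.2.1 (h.compl_injective heq)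
      · exact hcov' (c f) (h.compl_le_compl hfq) fun heq => hf.prop.2.2
          (by rw [← heq, h.compl_compl])
    obtain ⟨s, hs, hsf⟩ := hex
    have hfs : f ≤ s := h.compl_le_compl_iff.1 hsf
    rwa [hf.eq_of_le (hbelow s hs) hfs]
  · rintro ⟨rfl, hbelow, hmax⟩
    refine ⟨fun x hx => ?_, fun a b hab ha hb => ?_, fun q' r' v he hv hvr => ?_⟩
    · rw [Sym2.mem_iff, not_or]
      exact (hbelow x hx).2
    · obtain ⟨h1, h2, h3⟩ := hbelow a (pairExp_apply_ne_zero.1 ha)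
      have h4 := (hbelow b (pairExp_apply_ne_zero.1 hb)).1
      have hab' : c a ≤ b := hab
      rcases h1 with h1 | h1 <;> rcases h4 with h4 | h4
      · exact h.not_compl_le q ((h.compl_le_compl h1).trans (hab'.trans h4))
      · exact h2 (le_antisymm h1 (h.compl_le_compl_iff.1 (hab'.trans h4)))
      · exact h3 (le_antisymm h1 (h.compl_le_comm.1 (hab'.trans h4)))
      · exact h.not_le_compl q ((h.le_compl_comm.1 h1).trans (hab'.trans h4))
    · have hr' : r' = c q' := by
        rcases Sym2.eq_iff.1 he with ⟨rfl, rfl⟩ | ⟨rfl, rfl⟩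
        · rfl
        · rw [h.compl_compl]
      subst hr'
      have hb : Below c q' (c v) := by
        refine ⟨Or.inl (h.compl_le_comm.1 hv), fun heq => hvr (by rw [← heq, h.compl_compl]),
          fun heq => ?_⟩
        rw [h.compl_injective heq] at hv
        exact h.not_compl_le q' hv
      have hb' : Below c q (c v) := by
        rcases Sym2.eq_iff.1 he with ⟨rfl, -⟩ | ⟨-, rfl⟩
        · exact hb
        · simp only [Below, h.compl_compl] at hb
          exact ⟨hb.1.symm, hb.2.2, hb.2.1⟩
      obtain ⟨f, hf1, hf2⟩ := (Set.toFinite {x | Below c q x}).exists_le_maximal hb'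
      exact ⟨f, hmax f hf2, h.compl_le_comm.1 hf1⟩

lemma ncard_below [Finite σ] {ι : Type} [Finite ι] {π : σ → ι} {rep : ι → σ}
    (hrep : ∀ a, π (rep a) = a) (hπ : ∀ x y, π x = π y ↔ x = y ∨ x = c y) (q : σ) :
    {x | Below c q x}.ncard = Nat.card ι - 1 := by
  have hπc : ∀ x, π (c x) = π x := fun x => (hπ _ _).2 (Or.inr rfl)
  have hinj : Set.InjOn π {x | Below c q x} := by
    intro x hx y hy hxy
    rcases (hπ x y).1 hxy with rfl | rfl
    · rfl
    obtain ⟨hx1, hx2, hx3⟩ := hx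
    obtain ⟨hy1, hy2, hy3⟩ := hy
    exfalso
    rcases hx1 with hx1 | hx1 <;> rcases hy1 with hy1 | hy1
    · exact h.not_compl_le q ((h.compl_le_comm.1 hx1).trans hy1)
    · exact hy3 (le_antisymm hy1 (h.compl_le_comm.1 hx1))
    · exact hy2 (le_antisymm hy1 (h.compl_le_compl_iff.1 hx1))
    · exact h.not_le_compl q ((h.compl_le_compl_iff.1 hx1).trans hy1)
  have himg : π '' {x | Below c q x} = {π q}ᶜ := by
    ext a
    simp only [Set.mem_image, Set.mem_ofPred_eq, Set.mem_compl_iff, Set.mem_singleton_iff]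
    constructor
    · rintro ⟨x, ⟨-, hx2, hx3⟩, rfl⟩ hxq
      exact ((hπ x q).1 hxq).elim hx2 hx3
    · intro ha
      have h1 : ∀ x, π x = a → x ≠ q ∧ x ≠ c q := fun x hx =>
        ⟨fun heq => ha (by rw [← hx, heq]), fun heq => ha (by rw [← hx, heq, hπc])⟩
      have hr := hrep a
      have hcr : π (c (rep a)) = a := (hπc _).trans hr
      rcases h.nested (rep a) q with h2 | h2 | h2 | h2
      exacts [⟨_, ⟨Or.inl h2, h1 _ hr⟩, hr⟩, ⟨_, ⟨Or.inr h2, h1 _ hr⟩, hr⟩,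
        ⟨_, ⟨Or.inl h2, h1 _ hcr⟩, hcr⟩, ⟨_, ⟨Or.inr h2, h1 _ hcr⟩, hcr⟩]
  rw [← hinj.ncard_image, himg, Set.ncard_compl, Set.ncard_singleton]

lemma card_eq [Finite σ] {ι : Type} [Finite ι] {π : σ → ι} {rep : ι → σ}
    (hrep : ∀ a, π (rep a) = a) (hπ : ∀ x y, π x = π y ↔ x = y ∨ x = c y) :
    Nat.card σ = 2 * Nat.card ι := by
  have hπc : ∀ x, π (c x) = π x := fun x => (hπ _ _).2 (Or.inr rfl)
  have hbij : Function.Bijective (Sum.elim rep (c ∘ rep)) := by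
    constructor
    · have hne : ∀ a b, rep a ≠ c (rep b) := fun a b hab => by
        have : a = b := by rw [← hrep a, hab, hπc, hrep]
        exact h.ne_compl _ (this ▸ hab)
      have hinj : Function.Injective rep := Function.LeftInverse.injective hrep
      exact hinj.sumElim (h.compl_injective.comp hinj) hne
    · intro x
      rcases (hπ x (rep (π x))).1 (hrep _).symm with hx | hx
      · exact ⟨Sum.inl (π x), hx.symm⟩
      · exact ⟨Sum.inr (π x), hx.symm⟩
  rw [← Nat.card_congr (Equiv.ofBijective _ hbij), Nat.card_sum, two_mul]

lemma card_replacement [Finite σ] {ι : Type} [Finite ι] {π : σ → ι} {rep : ι → σ}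
    (hrep : ∀ a, π (rep a) = a) (hπ : ∀ x y, π x = π y ↔ x = y ∨ x = c y)
    (hι : 2 ≤ Nat.card ι) :
    Nat.card {x : Sym2 σ × Sym2 σ // x.1 ∈ h.facingGraph.edgeSet ∧
        IsReplacement h.facingGraph x.1 x.2} =
      (Nat.card ι - 1) * {a | {f | Maximal (Below c (rep a)) f}.ncard = 1}.ncard +
        {a | {f | Maximal (Below c (rep a)) f}.ncard = 2}.ncard := by
  classical
  have := Fintype.ofFinite ι
  have hπc : ∀ x, π (c x) = π x := fun x => (hπ _ _).2 (Or.inr rfl)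
  have hadj : ∀ q, h.facingGraph.Adj q (c q) := fun q => le_refl (c q)
  have hcard : ∀ a, Nat.card {u : Sym2 σ // (∀ s ∈ u, Below c (rep a) s) ∧
      ∀ f, Maximal (Below c (rep a)) f → f ∈ u} =
      (if {f | Maximal (Below c (rep a)) f}.ncard = 1 then Nat.card ι - 1 else 0) +
        if {f | Maximal (Below c (rep a)) f}.ncard = 2 then 1 else 0 := by
    intro a
    have hB := h.ncard_below hrep hπ (rep a)
    rw [← hB]
    refine card_sym2_between (B := {x | Below c (rep a) x})
      (D := {f | Maximal (Below c (rep a)) f}) (fun f hf => Maximal.prop hf) ?_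
    obtain ⟨x, hx⟩ := (Set.ncard_pos (Set.toFinite _)).1
      (show 0 < {x | Below c (rep a) x}.ncard by omega)
    obtain ⟨f, -, hf⟩ := (Set.toFinite {x | Below c (rep a) x}).exists_le_maximal hx
    exact ⟨f, hf⟩
  have hequiv : Nat.card (Σ a, {u : Sym2 σ // (∀ s ∈ u, Below c (rep a) s) ∧
      ∀ f, Maximal (Below c (rep a)) f → f ∈ u}) =
      Nat.card {x : Sym2 σ × Sym2 σ // x.1 ∈ h.facingGraph.edgeSet ∧
        IsReplacement h.facingGraph x.1 x.2} := by
    refine Nat.card_congr (Equiv.ofBijective (fun x => ⟨(s(rep x.1, c (rep x.1)), x.2.1),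
      hadj _, (h.isReplacement_iff (hadj _)).2 ⟨rfl, x.2.2⟩⟩) ⟨?_, ?_⟩)
    · rintro ⟨a, u, hu⟩ ⟨b, v, hv⟩ hab
      simp only [Subtype.mk.injEq, Prod.mk.injEq] at hab
      obtain ⟨hab, rfl⟩ := hab
      have : a = b := by
        have hm : rep a ∈ s(rep b, c (rep b)) := hab ▸ Sym2.mem_mk_left _ _
        rw [← hrep a, ← hrep b, hπ]
        exact Sym2.mem_iff.1 hm
      subst this
      rfl
    · rintro ⟨⟨e, u⟩, he, hu⟩
      have hex : ∃ a, e = s(rep a, c (rep a)) := by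
        induction e with | _ q r
        obtain rfl : r = c q := ((h.isReplacement_iff he).1 hu).1
        refine ⟨π q, ?_⟩
        rcases (hπ q (rep (π q))).1 (hrep _).symm with hq | hq
        · rw [← hq]
        · have hc : c q = rep (π q) := (congrArg c hq).trans (h.compl_compl _)
          rw [hc, ← hq, Sym2.eq_swap]
      obtain ⟨a, rfl⟩ := hex
      exact ⟨⟨a, u, ((h.isReplacement_iff (hadj _)).1 hu).2⟩, rfl⟩
  rw [← hequiv, Nat.card_sigma, Finset.sum_congr rfl fun a _ => hcard a, Finset.sum_add_distrib]
  congr 1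
  · rw [← Finset.sum_filter, Finset.sum_const, smul_eq_mul, mul_comm, Set.ncard_eq_toFinset_card']
    simp
  · rw [← Finset.sum_filter, Finset.sum_const, smul_eq_mul, mul_one, Set.ncard_eq_toFinset_card']
    simp

end IsHalfspaceSystem
end Halfspaces

section TreeHalfspaces

/-- The vertices that are closer to `i'` than to `i`, by exactly one step. -/
def closerSide {V : Type} (T : SimpleGraph V) (i i' : V) : Set V :=
  {v | T.dist i' v + 1 = T.dist i v}

section

variable {V : Type} {T : SimpleGraph V}

lemma mem_closerSide {i i' v : V} : v ∈ closerSide T i i' ↔ T.dist i' v + 1 = T.dist i v := Iff.rfl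

lemma head_mem_closerSide {i i' : V} (hadj : T.Adj i i') : i' ∈ closerSide T i i' := by
  rw [mem_closerSide, SimpleGraph.dist_self, SimpleGraph.dist_eq_one_iff_adj.2 hadj]

lemma mem_closerSide_swap (hT : T.IsTree) {i i' v : V} (hadj : T.Adj i i') :
    v ∈ closerSide T i' i ↔ v ∉ closerSide T i i' := by
  rw [mem_closerSide, mem_closerSide]
  have := hT.dist_eq_dist_add_one_of_adj v hadj
  rw [T.dist_comm (u := v), T.dist_comm (u := v)] at this
  omega

lemma exists_adj_mem_closerSide (hT : T.IsTree) {v t : V} (hne : v ≠ t) :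
    ∃ w, T.Adj v w ∧ t ∈ closerSide T v w := by
  obtain ⟨P, hP⟩ := hT.connected.exists_walk_length_eq_dist v t
  cases P with
  | nil => exact absurd rfl hne
  | cons hadj Q =>
    refine ⟨_, hadj, ?_⟩
    rw [mem_closerSide]
    rw [SimpleGraph.Walk.length_cons] at hP
    have h1 := SimpleGraph.dist_le Q
    have h2 := hT.dist_eq_dist_add_one_of_adj t hadj
    rw [T.dist_comm (u := t), T.dist_comm (u := t)] at h2
    omega

lemma eq_of_mem_closerSide (hT : T.IsTree) {v w w' t : V} (hw : T.Adj v w) (hw' : T.Adj v w')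
    (ht : t ∈ closerSide T v w) (ht' : t ∈ closerSide T v w') : w = w' := by
  obtain ⟨P, hP⟩ := hT.connected.exists_walk_length_eq_dist w t
  obtain ⟨Q, hQ⟩ := hT.connected.exists_walk_length_eq_dist w' t
  rw [mem_closerSide] at ht ht'
  have h1 : (SimpleGraph.Walk.cons hw P).IsPath :=
    SimpleGraph.Walk.isPath_of_length_eq_dist _ (by rw [SimpleGraph.Walk.length_cons]; omega)
  have h2 : (SimpleGraph.Walk.cons hw' Q).IsPath :=
    SimpleGraph.Walk.isPath_of_length_eq_dist _ (by rw [SimpleGraph.Walk.length_cons]; omega)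
  have h3 : SimpleGraph.Walk.cons hw P = SimpleGraph.Walk.cons hw' Q :=
    congrArg Subtype.val ((hT.isAcyclic.subsingleton_path v t).elim ⟨_, h1⟩ ⟨_, h2⟩)
  simpa using congrArg SimpleGraph.Walk.snd h3

lemma eq_of_adj_of_mem_closerSide (hT : T.IsTree) {i i' v w : V} (hadj : T.Adj i i')
    (hvw : T.Adj v w) (hv : v ∈ closerSide T i i') (hw : w ∉ closerSide T i i') :
    v = i' ∧ w = i := by
  rw [← mem_closerSide_swap hT hadj] at hw
  have hv' := mem_closerSide.1 hv
  have hw' := mem_closerSide.1 hw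
  have h1 := hT.dist_eq_dist_add_one_of_adj i hvw
  have h2 := hT.dist_eq_dist_add_one_of_adj i' hvw
  have hwi : w = i := by
    by_contra hne
    obtain ⟨x, hx, hxw⟩ := exists_adj_mem_closerSide hT (Ne.symm hne)
    have hxw' := mem_closerSide.1 hxw
    have hxv : v ∈ closerSide T i x := by
      have h3 := hT.connected.dist_triangle (u := x) (v := w) (w := v)
      have h4 := hT.dist_eq_dist_add_one_of_adj v hx
      rw [T.dist_comm (u := v), T.dist_comm (u := v)] at h4
      rw [SimpleGraph.dist_eq_one_iff_adj.2 hvw.symm] at h3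
      rw [mem_closerSide]
      omega
    obtain rfl := eq_of_mem_closerSide hT hx hadj hxv hv
    omega
  subst hwi
  refine ⟨?_, rfl⟩
  rw [SimpleGraph.dist_self] at *
  have : T.dist i' v = 0 := by omega
  exact (hT.connected.dist_eq_zero_iff.1 this).symm

lemma closerSide_subset_iff (hT : T.IsTree) {i i' j j' : V} (hi : T.Adj i i') (hj : T.Adj j j') :
    closerSide T i i' ⊆ closerSide T j j' ↔ i' ∈ closerSide T j j' ∧ j ∉ closerSide T i i' := by
  constructor
  · intro hsub
    exact ⟨hsub (head_mem_closerSide hi), fun hmem =>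
      (mem_closerSide_swap hT hj).1 (head_mem_closerSide hj.symm) (hsub hmem)⟩
  · rintro ⟨h1, h2⟩ v hv
    induction hd : T.dist v i' generalizing v with
    | zero =>
      rw [hT.connected.dist_eq_zero_iff] at hd
      rwa [hd]
    | succ d ih =>
      have hne : v ≠ i' := by
        rintro rfl
        simp at hd
      obtain ⟨w, hw, hwd⟩ := exists_adj_mem_closerSide hT hne
      rw [mem_closerSide] at hwd
      have hwi : w ∈ closerSide T i i' := by
        by_contra hwi
        exact hne (eq_of_adj_of_mem_closerSide hT hi hw hv hwi).1
      by_contra hvj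
      obtain ⟨-, rfl⟩ := eq_of_adj_of_mem_closerSide hT hj hw.symm (ih hwi (by omega)) hvj
      exact h2 hv

end

namespace TreeVar

variable {n' : ℕ} {edges : Fin (n' - 1) → Sym2 (Fin n')}

instance : Finite (TreeVar n' edges) :=
  inferInstanceAs (Finite {p : Fin n' × Fin (n' - 1) // p.1 ∈ edges p.2})

/-- The vertex `i` of `x_{ia}`. -/
def tail (p : TreeVar n' edges) : Fin n' := p.1.1

/-- The label `a` of `x_{ia}`. -/
def label (p : TreeVar n' edges) : Fin (n' - 1) := p.1.2

/-- The end of `e_a` other than `i`, for the variable `x_{ia}`. -/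
def head (p : TreeVar n' edges) : Fin n' := Sym2.Mem.other p.2

/-- The variable attached to the same edge and its other end. -/
def reverse (p : TreeVar n' edges) : TreeVar n' edges :=
  ⟨(p.head, p.label), Sym2.other_mem p.2⟩

lemma edges_label (p : TreeVar n' edges) : edges p.label = s(p.tail, p.head) :=
  (Sym2.other_spec p.2).symm

lemma ext {p q : TreeVar n' edges} (h1 : p.tail = q.tail) (h2 : p.label = q.label) :
    p = q :=
  Subtype.ext (Prod.ext h1 h2)

@[simp] lemma label_reverse (p : TreeVar n' edges) : p.reverse.label = p.label := rfl

@[simp] lemma tail_reverse (p : TreeVar n' edges) : p.reverse.tail = p.head := rfl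

@[simp] lemma head_reverse (p : TreeVar n' edges) : p.reverse.head = p.tail := by
  have h1 := p.reverse.edges_label
  rw [label_reverse, p.edges_label, tail_reverse, Sym2.eq_swap] at h1
  exact (Sym2.congr_right.1 h1).symm

lemma reverse_reverse (p : TreeVar n' edges) : p.reverse.reverse = p :=
  TreeVar.ext (by simp) rfl

lemma label_eq_iff {p q : TreeVar n' edges} : p.label = q.label ↔ p = q ∨ p = q.reverse := by
  constructor
  · intro h
    have hp := p.2
    change p.tail ∈ edges p.label at hp
    rw [h, q.edges_label, Sym2.mem_iff] at hp
    exact hp.imp (fun h' => TreeVar.ext h' h) fun h' => TreeVar.ext h' h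
  · rintro (rfl | rfl) <;> rfl

lemma eq_of_tail_eq_of_head_eq (hinj : Function.Injective edges) {p q : TreeVar n' edges}
    (h1 : p.tail = q.tail) (h2 : p.head = q.head) : p = q :=
  TreeVar.ext h1 (hinj (by rw [p.edges_label, q.edges_label, h1, h2]))

variable {T : SimpleGraph (Fin n')}

lemma adj (hrange : Set.range edges = T.edgeSet) (p : TreeVar n' edges) : T.Adj p.tail p.head := by
  rw [← SimpleGraph.mem_edgeSet, ← p.edges_label, ← hrange]
  exact Set.mem_range_self _

lemma exists_of_adj (hrange : Set.range edges = T.edgeSet) {v w : Fin n'} (hvw : T.Adj v w) :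
    ∃ p : TreeVar n' edges, p.tail = v ∧ p.head = w := by
  rw [← SimpleGraph.mem_edgeSet, ← hrange] at hvw
  obtain ⟨a, ha⟩ := hvw
  refine ⟨⟨(v, a), ha ▸ Sym2.mem_mk_left _ _⟩, rfl, ?_⟩
  have h1 := edges_label (⟨(v, a), ha ▸ Sym2.mem_mk_left _ _⟩ : TreeVar n' edges)
  exact (Sym2.congr_right.1 (ha.symm.trans h1)).symm

variable (T) in
/-- The component of the head of `p` after removing its edge from the tree. -/
def side (p : TreeVar n' edges) : Set (Fin n') := closerSide T p.tail p.head

section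

variable (hT : T.IsTree) (hinj : Function.Injective edges) (hrange : Set.range edges = T.edgeSet)

include hrange in
lemma head_mem_side (p : TreeVar n' edges) : p.head ∈ side T p :=
  head_mem_closerSide (p.adj hrange)

include hT hrange

lemma mem_side_reverse {p : TreeVar n' edges} {v : Fin n'} :
    v ∈ side T p.reverse ↔ v ∉ side T p := by
  simp only [side, head_reverse, tail_reverse]
  exact mem_closerSide_swap hT (p.adj hrange)

lemma tail_not_mem_side (p : TreeVar n' edges) : p.tail ∉ side T p := by
  rw [← mem_side_reverse hT hrange, ← head_reverse]
  exact head_mem_side hrange _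

lemma side_subset_iff {p q : TreeVar n' edges} :
    side T p ⊆ side T q ↔ p.head ∈ side T q ∧ q.tail ∉ side T p :=
  closerSide_subset_iff hT (p.adj hrange) (q.adj hrange)

include hinj

lemma eq_of_mem_side {p q : TreeVar n' edges} (h1 : q.head ∈ side T p) (h2 : q.tail ∉ side T p) :
    q = p := by
  obtain ⟨h3, h4⟩ :=
    eq_of_adj_of_mem_closerSide hT (p.adj hrange) (q.adj hrange).symm h1 h2
  exact eq_of_tail_eq_of_head_eq hinj h4 h3

lemma side_injective : Function.Injective (side T : TreeVar n' edges → Set (Fin n')) := by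
  intro p q hpq
  refine eq_of_mem_side hT hinj hrange (p := q) (q := p) ?_ ?_
  · exact hpq ▸ head_mem_side hrange p
  · exact hpq ▸ tail_not_mem_side hT hrange p

lemma head_mem_side_iff {p q : TreeVar n' edges} (hpq : p.label ≠ q.label) :
    q.head ∈ side T p ↔ q.tail ∈ side T p := by
  constructor
  · intro h1
    by_contra h2
    exact hpq (congrArg label (eq_of_mem_side hT hinj hrange h1 h2)).symm
  · intro h1
    by_contra h2
    rw [← tail_reverse] at h2
    rw [← head_reverse] at h1
    exact hpq (congrArg label (eq_of_mem_side hT hinj hrange h1 h2)).symm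

/-- The variables of `S_T`, ordered by inclusion of the corresponding halfspaces. -/
abbrev partialOrder : PartialOrder (TreeVar n' edges) :=
  PartialOrder.lift (side T) (side_injective hT hinj hrange)

end

variable [PartialOrder (TreeVar n' edges)] (hT : T.IsTree) (hinj : Function.Injective edges)
  (hrange : Set.range edges = T.edgeSet)
  (hle : ∀ p q : TreeVar n' edges, p ≤ q ↔ side T p ⊆ side T q)

include hT hinj hrange hle

lemma isHalfspaceSystem : IsHalfspaceSystem (reverse : TreeVar n' edges → TreeVar n' edges) where
  compl_compl := reverse_reverse
  compl_le_compl {p q} hpq := by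
    rw [hle] at hpq ⊢
    intro v
    rw [mem_side_reverse hT hrange, mem_side_reverse hT hrange]
    exact mt fun h => hpq h
  not_le_compl p hp := by
    rw [hle] at hp
    exact (mem_side_reverse hT hrange).1 (hp (head_mem_side hrange p)) (head_mem_side hrange p)
  nested p q := by
    by_cases hpq : p.label = q.label
    · rcases label_eq_iff.1 hpq with rfl | rfl
      · exact Or.inl le_rfl
      · exact Or.inr (Or.inl le_rfl)
    · have h1 := head_mem_side_iff hT hinj hrange hpq
      have h2 := head_mem_side_iff hT hinj hrange (Ne.symm hpq)
      simp only [hle, side_subset_iff hT hrange, mem_side_reverse hT hrange, tail_reverse,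
        head_reverse]
      tauto

lemma facingGraph_adj_iff {p q : TreeVar n' edges} :
    (isHalfspaceSystem hT hinj hrange hle).facingGraph.Adj p q ↔
      q.tail ∈ side T p ∧ p.tail ∈ side T q := by
  rw [IsHalfspaceSystem.facingGraph_adj, hle, side_subset_iff hT hrange,
    mem_side_reverse hT hrange, head_reverse, not_not, and_comm]

lemma treeIdeal_eq_edgeIdeal (k : Type) [Field k] :
    TreeIdeal k n' T edges = edgeIdeal k (isHalfspaceSystem hT hinj hrange hle).facingGraph := by
  rw [TreeIdeal, edgeIdeal]
  congr 1
  ext f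
  simp only [Set.mem_ofPred_eq, Set.mem_image]
  constructor
  · rintro ⟨i, j, a, b, hia, hjb, -, ⟨i', hi', hi⟩, ⟨j', hj', hj⟩, rfl⟩
    refine ⟨_, ⟨s(⟨(i, a), hia⟩, ⟨(j, b), hjb⟩), ?_, rfl⟩, monomial_pairExp_mk _ _⟩
    refine (facingGraph_adj_iff hT hinj hrange hle).2 ?_
    have h1 := edges_label (⟨(i, a), hia⟩ : TreeVar n' edges)
    have h2 := edges_label (⟨(j, b), hjb⟩ : TreeVar n' edges)
    obtain rfl := Sym2.congr_right.1 (hi'.symm.trans h1)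
    obtain rfl := Sym2.congr_right.1 ((Sym2.eq_swap.trans hj'.symm).trans h2)
    refine ⟨hi, ?_⟩
    rw [T.dist_comm, T.dist_comm (u := i)] at hj
    exact hj
  · rintro ⟨_, ⟨e, he, rfl⟩, rfl⟩
    induction e with | _ p q
    rw [SimpleGraph.mem_edgeSet, facingGraph_adj_iff hT hinj hrange hle] at he
    obtain ⟨h1, h2⟩ := he
    have h1' := mem_closerSide.1 h1
    have h2' := mem_closerSide.1 h2
    refine ⟨p.tail, q.tail, p.label, q.label, p.2, q.2, ?_, ⟨p.head, p.edges_label, h1'⟩,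
      ⟨q.head, q.edges_label.trans Sym2.eq_swap, ?_⟩, monomial_pairExp_mk _ _⟩
    · intro heq
      exact tail_not_mem_side hT hrange p (heq ▸ h1)
    · rw [T.dist_comm, T.dist_comm (u := p.tail)]
      exact h2'

lemma le_of_tail_eq_head {f q : TreeVar n' edges} (hf : f.tail = q.head)
    (hfq : f.label ≠ q.label) : f ≤ q := by
  rw [hle, side_subset_iff hT hrange, head_mem_side_iff hT hinj hrange (Ne.symm hfq), hf,
    ← head_mem_side_iff hT hinj hrange hfq, ← hf]
  exact ⟨hf ▸ head_mem_side hrange q, tail_not_mem_side hT hrange f⟩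

lemma exists_le_of_le {s q : TreeVar n' edges} (hsq : s ≤ q) (hne : s.label ≠ q.label) :
    ∃ f : TreeVar n' edges, f.tail = q.head ∧ f.label ≠ q.label ∧ s ≤ f := by
  by_cases hs : s.tail = q.head
  · exact ⟨s, hs, hne, le_rfl⟩
  obtain ⟨w, hw, hsw⟩ := exists_adj_mem_closerSide hT (Ne.symm hs)
  obtain ⟨f, hf, rfl⟩ := exists_of_adj hrange hw
  rw [← hf] at hsw
  rw [hle, side_subset_iff hT hrange] at hsq
  obtain ⟨h1, h2⟩ := hsq
  have h3 : q.head ∉ side T s := by rwa [head_mem_side_iff hT hinj hrange hne]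
  have hfq : f.label ≠ q.label := by
    intro hfq
    rcases label_eq_iff.1 hfq with rfl | rfl
    · exact (f.adj hrange).ne hf
    · exact (mem_side_reverse hT hrange).1 hsw
        ((head_mem_side_iff hT hinj hrange (Ne.symm hne)).1 h1)
  refine ⟨f, hf, hfq, ?_⟩
  rw [hle, side_subset_iff hT hrange]
  refine ⟨?_, hf ▸ h3⟩
  by_contra h4
  have h5 := eq_of_mem_side hT hinj hrange (p := f) (q := s.reverse) (by rwa [head_reverse]) h4
  rw [← hf, ← h5, tail_reverse] at h3
  exact h3 (head_mem_side hrange s)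

omit hT hinj hrange hle in
lemma below_iff {q s : TreeVar n' edges} :
    IsHalfspaceSystem.Below reverse q s ↔ (s ≤ q ∨ s ≤ q.reverse) ∧ s.label ≠ q.label := by
  rw [IsHalfspaceSystem.Below, Ne.eq_def s.label, label_eq_iff, not_or]

lemma maximal_below_iff {q f : TreeVar n' edges} :
    Maximal (IsHalfspaceSystem.Below reverse q) f ↔
      f.label ≠ q.label ∧ f.tail ∈ edges q.label := by
  have hsys := isHalfspaceSystem hT hinj hrange hle
  have hex : ∀ s, IsHalfspaceSystem.Below reverse q s → ∃ g : TreeVar n' edges,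
      (g.label ≠ q.label ∧ g.tail ∈ edges q.label) ∧ s ≤ g := by
    intro s hs
    rw [below_iff] at hs
    rw [q.edges_label]
    rcases hs.1 with h1 | h1
    · obtain ⟨g, h2, h3, h4⟩ := exists_le_of_le hT hinj hrange hle h1 hs.2
      exact ⟨g, ⟨h3, by simp [h2]⟩, h4⟩
    · obtain ⟨g, h2, h3, h4⟩ := exists_le_of_le hT hinj hrange hle h1 hs.2
      exact ⟨g, ⟨h3, by simp [h2]⟩, h4⟩
  have hlt : ∀ g : TreeVar n' edges, g.label ≠ q.label → g.tail ∈ edges q.label →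
      g.tail = q.tail ∧ g ≤ q.reverse ∨ g.tail = q.head ∧ g ≤ q := by
    intro g h1 h2
    rw [q.edges_label, Sym2.mem_iff] at h2
    refine h2.imp (fun h3 => ⟨h3, ?_⟩) fun h3 => ⟨h3, ?_⟩
    · exact le_of_tail_eq_head hT hinj hrange hle (h3.trans q.head_reverse.symm) h1
    · exact le_of_tail_eq_head hT hinj hrange hle h3 h1
  have hbelow : ∀ g : TreeVar n' edges, g.label ≠ q.label → g.tail ∈ edges q.label →
      IsHalfspaceSystem.Below reverse q g := fun g h1 h2 =>
    below_iff.2 ⟨((hlt g h1 h2).imp And.right And.right).symm, h1⟩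
  have hanti : ∀ f g : TreeVar n' edges, f.label ≠ q.label → f.tail ∈ edges q.label →
      g.label ≠ q.label → g.tail ∈ edges q.label → f ≤ g → f = g := by
    intro f g h1 h2 h3 h4 hfg
    have heq : f.tail = g.tail → f = g := by
      intro htail
      have := ((hle _ _).1 hfg) (head_mem_side hrange f)
      exact eq_of_mem_side hT hinj hrange this (htail ▸ tail_not_mem_side hT hrange g)
    rcases hlt f h1 h2 with h5 | h5 <;> rcases hlt g h3 h4 with h6 | h6
    · exact heq (h5.1.trans h6.1.symm)
    · exact absurd ((hfg.trans h6.2).trans (hsys.le_compl_comm.1 h5.2)) (hsys.not_le_compl f)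
    · exact absurd (h5.2.trans (hsys.le_compl_comm.1 (hfg.trans h6.2))) (hsys.not_le_compl f)
    · exact heq (h5.1.trans h6.1.symm)
  constructor
  · intro hf
    obtain ⟨g, ⟨h1, h2⟩, hfg⟩ := hex f hf.prop
    rw [hf.eq_of_le (hbelow g h1 h2) hfg]
    exact ⟨h1, h2⟩
  · rintro ⟨h1, h2⟩
    refine ⟨hbelow f h1 h2, fun x hx hfx => ?_⟩
    obtain ⟨g, ⟨h3, h4⟩, hxg⟩ := hex x hx
    rwa [hanti f g h1 h2 h3 h4 (hfx.trans hxg)]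

lemma ncard_maximal_below (q : TreeVar n' edges) :
    {f | Maximal (IsHalfspaceSystem.Below reverse q) f}.ncard = lineDeg n' edges q.label := by
  simp only [maximal_below_iff hT hinj hrange hle]
  have hinjOn : Set.InjOn label
      {f : TreeVar n' edges | f.label ≠ q.label ∧ f.tail ∈ edges q.label} := by
    rintro f ⟨hf1, hf2⟩ g ⟨-, hg2⟩ hfg
    refine TreeVar.ext ?_ hfg
    by_contra hne
    have hg3 : g.tail ∈ edges f.label := by
      rw [hfg]
      exact g.2
    exact hf1 (hinj (((Sym2.mem_and_mem_iff hne).1 ⟨f.2, hg3⟩).trans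
      ((Sym2.mem_and_mem_iff hne).1 ⟨hf2, hg2⟩).symm))
  rw [← hinjOn.ncard_image, lineDeg]
  congr 1
  ext b
  constructor
  · rintro ⟨f, ⟨hf1, hf2⟩, rfl⟩
    exact ⟨hf1, f.tail, hf2, f.2⟩
  · rintro ⟨h1, v, h2, h3⟩
    exact ⟨⟨(v, b), h3⟩, ⟨h1, h2⟩, rfl⟩

end TreeVar

end TreeHalfspaces

theorem statement3 (k : Type) [Field k] (n' : ℕ) (hn : 3 ≤ n')
    (T : SimpleGraph (Fin n')) (hT : T.IsTree)
    (edges : Fin (n' - 1) → Sym2 (Fin n')) (hinj : Function.Injective edges)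
    (hrange : Set.range edges = T.edgeSet) :
    Module.finrank k (degZeroHom k (TreeVar n' edges) (TreeIdeal k n' T edges)) =
      (3 * n' - 4) * (n' - 1) + treeIndex n' edges := by
  classical
  let _ : PartialOrder (TreeVar n' edges) := TreeVar.partialOrder hT hinj hrange
  have hle : ∀ p q : TreeVar n' edges, p ≤ q ↔ TreeVar.side T p ⊆ TreeVar.side T q :=
    fun _ _ => Iff.rfl
  have hsys := TreeVar.isHalfspaceSystem hT hinj hrange hle
  let rep : Fin (n' - 1) → TreeVar n' edges := fun a => ⟨((edges a).out.1, a), Sym2.out_fst_mem _⟩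
  have hrep : ∀ a, (rep a).label = a := fun _ => rfl
  have hlabel : ∀ p q : TreeVar n' edges, p.label = q.label ↔ p = q ∨ p = q.reverse :=
    fun _ _ => TreeVar.label_eq_iff
  have hcard := hsys.card_not_le
  rw [hsys.card_eq hrep hlabel, Nat.card_fin] at hcard
  rw [TreeVar.treeIdeal_eq_edgeIdeal hT hinj hrange hle,
    finrank_degZeroHom_edgeIdeal _ fun q p => hsys.hub_spec q p,
    hsys.card_replacement hrep hlabel (by rw [Nat.card_fin]; omega), Nat.card_fin, treeIndex,
    Nat.sub_sub n' 1 1]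
  simp only [TreeVar.ncard_maximal_below hT hinj hrange hle, hrep, hsys.isMove_iff]
  congr 1
  obtain ⟨m, rfl⟩ : ∃ m, n' = m + 1 := ⟨n' - 1, by omega⟩
  obtain ⟨l, rfl⟩ : ∃ l, m = l + 1 := ⟨m - 1, by omega⟩
  rw [show 3 * (l + 1 + 1) - 4 = 3 * l + 2 by omega]
  simp only [Nat.add_sub_cancel] at hcard ⊢
  nlinarith

end
end

section
/- Let M_{nd} be the d × (n+d−1) matrix over S̃ whose entry in row j and column c equals x_{(c−j+1) j} if 1 ≤ c−j+1 ≤ n, and 0 otherwise (so row j contains x_{1j},…,x_{nj} in columns j through j+n−1 and zeros elsewhere), and let I be the ideal of S̃ generated by the d × d minors of M_{nd}. Order the variables by x_{ij} < x_{i'j'} if j < j', or if j = j' and i < i', and let < be the induced lexicographic monomial order. Then the initial ideal of I with respect to <, i.e., the ideal generated by the leading (largest) monomials of all nonzero elements of I, equals B_{nd}. -/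
/-!
Statement 4: The initial ideal of the ideal of maximal minors of the matrix `M_{nd}`,
with respect to the lexicographic order with `x_{ij} < x_{i'j'}` iff `j < j'`, or
`j = j'` and `i < i'`, is the box polarization `B_{nd}`.
-/

set_option synthInstance.maxHeartbeats 800000
set_option maxHeartbeats 1600000

open MvPolynomial

noncomputable section

/-- The rank of the variable `x_{ij}`: `x_{ij} < x_{i'j'}` iff `j < j'`, or `j = j'` and
`i < i'`, iff `varRank (i,j) < varRank (i',j')`. -/
def varRank (n d : ℕ) (p : Fin n × Fin d) : ℕ := (p.2 : ℕ) * n + (p.1 : ℕ)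

/-- The lexicographic order on monomials (exponent vectors) induced by the above variable
order: `u < v` iff at the largest variable where the exponents differ, `v` has the larger
exponent. -/
def lexLT (n d : ℕ) (u v : (Fin n × Fin d) →₀ ℕ) : Prop :=
  ∃ p, u p < v p ∧ ∀ q, varRank n d p < varRank n d q → u q = v q

/-- The `d × (n+d−1)` matrix whose `j`-th row contains `x_{1j}, …, x_{nj}` in columns
`j, …, j+n−1` (and zeros elsewhere). -/
def Mnd (k : Type) [Field k] (n d : ℕ) :
    Matrix (Fin d) (Fin (n + d - 1)) (MvPolynomial (Fin n × Fin d) k) :=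
  fun j c =>
    if h : (j : ℕ) ≤ (c : ℕ) ∧ (c : ℕ) - (j : ℕ) < n then X (⟨(c : ℕ) - (j : ℕ), h.2⟩, j) else 0

/-- The ideal generated by the `d × d` minors of `M_{nd}`. -/
def minorsIdeal (k : Type) [Field k] (n d : ℕ) : Ideal (MvPolynomial (Fin n × Fin d) k) :=
  Ideal.span {f | ∃ c : Fin d → Fin (n + d - 1), StrictMono c ∧
    f = ((Mnd k n d).submatrix id c).det}

/-- The initial ideal of `I` for the above lexicographic order: the ideal generated by the
leading (largest) monomials of the nonzero elements of `I`. -/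
def initialIdeal (k : Type) [Field k] (n d : ℕ) (I : Ideal (MvPolynomial (Fin n × Fin d) k)) :
    Ideal (MvPolynomial (Fin n × Fin d) k) :=
  Ideal.span {g | ∃ f ∈ I, f ≠ 0 ∧ ∃ u ∈ f.support,
    (∀ v ∈ f.support, v ≠ u → lexLT n d v u) ∧ g = monomial u (1 : k)}

/-- The monomial order on exponent vectors whose strict order is `lexLT`. -/
def boxOrder (n d : ℕ) : MonomialOrder (Fin n × Fin d) :=
  let o : LinearOrder (Fin n × Fin d) :=
    LinearOrder.lift' (fun p => OrderDual.toDual (toLex (p.2, p.1))) fun p q h => by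
      have h' : (p.2, p.1) = (q.2, q.1) := h
      simp only [Prod.mk.injEq] at h'
      exact Prod.ext h'.2 h'.1
  @MonomialOrder.lex _ o (@Finite.to_wellFoundedGT _ _ o.toPreorder)

theorem varRank_lt_iff {n d : ℕ} (p q : Fin n × Fin d) :
    varRank n d p < varRank n d q ↔ p.2 < q.2 ∨ p.2 = q.2 ∧ p.1 < q.1 := by
  obtain ⟨i, j⟩ := p
  obtain ⟨i', j'⟩ := q
  have hi := i.2
  have hi' := i'.2
  simp only [varRank]
  rcases lt_trichotomy j j' with h | h | h
  · have h2 : ((j : ℕ) + 1) * n ≤ j' * n := Nat.mul_le_mul_right _ h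
    simp only [h, true_or, iff_true]
    linarith
  · subst h
    simp
  · have h2 : ((j' : ℕ) + 1) * n ≤ j * n := Nat.mul_le_mul_right _ h
    simp only [h.not_gt, h.ne', false_or, false_and, iff_false]
    linarith

theorem lexLT_iff {n d : ℕ} (u v : (Fin n × Fin d) →₀ ℕ) :
    lexLT n d u v ↔ (boxOrder n d).toSyn u < (boxOrder n d).toSyn v := by
  have key : (boxOrder n d).toSyn u < (boxOrder n d).toSyn v ↔
      ∃ p : Fin n × Fin d, (∀ q : Fin n × Fin d, toLex (p.2, p.1) < toLex (q.2, q.1) → u q = v q) ∧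
        u p < v p := Iff.rfl
  rw [key]
  simp only [lexLT, varRank_lt_iff, Prod.Lex.toLex_lt_toLex]
  exact exists_congr fun p => and_comm

theorem lexLT_of_row {n d : ℕ} {u v : (Fin n × Fin d) →₀ ℕ} (i : Fin n) (j : Fin d)
    (hlt : u (i, j) < v (i, j)) (hrow : ∀ i', i < i' → u (i', j) = v (i', j))
    (habove : ∀ i' j', j < j' → u (i', j') = v (i', j')) : lexLT n d u v := by
  refine ⟨(i, j), hlt, ?_⟩
  rintro ⟨i', j'⟩ h
  rw [varRank_lt_iff] at h
  rcases h with h | ⟨h, h'⟩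
  · exact habove _ _ h
  · simp only at h h'
    subst h
    exact hrow _ h'

/-- The exponent vector of the entry of `M_{nd}` in row `j` and column `c`
(zero if that entry is zero). -/
def entryExp {n d : ℕ} (j : Fin d) (c : Fin (n + d - 1)) : (Fin n × Fin d) →₀ ℕ :=
  Finsupp.equivFunOnFinite.symm fun p => if p.2 = j ∧ (c : ℕ) = p.1 + p.2 then 1 else 0

/-- The exponent vector of the diagonal term of the minor of `M_{nd}` with columns `c`. -/
def diagExp {n d : ℕ} (c : Fin d → Fin (n + d - 1)) : (Fin n × Fin d) →₀ ℕ :=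
  ∑ j, entryExp j (c j)

theorem entryExp_apply {n d : ℕ} (j : Fin d) (c : Fin (n + d - 1)) (i : Fin n) (l : Fin d) :
    entryExp j c (i, l) = if l = j ∧ (c : ℕ) = i + l then 1 else 0 := rfl

theorem diagExp_apply {n d : ℕ} (c : Fin d → Fin (n + d - 1)) (i : Fin n) (l : Fin d) :
    diagExp c (i, l) = if (c l : ℕ) = i + l then 1 else 0 := by
  simp only [diagExp, Finsupp.finsetSum_apply, entryExp_apply, ite_and]
  simp

theorem Mnd_eq_zero_or {n d : ℕ} (k : Type) [Field k] (j : Fin d) (c : Fin (n + d - 1)) :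
    Mnd k n d j c = 0 ∨ Mnd k n d j c = monomial (entryExp j c) 1 := by
  unfold Mnd
  split_ifs with h
  · right
    rw [X]
    refine congrArg (fun e => monomial e (1 : k)) (Finsupp.ext fun ⟨i, l⟩ => ?_)
    rw [entryExp_apply, Finsupp.single_apply]
    congr 1
    simp only [Prod.mk.injEq, Fin.ext_iff, eq_iff_iff]
    omega
  · exact Or.inl rfl

theorem Mnd_of_range {n d : ℕ} (k : Type) [Field k] (j : Fin d) (c : Fin (n + d - 1)) (i : Fin n)
    (h : (c : ℕ) = i + j) : Mnd k n d j c = X (i, j) := by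
  have hi := i.2
  unfold Mnd
  rw [dif_pos ⟨by omega, by omega⟩]
  congr 2
  ext
  simp only
  omega

theorem Mnd_of_range_monomial {n d : ℕ} (k : Type) [Field k] (j : Fin d) (c : Fin (n + d - 1))
    (i : Fin n) (h : (c : ℕ) = i + j) : Mnd k n d j c = monomial (entryExp j c) 1 := by
  rcases Mnd_eq_zero_or k j c with h0 | h0
  · rw [Mnd_of_range k j c i h] at h0
    exact absurd h0 (X_ne_zero _)
  · exact h0

theorem add_le_of_strictMono {d N : ℕ} {c : Fin d → Fin N} (hc : StrictMono c) {a b : Fin d}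
    (hab : a ≤ b) : (c a : ℕ) + b ≤ c b + a := by
  obtain ⟨b, hb⟩ := b
  induction b with
  | zero =>
    have : a = ⟨0, hb⟩ := le_antisymm hab (Nat.zero_le _)
    subst this
    exact le_rfl
  | succ b ih =>
    rcases hab.eq_or_lt with rfl | h
    · exact le_rfl
    · have h1 := ih (by omega) (Nat.lt_succ_iff.mp h)
      have h2 : c ⟨b, by omega⟩ < c ⟨b + 1, hb⟩ := hc (Nat.lt_succ_self b)
      rw [Fin.lt_def] at h2
      simp only at h1 ⊢
      omega

theorem exists_row_index {n d : ℕ} {c : Fin d → Fin (n + d - 1)} (hc : StrictMono c) (j : Fin d) :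
    ∃ i : Fin n, (c j : ℕ) = i + j := by
  have hj := j.2
  have h1 := add_le_of_strictMono hc (a := ⟨0, by omega⟩) (b := j) (Nat.zero_le _)
  have h2 := add_le_of_strictMono hc (a := j) (b := ⟨d - 1, by omega⟩)
    (by rw [Fin.le_def]; simp only; omega)
  have h3 := (c ⟨d - 1, by omega⟩).2
  simp only at h1 h2
  exact ⟨⟨c j - j, by omega⟩, by simp only; omega⟩

theorem prod_Mnd_eq_zero_or {n d : ℕ} (k : Type) [Field k] (c : Fin d → Fin (n + d - 1)) :
    ∏ j, Mnd k n d j (c j) = 0 ∨ ∏ j, Mnd k n d j (c j) = monomial (diagExp c) 1 := by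
  by_cases h : ∃ j, Mnd k n d j (c j) = 0
  · obtain ⟨j, hj⟩ := h
    exact Or.inl (Finset.prod_eq_zero (Finset.mem_univ j) hj)
  · push Not at h
    right
    rw [diagExp, monomial_sum_one]
    exact Finset.prod_congr rfl fun j _ => (Mnd_eq_zero_or k j (c j)).resolve_left (h j)

theorem monomial_diagExp {n d : ℕ} (k : Type) [Field k] {c : Fin d → Fin (n + d - 1)}
    {i : Fin d → Fin n} (h : ∀ j, (c j : ℕ) = i j + j) :
    monomial (diagExp c) (1 : k) = ∏ j, X (i j, j) := by
  rw [diagExp, monomial_sum_one]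
  exact Finset.prod_congr rfl fun j _ => by
    rw [← Mnd_of_range_monomial k j (c j) (i j) (h j), Mnd_of_range k j (c j) (i j) (h j)]

theorem diagExp_perm_lt {n d : ℕ} {c : Fin d → Fin (n + d - 1)} (hc : StrictMono c)
    {σ : Equiv.Perm (Fin d)} (hσ : σ ≠ 1) : lexLT n d (diagExp (c ∘ σ)) (diagExp c) := by
  have hne : (Finset.univ.filter fun j => σ j ≠ j).Nonempty := by
    by_contra h
    rw [Finset.not_nonempty_iff_eq_empty, Finset.filter_eq_empty_iff] at h
    exact hσ (Equiv.ext fun j => by simpa using h (Finset.mem_univ j))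
  obtain ⟨j, hj, hmax⟩ := Finset.exists_max_image _ id hne
  simp only [Finset.mem_filter, Finset.mem_univ, true_and, id] at hj hmax
  have hfix : ∀ l, j < l → σ l = l := fun l hl => by
    by_contra h
    exact absurd (hmax l h) (not_le.mpr hl)
  have hlt : σ j < j := by
    rcases lt_trichotomy (σ j) j with h | h | h
    · exact h
    · exact absurd h hj
    · exact absurd (σ.injective (hfix _ h)) hj
  have hclt : (c (σ j) : ℕ) < c j := hc hlt
  obtain ⟨i, hi⟩ := exists_row_index hc j
  refine lexLT_of_row i j ?_ ?_ ?_
  · simp only [diagExp_apply, Function.comp]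
    rw [if_neg (by omega), if_pos hi]
    exact zero_lt_one
  · intro i' hi'
    rw [Fin.lt_def] at hi'
    simp only [diagExp_apply, Function.comp]
    rw [if_neg (by omega), if_neg (by omega)]
  · intro i' l hl
    simp only [diagExp_apply, Function.comp, hfix l hl]

/-- The maximal minor of `M_{nd}` with columns `c`. -/
def minor (k : Type) [Field k] {n d : ℕ} (c : Fin d → Fin (n + d - 1)) :
    MvPolynomial (Fin n × Fin d) k :=
  ((Mnd k n d).submatrix id c).det

theorem minor_eq_sum (k : Type) [Field k] {n d : ℕ} (c : Fin d → Fin (n + d - 1)) :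
    minor k c = ∑ σ : Equiv.Perm (Fin d),
      ((Equiv.Perm.sign σ : ℤ) : MvPolynomial (Fin n × Fin d) k) *
        ∏ j, Mnd k n d j ((c ∘ σ) j) := by
  rw [minor, ← Matrix.det_transpose, Matrix.det_apply']
  rfl

theorem coeff_perm_term (k : Type) [Field k] {n d : ℕ} {c : Fin d → Fin (n + d - 1)}
    (hc : StrictMono c) {v : (Fin n × Fin d) →₀ ℕ} (hv : ¬ lexLT n d v (diagExp c))
    {σ : Equiv.Perm (Fin d)} (hσ : σ ≠ 1) :
    coeff v (((Equiv.Perm.sign σ : ℤ) : MvPolynomial (Fin n × Fin d) k) *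
        ∏ j, Mnd k n d j ((c ∘ σ) j)) = 0 := by
  rw [← map_intCast (C (σ := Fin n × Fin d) (R := k)), coeff_C_mul]
  rcases prod_Mnd_eq_zero_or k (c ∘ σ) with h | h
  · rw [h, coeff_zero, mul_zero]
  · rw [h, coeff_monomial, if_neg, mul_zero]
    rintro rfl
    exact hv (diagExp_perm_lt hc hσ)

theorem coeff_minor (k : Type) [Field k] {n d : ℕ} {c : Fin d → Fin (n + d - 1)}
    (hc : StrictMono c) {v : (Fin n × Fin d) →₀ ℕ} (hv : ¬ lexLT n d v (diagExp c)) :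
    coeff v (minor k c) = coeff v (monomial (diagExp c) (1 : k)) := by
  choose i hi using exists_row_index hc
  rw [minor_eq_sum, coeff_sum,
    Finset.sum_eq_single 1 (fun σ _ hσ => coeff_perm_term k hc hv hσ) (by simp)]
  have : ∏ j, Mnd k n d j ((c ∘ (1 : Equiv.Perm (Fin d))) j) = monomial (diagExp c) 1 := by
    rw [monomial_diagExp k hi]
    exact Finset.prod_congr rfl fun j _ => Mnd_of_range k j (c j) (i j) (hi j)
  rw [this]
  simp

theorem lexLT_irrefl {n d : ℕ} (u : (Fin n × Fin d) →₀ ℕ) : ¬ lexLT n d u u := by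
  rw [lexLT_iff]
  exact lt_irrefl _

theorem lexLT_trans {n d : ℕ} {u v w : (Fin n × Fin d) →₀ ℕ} (h : lexLT n d u v)
    (h' : lexLT n d v w) : lexLT n d u w := by
  rw [lexLT_iff] at *
  exact h.trans h'

theorem lexLT_trichotomy {n d : ℕ} (u v : (Fin n × Fin d) →₀ ℕ) :
    lexLT n d u v ∨ u = v ∨ lexLT n d v u := by
  simp only [lexLT_iff]
  rw [← (boxOrder n d).toSyn.injective.eq_iff]
  exact lt_trichotomy _ _

theorem lexLT_add_left {n d : ℕ} {u v : (Fin n × Fin d) →₀ ℕ} (m : (Fin n × Fin d) →₀ ℕ)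
    (h : lexLT n d u v) : lexLT n d (m + u) (m + v) := by
  rw [lexLT_iff] at *
  simpa using h

theorem wellFounded_lexLT (n d : ℕ) : WellFounded (lexLT n d) := by
  have : lexLT n d = InvImage (· < ·) (boxOrder n d).toSyn := by
    ext u v
    exact lexLT_iff u v
  rw [this]
  exact InvImage.wf _ wellFounded_lt

theorem coeff_minor_diagExp (k : Type) [Field k] {n d : ℕ} {c : Fin d → Fin (n + d - 1)}
    (hc : StrictMono c) : coeff (diagExp c) (minor k c) = 1 := by
  rw [coeff_minor k hc (lexLT_irrefl _), coeff_monomial, if_pos rfl]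

theorem lexLT_of_mem_support_minor (k : Type) [Field k] {n d : ℕ} {c : Fin d → Fin (n + d - 1)}
    (hc : StrictMono c) {v : (Fin n × Fin d) →₀ ℕ} (hv : v ∈ (minor k c).support)
    (hne : v ≠ diagExp c) : lexLT n d v (diagExp c) := by
  by_contra h
  rw [mem_support_iff, coeff_minor k hc h, coeff_monomial, if_neg hne.symm] at hv
  exact hv rfl

/-- The `k`-span of those products of a monomial and a maximal minor whose leading exponent
lies in `S`. -/
def minorSpan (k : Type) [Field k] {n d : ℕ} (S : Set ((Fin n × Fin d) →₀ ℕ)) :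
    Submodule k (MvPolynomial (Fin n × Fin d) k) :=
  Submodule.span k {f | ∃ c : Fin d → Fin (n + d - 1), StrictMono c ∧
    ∃ m, m + diagExp c ∈ S ∧ f = monomial m 1 * minor k c}

theorem monomial_mul_minor_mem {k : Type} [Field k] {n d : ℕ} {S : Set ((Fin n × Fin d) →₀ ℕ)}
    {c : Fin d → Fin (n + d - 1)} (hc : StrictMono c) {m : (Fin n × Fin d) →₀ ℕ}
    (h : m + diagExp c ∈ S) : monomial m 1 * minor k c ∈ minorSpan k S :=
  Submodule.subset_span ⟨c, hc, m, h, rfl⟩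

theorem minorSpan_mono {k : Type} [Field k] {n d : ℕ} {S T : Set ((Fin n × Fin d) →₀ ℕ)}
    (h : S ⊆ T) : minorSpan k S ≤ minorSpan k T :=
  Submodule.span_mono fun _ ⟨c, hc, m, hm, hf⟩ => ⟨c, hc, m, h hm, hf⟩

/-- A row of `M_{nd}` expanded against the maximal minors on `d + 1` columns gives zero. -/
theorem sum_row_mul_minor (k : Type) [Field k] {n d : ℕ} (C : Fin (d + 1) → Fin (n + d - 1))
    (j : Fin d) :
    ∑ l : Fin (d + 1), (-1) ^ (l : ℕ) * Mnd k n d j (C l) * minor k (C ∘ l.succAbove) = 0 := by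
  let A : Matrix (Fin (d + 1)) (Fin (d + 1)) (MvPolynomial (Fin n × Fin d) k) :=
    Matrix.of (Fin.cons (fun l => Mnd k n d j (C l)) fun r l => Mnd k n d r (C l))
  have h0 : A.det = 0 :=
    Matrix.det_zero_of_row_eq (i := 0) (j := j.succ) (Fin.succ_ne_zero j).symm rfl
  rw [Matrix.det_succ_row_zero] at h0
  exact h0

/-- Two column sets differing in one place are the two ways of deleting one of two adjacent
columns from a set of `d + 1` columns. -/
theorem exists_common_columns {d N : ℕ} {c c' : Fin d → Fin N} (hc : StrictMono c)
    (hc' : StrictMono c') {t : Fin d} (hne : ∀ l, l ≠ t → c' l = c l) (ht : c' t < c t) :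
    ∃ C : Fin (d + 1) → Fin N, StrictMono C ∧ (∀ l ≤ t, C l.castSucc = c' l) ∧
      (∀ l, t ≤ l → C l.succ = c l) ∧ C ∘ t.castSucc.succAbove = c ∧
      C ∘ t.succ.succAbove = c' := by
  let C : Fin (d + 1) → Fin N := fun l =>
    if h : (l : ℕ) ≤ t then c' ⟨l, by omega⟩ else c ⟨l - 1, by omega⟩
  have h1 : ∀ l ≤ t, C l.castSucc = c' l := fun l hl => dif_pos (Fin.le_def.mp hl)
  have h2 : ∀ l, t ≤ l → C l.succ = c l := fun l hl =>
    dif_neg (by rw [Fin.le_def] at hl; simp only [Fin.val_succ]; omega)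
  refine ⟨C, Fin.strictMono_iff_lt_succ.mpr fun l => ?_, h1, h2, ?_, ?_⟩
  · rcases lt_trichotomy l t with h | h | h
    · rw [Fin.lt_def] at h
      have h3 : C l.succ = c' ⟨l + 1, by omega⟩ := h1 ⟨l + 1, by omega⟩ (Fin.le_def.mpr h)
      rw [h1 l h.le, h3]
      exact hc' (Nat.lt_succ_self _)
    · subst h
      rw [h1 l le_rfl, h2 l le_rfl]
      exact ht
    · rw [Fin.lt_def] at h
      have h3 : C l.castSucc = c ⟨l - 1, by omega⟩ := dif_neg (not_le.mpr h)
      rw [h2 l h.le, h3]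
      refine hc ?_
      rw [Fin.lt_def]
      simp only
      omega
  · funext r
    rcases lt_or_ge r t with h | h
    · rw [Function.comp, Fin.succAbove_of_castSucc_lt _ _ (Fin.castSucc_lt_castSucc_iff.mpr h),
        h1 r h.le, hne r h.ne]
    · rw [Function.comp, Fin.succAbove_of_le_castSucc _ _ (Fin.castSucc_le_castSucc_iff.mpr h),
        h2 r h]
  · funext r
    rcases le_or_gt r t with h | h
    · rw [Function.comp, Fin.succAbove_of_castSucc_lt _ _ (Fin.castSucc_lt_succ_iff.mpr h), h1 r h]
    · rw [Function.comp, Fin.succAbove_of_le_castSucc _ _ (Fin.succ_le_castSucc_iff.mpr h),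
        h2 r h.le, hne r h.ne']

/-- In the relation `sum_row_mul_minor` for row `t`, all terms other than those deleting the
columns numbered `t` and `t + 1` have smaller exponents. -/
theorem syzygy_term_lt {n d : ℕ} {c c' : Fin d → Fin (n + d - 1)} (hc : StrictMono c)
    (hc' : StrictMono c') {t : Fin d} (ht : c' t < c t)
    {C : Fin (d + 1) → Fin (n + d - 1)} (hC : StrictMono C)
    (h1 : ∀ l ≤ t, C l.castSucc = c' l) (h2 : ∀ l, t ≤ l → C l.succ = c l)
    {l : Fin (d + 1)} (hl : l ≠ t.castSucc) (hl' : l ≠ t.succ) :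
    lexLT n d (entryExp t (C l) + diagExp (C ∘ l.succAbove))
      (entryExp t (c' t) + diagExp c) := by
  rw [Ne, Fin.ext_iff] at hl hl'
  simp only [Fin.val_castSucc, Fin.val_succ] at hl hl'
  rw [Fin.lt_def] at ht
  rcases lt_or_ge (l : ℕ) t with h | h
  · have habove : ∀ r, t ≤ r → C (l.succAbove r) = c r := fun r hr => by
      rw [Fin.le_def] at hr
      rw [Fin.succAbove_of_le_castSucc, h2 r hr]
      rw [Fin.le_def, Fin.val_castSucc]
      omega
    have hlt : (C l : ℕ) < c' t := by
      rw [← h1 t le_rfl]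
      exact hC h
    obtain ⟨i, hi⟩ := exists_row_index hc' t
    refine lexLT_of_row i t ?_ ?_ ?_
    · simp only [Finsupp.add_apply, diagExp_apply, entryExp_apply, Function.comp,
        habove t le_rfl, true_and]
      rw [if_neg (by omega), if_neg (by omega), if_pos hi]
      exact zero_lt_one
    · intro i' hi'
      rw [Fin.lt_def] at hi'
      simp only [Finsupp.add_apply, diagExp_apply, entryExp_apply, Function.comp,
        habove t le_rfl, true_and]
      rw [if_neg (by omega : ¬ (C l : ℕ) = i' + t), if_neg (by omega : ¬ (c' t : ℕ) = i' + t)]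
    · intro i' r hr
      simp only [Finsupp.add_apply, diagExp_apply, entryExp_apply, Function.comp,
        habove r hr.le, hr.ne', false_and]
  · have hld := l.2
    obtain ⟨s, rfl⟩ : ∃ s : Fin d, l = s.succ :=
      ⟨⟨l - 1, by omega⟩, by ext; simp only [Fin.val_succ]; omega⟩
    simp only [Fin.val_succ] at h hl hl'
    have hts : t < s := by
      rw [Fin.lt_def]
      omega
    have hrow : (C (s.succ.succAbove s) : ℕ) < c s := by
      rw [Fin.succAbove_of_castSucc_lt _ _ Fin.castSucc_lt_succ, ← h2 s hts.le]
      exact hC Fin.castSucc_lt_succ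
    have habove : ∀ r, s < r → C (s.succ.succAbove r) = c r := fun r hr => by
      rw [Fin.succAbove_of_le_castSucc _ _ (Fin.succ_le_castSucc_iff.mpr hr),
        h2 r (hts.trans hr).le]
    obtain ⟨i, hi⟩ := exists_row_index hc s
    refine lexLT_of_row i s ?_ ?_ ?_
    · simp only [Finsupp.add_apply, diagExp_apply, entryExp_apply, Function.comp, hts.ne',
        false_and, if_false, zero_add]
      rw [if_neg (by omega), if_pos hi]
      exact zero_lt_one
    · intro i' hi'
      rw [Fin.lt_def] at hi'
      simp only [Finsupp.add_apply, diagExp_apply, entryExp_apply, Function.comp, hts.ne',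
        false_and, if_false, zero_add]
      rw [if_neg (by omega), if_neg (by omega)]
    · intro i' r hr
      simp only [Finsupp.add_apply, diagExp_apply, entryExp_apply, Function.comp,
        habove r hr, (hts.trans hr).ne', false_and]

theorem diagExp_add_entryExp {n d : ℕ} {c c' : Fin d → Fin (n + d - 1)} {t : Fin d}
    (hne : ∀ l, l ≠ t → c' l = c l) :
    diagExp c + entryExp t (c' t) = diagExp c' + entryExp t (c t) := by
  ext ⟨i, l⟩
  simp only [Finsupp.add_apply, diagExp_apply, entryExp_apply]
  by_cases h : l = t
  · subst h
    simp only [true_and]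
    exact add_comm _ _
  · simp only [h, false_and, hne l h]

theorem diagExp_add_entryExp_le {n d : ℕ} {c c' : Fin d → Fin (n + d - 1)} {t : Fin d}
    (ht : c' t < c t) {w : (Fin n × Fin d) →₀ ℕ} (hw : diagExp c ≤ w) (hw' : diagExp c' ≤ w) :
    diagExp c + entryExp t (c' t) ≤ w := by
  rintro ⟨i, l⟩
  have h1 := hw (i, l)
  have h2 := hw' (i, l)
  rw [Fin.lt_def] at ht
  simp only [Finsupp.add_apply, diagExp_apply, entryExp_apply] at *
  by_cases h : l = t ∧ (c' t : ℕ) = i + l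
  · obtain ⟨rfl, h⟩ := h
    rw [if_pos h] at h2
    rw [if_neg (by omega), if_pos ⟨rfl, h⟩]
    omega
  · rw [if_neg h]
    exact h1

/-- Exchanging one column changes a multiple of a minor with leading exponent `w` only by
terms of smaller leading exponent. -/
theorem exchange_mem {k : Type} [Field k] {n d : ℕ} {c c' : Fin d → Fin (n + d - 1)}
    (hc : StrictMono c) (hc' : StrictMono c') {t : Fin d} (hne : ∀ l, l ≠ t → c' l = c l)
    (ht : c' t < c t) {w : (Fin n × Fin d) →₀ ℕ} (hw : diagExp c ≤ w) (hw' : diagExp c' ≤ w) :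
    monomial (w - diagExp c) 1 * minor k c - monomial (w - diagExp c') 1 * minor k c' ∈
      minorSpan k {u | lexLT n d u w} := by
  obtain ⟨C, hC, h1, h2, hCc, hCc'⟩ := exists_common_columns hc hc' hne ht
  have heq := diagExp_add_entryExp hne
  obtain ⟨m, rfl⟩ := exists_add_of_le (diagExp_add_entryExp_le ht hw hw')
  have hm : diagExp c + entryExp t (c' t) + m - diagExp c = m + entryExp t (c' t) := by
    rw [add_assoc, add_tsub_cancel_left, add_comm]
  have hm' : diagExp c + entryExp t (c' t) + m - diagExp c' = m + entryExp t (c t) := by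
    rw [heq, add_assoc, add_tsub_cancel_left, add_comm]
  rw [hm, hm']
  obtain ⟨i, hi⟩ := exists_row_index hc t
  obtain ⟨i', hi'⟩ := exists_row_index hc' t
  have hrel := sum_row_mul_minor k C t
  have hmem : t.succ ∈ Finset.univ.erase t.castSucc := by simp [Fin.castSucc_lt_succ.ne']
  rw [← Finset.add_sum_erase _ _ (Finset.mem_univ t.castSucc), ← Finset.add_sum_erase _ _ hmem,
    hCc, hCc', h1 t le_rfl, h2 t le_rfl, Mnd_of_range_monomial k t _ i hi,
    Mnd_of_range_monomial k t _ i' hi', Fin.val_succ, Fin.val_castSucc, ← add_assoc] at hrel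
  set R := ∑ l ∈ (Finset.univ.erase t.castSucc).erase t.succ,
    (-1) ^ (l : ℕ) * Mnd k n d t (C l) * minor k (C ∘ l.succAbove) with hR
  have hRmem : monomial m 1 * R ∈
      minorSpan k {u | lexLT n d u (diagExp c + entryExp t (c' t) + m)} := by
    rw [hR, Finset.mul_sum]
    refine Submodule.sum_mem _ fun l hl => ?_
    simp only [Finset.mem_erase, Finset.mem_univ, and_true] at hl
    rcases Mnd_eq_zero_or k t (C l) with h0 | h0
    · simp [h0]
    · have hmm : monomial (m + entryExp t (C l)) 1 * minor k (C ∘ l.succAbove) ∈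
          minorSpan k {u | lexLT n d u (diagExp c + entryExp t (c' t) + m)} := by
        refine monomial_mul_minor_mem (hC.comp (Fin.strictMono_succAbove l)) ?_
        have := lexLT_add_left m (syzygy_term_lt hc hc' ht hC h1 h2 hl.2 hl.1)
        rw [Set.mem_ofPred_eq, add_assoc, add_comm (diagExp c + _) m, add_comm (diagExp c)]
        exact this
      have hsplit : monomial (m + entryExp t (C l)) (1 : k) =
          monomial m 1 * monomial (entryExp t (C l)) 1 := by
        rw [monomial_mul, one_mul]
      rw [hsplit] at hmm
      rw [h0]
      rcases neg_one_pow_eq_or (MvPolynomial (Fin n × Fin d) k) (l : ℕ) with h | h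
      · rw [h, one_mul, ← mul_assoc]
        exact hmm
      · rw [h, neg_one_mul, neg_mul, mul_neg, ← mul_assoc]
        exact Submodule.neg_mem _ hmm
  have hsplit : ∀ e : (Fin n × Fin d) →₀ ℕ,
      monomial (m + e) (1 : k) = monomial m 1 * monomial e 1 := fun e => by
    rw [monomial_mul, one_mul]
  rw [hsplit, hsplit]
  rcases neg_one_pow_eq_or (MvPolynomial (Fin n × Fin d) k) (t : ℕ) with h | h
  · rw [pow_succ, h] at hrel
    convert Submodule.neg_mem _ hRmem using 1
    linear_combination (monomial m 1) * hrel
  · rw [pow_succ, h] at hrel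
    convert hRmem using 1
    linear_combination (-monomial m 1) * hrel

theorem sub_mem_of_agree {k : Type} [Field k] {n d : ℕ} {w : (Fin n × Fin d) →₀ ℕ} (s : ℕ)
    {c c' : Fin d → Fin (n + d - 1)} (hc : StrictMono c) (hc' : StrictMono c')
    (hagree : ∀ l : Fin d, (l : ℕ) + s < d → c l = c' l)
    (hw : diagExp c ≤ w) (hw' : diagExp c' ≤ w) :
    monomial (w - diagExp c) 1 * minor k c - monomial (w - diagExp c') 1 * minor k c' ∈
      minorSpan k {u | lexLT n d u w} := by
  induction s generalizing c c' with
  | zero =>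
    obtain rfl : c = c' := funext fun l => hagree l l.2
    rw [sub_self]
    exact Submodule.zero_mem _
  | succ s ih =>
    by_cases hs : d ≤ s
    · exact ih hc hc' (fun l hl => by omega) hw hw'
    push Not at hs
    let t : Fin d := ⟨d - 1 - s, by omega⟩
    have hbefore : ∀ l < t, c l = c' l := fun l hl => hagree l (by
      have : (l : ℕ) < d - 1 - s := hl
      omega)
    have hfirst : ∀ l : Fin d, (l : ℕ) + s < d → l ≤ t := fun l hl => by
      rw [Fin.le_def]
      simp only [t]
      omega
    have main : ∀ {a b : Fin d → Fin (n + d - 1)}, StrictMono a → StrictMono b →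
        (∀ l < t, a l = b l) → b t < a t → diagExp a ≤ w → diagExp b ≤ w →
        monomial (w - diagExp a) 1 * minor k a - monomial (w - diagExp b) 1 * minor k b ∈
          minorSpan k {u | lexLT n d u w} := by
      intro a b ha hb hab hlt hwa hwb
      let e := Function.update a t (b t)
      have het : e t = b t := Function.update_self _ _ _
      have hel : ∀ l, l ≠ t → e l = a l := fun l hl => Function.update_of_ne hl _ _
      have he : StrictMono e := by
        intro p q hpq
        by_cases hp : p = t
        · subst hp
          rw [het, hel q hpq.ne']
          exact hlt.trans (ha hpq)
        · by_cases hq : q = t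
          · subst hq
            rw [het, hel p hp, hab p hpq]
            exact hb hpq
          · rw [hel p hp, hel q hq]
            exact ha hpq
      have hwe : diagExp e ≤ w := by
        rintro ⟨i, l⟩
        have h1 := hwa (i, l)
        have h2 := hwb (i, l)
        rw [diagExp_apply] at *
        by_cases hl : l = t
        · subst hl
          rw [het]
          exact h2
        · rw [hel l hl]
          exact h1
      have h1 := exchange_mem (k := k) ha he hel (het ▸ hlt) hwa hwe
      have h2 := ih he hb (fun l hl => by
        rcases (hfirst l hl).lt_or_eq with h | h
        · rw [hel l h.ne, hab l h]
        · rw [h, het]) hwe hwb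
      simpa using Submodule.add_mem _ h1 h2
    rcases lt_trichotomy (c t) (c' t) with h | h | h
    · have := main hc' hc (fun l hl => (hbefore l hl).symm) h hw' hw
      simpa using Submodule.neg_mem _ this
    · refine ih hc hc' (fun l hl => ?_) hw hw'
      rcases (hfirst l hl).lt_or_eq with h' | h'
      · exact hbefore l h'
      · rw [h', h]
    · exact main hc hc' hbefore h hw hw'

/-- Any two monomial multiples of minors with the same leading exponent agree up to terms of
smaller leading exponent. -/
theorem sub_mem_minorSpan_lt {k : Type} [Field k] {n d : ℕ} {w : (Fin n × Fin d) →₀ ℕ}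
    {c c' : Fin d → Fin (n + d - 1)} (hc : StrictMono c) (hc' : StrictMono c')
    (hw : diagExp c ≤ w) (hw' : diagExp c' ≤ w) :
    monomial (w - diagExp c) 1 * minor k c - monomial (w - diagExp c') 1 * minor k c' ∈
      minorSpan k {u | lexLT n d u w} :=
  sub_mem_of_agree d hc hc' (fun l hl => by omega) hw hw'

theorem coeff_eq_zero_of_mem_minorSpan {k : Type} [Field k] {n d : ℕ}
    {w v : (Fin n × Fin d) →₀ ℕ} {f : MvPolynomial (Fin n × Fin d) k}
    (hf : f ∈ minorSpan k {u | lexLT n d u w}) (hv : ¬ lexLT n d v w) : coeff v f = 0 := by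
  induction hf using Submodule.span_induction with
  | mem f hf =>
    obtain ⟨c, hc, m, hm, rfl⟩ := hf
    rw [coeff_monomial_mul', one_mul]
    split_ifs with hle
    · by_contra h
      obtain ⟨e, rfl⟩ := exists_add_of_le hle
      rw [add_tsub_cancel_left] at h
      by_cases he : e = diagExp c
      · subst he
        exact hv hm
      · exact hv (lexLT_trans (lexLT_add_left m
          (lexLT_of_mem_support_minor k hc (mem_support_iff.mpr h) he)) hm)
    · rfl
  | zero => exact coeff_zero _
  | add f g _ _ hf hg => rw [coeff_add, hf, hg, add_zero]
  | smul a f _ hf => rw [coeff_smul, hf, smul_zero]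

theorem eq_zero_or_exists_mem_minorSpan_le {k : Type} [Field k] {n d : ℕ}
    {S : Set ((Fin n × Fin d) →₀ ℕ)} {f : MvPolynomial (Fin n × Fin d) k}
    (hf : f ∈ minorSpan k S) :
    f = 0 ∨ ∃ w ∈ S, f ∈ minorSpan k {u | u = w ∨ lexLT n d u w} := by
  induction hf using Submodule.span_induction with
  | mem f hf =>
    obtain ⟨c, hc, m, hm, rfl⟩ := hf
    exact Or.inr ⟨m + diagExp c, hm, monomial_mul_minor_mem hc (Or.inl rfl)⟩
  | zero => exact Or.inl rfl
  | add f g _ _ hf hg =>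
    rcases hf with rfl | ⟨w, hw, hf⟩
    · rwa [zero_add]
    rcases hg with rfl | ⟨w', hw', hg⟩
    · rw [add_zero]
      exact Or.inr ⟨w, hw, hf⟩
    right
    have mono : ∀ {a b : (Fin n × Fin d) →₀ ℕ}, lexLT n d a b →
        {u | u = a ∨ lexLT n d u a} ⊆ {u | u = b ∨ lexLT n d u b} := by
      rintro a b hab u (rfl | hu)
      · exact Or.inr hab
      · exact Or.inr (lexLT_trans hu hab)
    rcases lexLT_trichotomy w w' with h | rfl | h
    · exact ⟨w', hw', Submodule.add_mem _ (minorSpan_mono (mono h) hf) hg⟩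
    · exact ⟨w, hw, Submodule.add_mem _ hf hg⟩
    · exact ⟨w, hw, Submodule.add_mem _ hf (minorSpan_mono (mono h) hg)⟩
  | smul a f _ hf =>
    rcases hf with rfl | ⟨w, hw, hf⟩
    · exact Or.inl (smul_zero a)
    · exact Or.inr ⟨w, hw, Submodule.smul_mem _ a hf⟩

theorem mul_mem_minorSpan_univ {k : Type} [Field k] {n d : ℕ}
    (p : MvPolynomial (Fin n × Fin d) k) {f : MvPolynomial (Fin n × Fin d) k}
    (hf : f ∈ minorSpan k (n := n) (d := d) Set.univ) :
    p * f ∈ minorSpan k (n := n) (d := d) Set.univ := by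
  induction hf using Submodule.span_induction with
  | mem f hf =>
    obtain ⟨c, hc, m, hm, rfl⟩ := hf
    induction p using MvPolynomial.induction_on' with
    | monomial u a =>
      have : monomial u a * (monomial m 1 * minor k c) =
          a • (monomial (u + m) 1 * minor k c) := by
        rw [← mul_assoc, monomial_mul, mul_one, ← smul_mul_assoc, smul_monomial, smul_eq_mul,
          mul_one]
      rw [this]
      exact Submodule.smul_mem _ a (monomial_mul_minor_mem hc trivial)
    | add p q hp hq =>
      rw [add_mul]
      exact Submodule.add_mem _ hp hq
  | zero => simp
  | add f g _ _ hf hg =>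
    rw [mul_add]
    exact Submodule.add_mem _ hf hg
  | smul a f _ hf =>
    rw [mul_smul_comm]
    exact Submodule.smul_mem _ a hf

theorem mem_minorSpan_univ {k : Type} [Field k] {n d : ℕ} {f : MvPolynomial (Fin n × Fin d) k}
    (hf : f ∈ minorsIdeal k n d) : f ∈ minorSpan k (n := n) (d := d) Set.univ := by
  induction hf using Submodule.span_induction with
  | mem f hf =>
    obtain ⟨c, hc, rfl⟩ := hf
    have := monomial_mul_minor_mem (k := k) hc (m := 0) (S := Set.univ) trivial
    rwa [monomial_zero', C_1, one_mul] at this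
  | zero => exact Submodule.zero_mem _
  | add f g _ _ hf hg => exact Submodule.add_mem _ hf hg
  | smul a f _ hf => exact mul_mem_minorSpan_univ a hf

/-- The leading exponent of an element of the `k`-span of monomial multiples of minors is
divisible by the leading exponent of a minor. -/
theorem exists_diagExp_le {k : Type} [Field k] {n d : ℕ} (w : (Fin n × Fin d) →₀ ℕ)
    {f : MvPolynomial (Fin n × Fin d) k} (hf : f ∈ minorSpan k {u | u = w ∨ lexLT n d u w})
    {u : (Fin n × Fin d) →₀ ℕ} (hu : u ∈ f.support)
    (hmax : ∀ v ∈ f.support, v ≠ u → lexLT n d v u) :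
    ∃ c : Fin d → Fin (n + d - 1), StrictMono c ∧ diagExp c ≤ u := by
  induction w using (wellFounded_lexLT n d).induction generalizing f with
  | _ w ih =>
    have hlower : f ∈ minorSpan k {u | lexLT n d u w} →
        ∃ c : Fin d → Fin (n + d - 1), StrictMono c ∧ diagExp c ≤ u := fun h => by
      rcases eq_zero_or_exists_mem_minorSpan_le h with rfl | ⟨w', hw', hf'⟩
      · simp at hu
      · exact ih w' hw' hf' hu hmax
    by_cases hex : ∃ c : Fin d → Fin (n + d - 1), StrictMono c ∧ diagExp c ≤ w
    · obtain ⟨c, hc, hcw⟩ := hex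
      have hle : minorSpan k {u | u = w ∨ lexLT n d u w} ≤
          minorSpan k {u | lexLT n d u w} ⊔
            Submodule.span k {monomial (w - diagExp c) 1 * minor k c} := by
        refine Submodule.span_le.mpr ?_
        rintro _ ⟨c', hc', m, rfl | hm, rfl⟩
        · have h := sub_mem_minorSpan_lt (k := k) hc' hc le_add_self hcw
          rw [add_tsub_cancel_right] at h
          rw [← sub_add_cancel (monomial m 1 * minor k c')]
          exact Submodule.add_mem_sup h (Submodule.mem_span_singleton_self _)
        · exact Submodule.mem_sup_left (monomial_mul_minor_mem hc' hm)
      obtain ⟨g, hg, h, hh, rfl⟩ := Submodule.mem_sup.mp (hle hf)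
      obtain ⟨a, rfl⟩ := Submodule.mem_span_singleton.mp hh
      by_cases ha : a = 0
      · exact hlower (by rwa [ha, zero_smul, add_zero])
      · have hcoeff : coeff w (g + a • (monomial (w - diagExp c) 1 * minor k c)) = a := by
          have h1 : coeff w (monomial (w - diagExp c) 1 * minor k c) = 1 := by
            rw [coeff_monomial_mul', if_pos tsub_le_self, tsub_tsub_cancel_of_le hcw,
              coeff_minor_diagExp k hc, one_mul]
          rw [coeff_add, coeff_eq_zero_of_mem_minorSpan hg (lexLT_irrefl w), coeff_smul, h1,
            zero_add, smul_eq_mul, mul_one]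
        have hwu : w = u := by
          by_contra hne
          have hlt := hmax w (by rwa [mem_support_iff, hcoeff]) hne
          refine mem_support_iff.mp hu (coeff_eq_zero_of_mem_minorSpan
            (minorSpan_mono ?_ hf) (lexLT_irrefl u))
          rintro v (rfl | hv)
          · exact hlt
          · exact lexLT_trans hv hlt
        exact ⟨c, hc, hwu ▸ hcw⟩
    · refine hlower (Submodule.span_mono ?_ hf)
      rintro _ ⟨c', hc', m, rfl | hm, rfl⟩
      · exact absurd ⟨c', hc', le_add_self⟩ hex
      · exact ⟨c', hc', m, hm, rfl⟩

theorem statement4 (k : Type) [Field k] (n d : ℕ) :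
    initialIdeal k n d (minorsIdeal k n d) = BoxIdeal k n d := by
  refine le_antisymm (Ideal.span_le.mpr ?_) (Ideal.span_le.mpr ?_)
  · rintro _ ⟨f, hf, -, u, hu, hmax, rfl⟩
    obtain ⟨c, hc, hcu⟩ : ∃ c : Fin d → Fin (n + d - 1), StrictMono c ∧ diagExp c ≤ u := by
      rcases eq_zero_or_exists_mem_minorSpan_le (mem_minorSpan_univ hf) with rfl | ⟨w, -, hw⟩
      · simp at hu
      · exact exists_diagExp_le w hw hu hmax
    choose i hi using exists_row_index hc
    obtain ⟨m, rfl⟩ := exists_add_of_le hcu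
    have hsplit : monomial (diagExp c + m) (1 : k) = monomial m 1 * ∏ j, X (i j, j) := by
      rw [← monomial_diagExp k hi, monomial_mul, one_mul, add_comm]
    rw [hsplit]
    refine Ideal.mul_mem_left _ _ (Ideal.subset_span ⟨i, fun a b hab => ?_, rfl⟩)
    have h := add_le_of_strictMono hc hab
    rw [hi, hi] at h
    rw [Fin.le_def]
    omega
  · rintro _ ⟨i, hmono, rfl⟩
    let c : Fin d → Fin (n + d - 1) := fun j => ⟨i j + j, by omega⟩
    have hc : StrictMono c := fun a b hab => by
      have h := hmono hab.le
      rw [Fin.lt_def] at hab ⊢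
      rw [Fin.le_def] at h
      simp only [c]
      omega
    have hmem : diagExp c ∈ (minor k c).support := by
      rw [mem_support_iff, coeff_minor_diagExp k hc]
      exact one_ne_zero
    refine Ideal.subset_span ⟨minor k c, Ideal.subset_span ⟨c, hc, rfl⟩, ?_, diagExp c, hmem,
      fun v hv hne => lexLT_of_mem_support_minor k hc hv hne,
      (monomial_diagExp k fun _ => rfl).symm⟩
    rintro h
    simp [h] at hmem

end
end
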